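/- For any planar simple graph G and any integer k ≥ 1, the k-frugal chromatic number satisfies χ_k(G) ≤ ⌈(5·Δ(G) + 180)/(3k)⌉ + 18. -/

import Mathlib

open SimpleGraph

/-- A drawing of a simple graph in the plane: vertices are mapped to distinct points,
edges to arcs (injective continuous curves parametrised on `[0,1]`) joining the images of
their endpoints, whose interiors avoid the vertex points and each other. -/
structure PlaneEmbedding {V : Type*} (G : SimpleGraph V) where
  pos : V → ℝ × ℝ
  inj : Function.Injective pos
  arc : G.edgeSet → ℝ → ℝ × ℝ
  arc_cont : ∀ e, ContinuousOn (arc e) (Set.Icc 0 1)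
  arc_inj : ∀ e, Set.InjOn (arc e) (Set.Icc 0 1)
  arc_ends : ∀ e : G.edgeSet, ∃ u v : V, (e : Sym2 V) = s(u, v) ∧
      arc e 0 = pos u ∧ arc e 1 = pos v
  arc_avoid : ∀ e : G.edgeSet, ∀ t ∈ Set.Ioo (0:ℝ) 1, arc e t ∉ Set.range pos
  arc_disjoint : ∀ e f : G.edgeSet, e ≠ f → ∀ s ∈ Set.Ioo (0:ℝ) 1, ∀ t ∈ Set.Ioo (0:ℝ) 1,
      arc e s ≠ arc f t

/-- A graph is planar if it admits a drawing in the plane. -/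
def SimpleGraph.IsPlanar {V : Type*} (G : SimpleGraph V) : Prop :=
  Nonempty (PlaneEmbedding G)

/-- A `k`-frugal colouring: a proper vertex colouring in which no colour appears more than
`k` times in the neighbourhood of any vertex. -/
def SimpleGraph.IsFrugalColoring {V α : Type*} (G : SimpleGraph V) (k : ℕ) (c : V → α) : Prop :=
  (∀ u v, G.Adj u v → c u ≠ c v) ∧
  ∀ (v : V) (a : α), {u | u ∈ G.neighborSet v ∧ c u = a}.ncard ≤ k

/-- The `k`-frugal chromatic number `χ_k(G)`: the least number of colours in a `k`-frugal
colouring of `G`. -/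
noncomputable def SimpleGraph.frugalChromaticNumber {V : Type*} (G : SimpleGraph V) (k : ℕ) : ℕ :=
  sInf {n : ℕ | ∃ c : V → ℕ, (∀ v, c v < n) ∧ G.IsFrugalColoring k c}

namespace PlanarFrugal

open Relation

theorem reflTransGen_symm {α : Type*} {r : α → α → Prop} (hr : ∀ a b, r a b → r b a) {a b : α}
    (h : ReflTransGen r a b) : ReflTransGen r b a := by
  induction h with
  | refl => exact .refl
  | tail _ h ih => exact ReflTransGen.head (hr _ _ h) ih

/-- A map `φ` exhibits the relation `s` as a minor of the relation `r`: the fibres of `φ` are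
nonempty and `r`-connected, and `s`-related points have `r`-related representatives. -/
structure IsModel {α W : Type*} (r : α → α → Prop) (s : W → W → Prop) (φ : α → Option W) :
    Prop where
  nonempty : ∀ w, ∃ a, φ a = some w
  conn : ∀ w a b, φ a = some w → φ b = some w →
    ReflTransGen (fun x y => r x y ∧ φ x = some w ∧ φ y = some w) a b
  adj : ∀ w w', s w w' → ∃ a b, r a b ∧ φ a = some w ∧ φ b = some w'

theorem IsModel.comp {α W U : Type*} {r : α → α → Prop} {s : W → W → Prop} {t : U → U → Prop}
    {φ : α → Option W} {ψ : W → Option U} (hφ : IsModel r s φ) (hψ : IsModel s t ψ) :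
    IsModel r t (fun a => (φ a).bind ψ) := by
  have key : ∀ {a u}, (φ a).bind ψ = some u ↔ ∃ w, φ a = some w ∧ ψ w = some u := by
    intro a u; exact Option.bind_eq_some_iff
  refine ⟨fun u => ?_, fun u a b ha hb => ?_, fun u u' h => ?_⟩
  · obtain ⟨w, hw⟩ := hψ.nonempty u
    obtain ⟨a, ha⟩ := hφ.nonempty w
    exact ⟨a, key.2 ⟨w, ha, hw⟩⟩
  · obtain ⟨w, ha, hw⟩ := key.1 ha
    obtain ⟨w', hb, hw'⟩ := key.1 hb
    have inside : ∀ w a b, φ a = some w → φ b = some w → ψ w = some u →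
        ReflTransGen (fun x y => r x y ∧ (φ x).bind ψ = some u ∧ (φ y).bind ψ = some u) a b := by
      intro w a b ha hb hw
      refine ReflTransGen.mono ?_ _ _ (hφ.conn w a b ha hb)
      rintro x y ⟨h1, h2, h3⟩
      exact ⟨h1, key.2 ⟨w, h2, hw⟩, key.2 ⟨w, h3, hw⟩⟩
    have h := hψ.conn u w w' hw hw'
    have gen : ∀ b, φ b = some w' → ReflTransGen
        (fun x y => r x y ∧ (φ x).bind ψ = some u ∧ (φ y).bind ψ = some u) a b := by
      clear hw' hb
      induction h with
      | refl => exact fun b hb => inside w a b ha hb hw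
      | tail _ h2 ih =>
        intro b hb
        obtain ⟨c, d, hcd, hc, hd⟩ := hφ.adj _ _ h2.1
        exact ((ih c hc).tail ⟨hcd, key.2 ⟨_, hc, h2.2.1⟩, key.2 ⟨_, hd, h2.2.2⟩⟩).trans
          (inside _ _ _ hd hb h2.2.2)
    exact gen b hb
  · obtain ⟨w, w', h1, h2, h3⟩ := hψ.adj u u' h
    obtain ⟨a, b, h4, h5, h6⟩ := hφ.adj w w' h1
    exact ⟨a, b, h4, key.2 ⟨w, h5, h2⟩, key.2 ⟨w', h6, h3⟩⟩

/-- Adjacency in the square grid. -/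
def gridAdj (a b : ℤ × ℤ) : Prop :=
  (a.1 = b.1 ∧ (b.2 = a.2 + 1 ∨ a.2 = b.2 + 1)) ∨ (a.2 = b.2 ∧ (b.1 = a.1 + 1 ∨ a.1 = b.1 + 1))

theorem gridAdj_symm {a b : ℤ × ℤ} (h : gridAdj a b) : gridAdj b a := by
  unfold gridAdj at *; omega

/-- The graph `H` is a minor of a finite part of the square grid. -/
def GridMinor {W : Type*} (H : SimpleGraph W) : Prop :=
  ∃ φ : ℤ × ℤ → Option W, IsModel gridAdj H.Adj φ ∧ ∀ w, {a | φ a = some w}.Finite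

theorem GridMinor.of_model {V W : Type*} [Finite V] {G : SimpleGraph V} {H : SimpleGraph W}
    (hG : GridMinor G) {f : V → Option W} (hf : IsModel G.Adj H.Adj f) : GridMinor H := by
  obtain ⟨φ, hφ, hfin⟩ := hG
  refine ⟨_, hφ.comp hf, fun w => ?_⟩
  refine (Set.finite_iUnion (fun v : V => hfin v)).subset ?_
  intro a ha
  obtain ⟨v, hv, -⟩ := Option.bind_eq_some_iff.1 ha
  exact Set.mem_iUnion.2 ⟨v, hv⟩

/-- Connected vertex sets `A v` joined by connected edge sets `B e` form a minor model. -/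
theorem exists_isModel_of_regions {α V E : Type*} {r : α → α → Prop}
    (hr : ∀ a b, r a b → r b a) (A : V → Set α) (B : E → Set α) (src tgt : E → V)
    (hne : ∀ v, (A v).Nonempty)
    (hAc : ∀ v, ∀ a ∈ A v, ∀ b ∈ A v,
      ReflTransGen (fun x y => r x y ∧ x ∈ A v ∧ y ∈ A v) a b)
    (hBc : ∀ e, ∀ a ∈ B e, ∀ b ∈ B e,
      ReflTransGen (fun x y => r x y ∧ x ∈ B e ∧ y ∈ B e) a b)
    (hA : ∀ u v, u ≠ v → Disjoint (A u) (A v)) (hB : ∀ e f, e ≠ f → Disjoint (B e) (B f))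
    (hAB : ∀ v e, v ≠ src e → v ≠ tgt e → Disjoint (A v) (B e))
    (hst : ∀ e, src e ≠ tgt e)
    (hs : ∀ e, (A (src e) ∩ B e).Nonempty) (ht : ∀ e, (A (tgt e) ∩ B e).Nonempty)
    (s : V → V → Prop)
    (hE : ∀ u v, s u v → ∃ e, (src e = u ∧ tgt e = v) ∨ (src e = v ∧ tgt e = u)) :
    ∃ φ : α → Option V, IsModel r s φ ∧
      ∀ a v, φ a = some v → a ∈ A v ∨ ∃ e, a ∈ B e := by
  classical
  let C : E → Set α := fun e => {x | x ∈ B e ∧ x ∉ A (tgt e) ∧ ∃ a ∈ A (src e) ∩ B e,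
    ReflTransGen (fun x y => r x y ∧ (x ∈ B e ∧ x ∉ A (tgt e)) ∧ (y ∈ B e ∧ y ∉ A (tgt e))) a x}
  let M : V → Set α := fun v => {x | x ∈ A v ∨ ∃ e, src e = v ∧ x ∈ C e}
  have dis : ∀ u v, u ≠ v → ∀ x, x ∈ A u → x ∉ A v := fun u v h x h1 h2 =>
    Set.disjoint_left.1 (hA u v h) h1 h2
  have CA : ∀ e u x, x ∈ C e → x ∈ A u → u = src e := by
    intro e u x hx hu
    by_contra hne
    by_cases h2 : u = tgt e
    · exact hx.2.1 (h2 ▸ hu)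
    · exact Set.disjoint_left.1 (hAB u e hne h2) hu hx.1
  have Muniq : ∀ u v x, x ∈ M u → x ∈ M v → u = v := by
    rintro u v x (h1 | ⟨e, rfl, h1⟩) (h2 | ⟨f, rfl, h2⟩)
    · by_contra hne; exact dis u v hne x h1 h2
    · exact CA _ _ _ h2 h1
    · exact (CA _ _ _ h1 h2).symm
    · by_contra hne
      exact Set.disjoint_left.1 (hB e f (fun h => hne (h ▸ rfl))) h1.1 h2.1
  let φ : α → Option V := fun x => if h : ∃ v, x ∈ M v then some h.choose else none
  have hφ : ∀ x v, φ x = some v ↔ x ∈ M v := by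
    intro x v
    by_cases h : ∃ v, x ∈ M v
    · simp only [φ, dif_pos h, Option.some.injEq]
      exact ⟨fun h' => h' ▸ h.choose_spec, fun h' => Muniq _ _ _ h.choose_spec h'⟩
    · simp only [φ, dif_neg h, reduceCtorEq, false_iff]
      exact fun h' => h ⟨v, h'⟩
  have srcC : ∀ e x, x ∈ A (src e) → x ∈ B e → x ∈ C e := fun e x h1 h2 =>
    ⟨h2, fun h => dis _ _ (hst e) x h1 h, x, ⟨h1, h2⟩, .refl⟩
  have cross : ∀ e, ∃ x y, r x y ∧ x ∈ C e ∧ y ∈ A (tgt e) := by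
    intro e
    obtain ⟨a, ha1, ha2⟩ := hs e
    obtain ⟨b, hb1, hb2⟩ := ht e
    by_contra hcon
    push Not at hcon
    have : ∀ b, ReflTransGen (fun x y => r x y ∧ x ∈ B e ∧ y ∈ B e) a b → b ∈ C e := by
      intro b hb
      induction hb with
      | refl => exact srcC e a ha1 ha2
      | tail _ h2 ih =>
        rename_i c d _
        have hd : d ∉ A (tgt e) := hcon _ _ h2.1 ih
        obtain ⟨h3, h4, a', h5, h6⟩ := ih
        exact ⟨h2.2.2, hd, a', h5, h6.tail ⟨h2.1, ⟨h3, h4⟩, h2.2.2, hd⟩⟩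
    exact (this b (hBc e a ha2 b hb2)).2.1 hb1
  have symm : ∀ v, ∀ a b, ReflTransGen (fun x y => r x y ∧ φ x = some v ∧ φ y = some v) a b →
      ReflTransGen (fun x y => r x y ∧ φ x = some v ∧ φ y = some v) b a := by
    intro v a b h
    exact reflTransGen_symm (fun x y h => ⟨hr _ _ h.1, h.2.2, h.2.1⟩) h
  have base : ∀ v x, x ∈ M v → ∃ a ∈ A v,
      ReflTransGen (fun x y => r x y ∧ φ x = some v ∧ φ y = some v) a x := by
    rintro v x (h | ⟨e, rfl, h1, h2, a, ⟨h3, h3'⟩, h4⟩)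
    · exact ⟨x, h, .refl⟩
    · refine ⟨a, h3, ?_⟩
      have : ∀ x, ReflTransGen (fun x y => r x y ∧ (x ∈ B e ∧ x ∉ A (tgt e)) ∧
          (y ∈ B e ∧ y ∉ A (tgt e))) a x → x ∈ C e ∧
          ReflTransGen (fun x y => r x y ∧ φ x = some (src e) ∧ φ y = some (src e)) a x := by
        intro x hx
        induction hx with
        | refl => exact ⟨srcC e a h3 h3', .refl⟩
        | tail h5 h6 ih =>
          refine ⟨⟨h6.2.2.1, h6.2.2.2, a, ⟨h3, h3'⟩, h5.tail h6⟩, ih.2.tail ⟨h6.1, ?_, ?_⟩⟩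
          · exact (hφ _ _).2 (Or.inr ⟨e, rfl, ih.1⟩)
          · exact (hφ _ _).2 (Or.inr ⟨e, rfl, h6.2.2.1, h6.2.2.2, a, ⟨h3, h3'⟩, h5.tail h6⟩)
      exact (this x h4).2
  refine ⟨φ, ⟨fun v => ?_, fun v a b ha hb => ?_, fun u v h => ?_⟩, fun a v h => ?_⟩
  · obtain ⟨a, ha⟩ := hne v
    exact ⟨a, (hφ _ _).2 (Or.inl ha)⟩
  · obtain ⟨a', ha', h1⟩ := base v a ((hφ _ _).1 ha)
    obtain ⟨b', hb', h2⟩ := base v b ((hφ _ _).1 hb)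
    refine ((symm v _ _ h1).trans ?_).trans h2
    refine ReflTransGen.mono ?_ _ _ (hAc v a' ha' b' hb')
    rintro x y ⟨h1, h2, h3⟩
    exact ⟨h1, (hφ _ _).2 (Or.inl h2), (hφ _ _).2 (Or.inl h3)⟩
  · obtain ⟨e, ⟨rfl, rfl⟩ | ⟨rfl, rfl⟩⟩ := hE u v h <;> obtain ⟨x, y, h1, h2, h3⟩ := cross e
    · exact ⟨x, y, h1, (hφ _ _).2 (Or.inr ⟨e, rfl, h2⟩), (hφ _ _).2 (Or.inl h3)⟩
    · exact ⟨y, x, hr _ _ h1, (hφ _ _).2 (Or.inl h3), (hφ _ _).2 (Or.inr ⟨e, rfl, h2⟩)⟩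
  · rcases (hφ _ _).1 h with h | ⟨e, -, h⟩
    · exact Or.inl h
    · exact Or.inr ⟨e, h.1⟩

end PlanarFrugal

namespace PlanarFrugal

open Relation Topology

/-- Lattice points at sup-distance at most `ε` from `X`, in the lattice of mesh `ε`. -/
def latticeNhd (ε : ℝ) (X : Set (ℝ × ℝ)) : Set (ℤ × ℤ) :=
  {p | ∃ x ∈ X, |ε * p.1 - x.1| ≤ ε ∧ |ε * p.2 - x.2| ≤ ε}

theorem abs_round_sub_le {ε : ℝ} (hε : 0 < ε) (t : ℝ) : |ε * (round (t / ε) : ℤ) - t| ≤ ε / 2 := by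
  have h := abs_sub_round (t / ε)
  have : ε * (round (t / ε) : ℤ) - t = -(ε * (t / ε - round (t / ε))) := by
    field_simp; ring
  rw [this, abs_neg, abs_mul, abs_of_pos hε]
  nlinarith

theorem latticeNhd_nonempty {ε : ℝ} (hε : 0 < ε) {X : Set (ℝ × ℝ)} (hX : X.Nonempty) :
    (latticeNhd ε X).Nonempty := by
  obtain ⟨x, hx⟩ := hX
  refine ⟨(round (x.1 / ε), round (x.2 / ε)), x, hx, ?_, ?_⟩
  · have := abs_round_sub_le hε x.1; dsimp only; linarith
  · have := abs_round_sub_le hε x.2; dsimp only; linarith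

theorem reflTransGen_grid_line {ε s : ℝ} {m n : ℤ} (hm : |ε * m - s| ≤ ε) (hn : |ε * n - s| ≤ ε) :
    ReflTransGen (fun i j : ℤ => (j = i + 1 ∨ i = j + 1) ∧ |ε * i - s| ≤ ε ∧ |ε * j - s| ≤ ε)
      m n := by
  have up : ∀ (d : ℕ) (m : ℤ), |ε * m - s| ≤ ε → |ε * (m + d : ℤ) - s| ≤ ε →
      ReflTransGen (fun i j : ℤ => (j = i + 1 ∨ i = j + 1) ∧ |ε * i - s| ≤ ε ∧ |ε * j - s| ≤ ε)
      m (m + d) := by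
    intro d
    induction d with
    | zero => intro m _ _; simpa using .refl
    | succ d ih =>
      intro m hm hn
      have hε : 0 ≤ ε := (abs_nonneg _).trans hm
      have h1 : |ε * (m + 1 : ℤ) - s| ≤ ε := by
        rw [abs_le] at hm hn ⊢
        push_cast at hn ⊢
        have : 0 ≤ ε * d := by positivity
        constructor <;> nlinarith
      have := ih (m + 1) h1 (by push_cast at hn ⊢; convert hn using 3; ring)
      refine ReflTransGen.head ⟨Or.inl rfl, hm, h1⟩ ?_
      convert this using 1; push_cast; ring
  rcases le_total m n with h | h
  · obtain ⟨d, rfl⟩ := Int.le.dest h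
    exact up d m hm hn
  · obtain ⟨d, rfl⟩ := Int.le.dest h
    exact reflTransGen_symm (fun i j h => ⟨h.1.symm, h.2.2, h.2.1⟩) (up d n hn hm)

theorem latticeNhd_conn_point {ε : ℝ} {X : Set (ℝ × ℝ)} {x : ℝ × ℝ} (hx : x ∈ X) {p q : ℤ × ℤ}
    (hp : |ε * p.1 - x.1| ≤ ε ∧ |ε * p.2 - x.2| ≤ ε)
    (hq : |ε * q.1 - x.1| ≤ ε ∧ |ε * q.2 - x.2| ≤ ε) :
    ReflTransGen (fun a b => gridAdj a b ∧ a ∈ latticeNhd ε X ∧ b ∈ latticeNhd ε X) p q := by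
  have h1 := ReflTransGen.lift (p := fun a b => gridAdj a b ∧ a ∈ latticeNhd ε X ∧
    b ∈ latticeNhd ε X) (fun i : ℤ => (i, p.2))
    (fun i j h => ⟨Or.inr ⟨rfl, h.1⟩, ⟨x, hx, h.2.1, hp.2⟩, ⟨x, hx, h.2.2, hp.2⟩⟩)
    _ _ (reflTransGen_grid_line hp.1 hq.1)
  have h2 := ReflTransGen.lift (p := fun a b => gridAdj a b ∧ a ∈ latticeNhd ε X ∧
    b ∈ latticeNhd ε X) (fun i : ℤ => (q.1, i))
    (fun i j h => ⟨Or.inl ⟨rfl, h.1⟩, ⟨x, hx, hq.1, h.2.1⟩, ⟨x, hx, hq.1, h.2.2⟩⟩)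
    _ _ (reflTransGen_grid_line hp.2 hq.2)
  exact h1.trans h2

theorem latticeNhd_conn {ε : ℝ} (hε : 0 < ε) {X : Set (ℝ × ℝ)} (hX : IsPreconnected X) :
    ∀ p ∈ latticeNhd ε X, ∀ q ∈ latticeNhd ε X,
      ReflTransGen (fun a b => gridAdj a b ∧ a ∈ latticeNhd ε X ∧ b ∈ latticeNhd ε X) p q := by
  rintro p ⟨x, hx, hp⟩ q ⟨y, hy, hq⟩
  let P : ℝ × ℝ → ℝ × ℝ → Prop := fun x y => x ∈ X → y ∈ X → ∀ p q : ℤ × ℤ,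
    |ε * p.1 - x.1| ≤ ε ∧ |ε * p.2 - x.2| ≤ ε → |ε * q.1 - y.1| ≤ ε ∧ |ε * q.2 - y.2| ≤ ε →
    ReflTransGen (fun a b => gridAdj a b ∧ a ∈ latticeNhd ε X ∧ b ∈ latticeNhd ε X) p q
  have rnd : ∀ x : ℝ × ℝ, ∃ p : ℤ × ℤ, |ε * p.1 - x.1| ≤ ε / 2 ∧ |ε * p.2 - x.2| ≤ ε / 2 :=
    fun x => ⟨(round (x.1 / ε), round (x.2 / ε)), abs_round_sub_le hε x.1, abs_round_sub_le hε x.2⟩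
  have : P x y := by
    refine hX.induction₂ P ?_ ?_ ?_ hx hy
    · intro x hx
      have : Metric.ball x (ε / 2) ∈ 𝓝[X] x :=
        mem_nhdsWithin_of_mem_nhds (Metric.ball_mem_nhds x (by positivity))
      filter_upwards [this] with y hy hx hyX p q hp hq
      obtain ⟨c, hc⟩ := rnd x
      have hd : max (dist y.1 x.1) (dist y.2 x.2) < ε / 2 := by
        rw [← Prod.dist_eq]; exact hy
      have hd1 := (le_max_left _ _).trans_lt hd
      have hd2 := (le_max_right _ _).trans_lt hd
      rw [Real.dist_eq] at hd1 hd2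
      refine (latticeNhd_conn_point hx hp (q := c) ?_).trans
        (latticeNhd_conn_point hyX (p := c) ?_ hq)
      · constructor <;> linarith [hc.1, hc.2]
      · constructor
        · have := hc.1; rw [abs_le] at *; rw [abs_lt] at *; constructor <;> linarith
        · have := hc.2; rw [abs_le] at *; rw [abs_lt] at *; constructor <;> linarith
    · intro x y z _ hy _ hxy hyz hx' hz' p q hp hq
      obtain ⟨c, hc⟩ := rnd y
      have hc' : |ε * c.1 - y.1| ≤ ε ∧ |ε * c.2 - y.2| ≤ ε := by
        constructor <;> linarith [hc.1, hc.2]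
      exact (hxy hx' hy p c hp hc').trans (hyz hy hz' c q hc' hq)
    · intro x y _ _ h hy hx p q hp hq
      exact reflTransGen_symm (fun a b h => ⟨gridAdj_symm h.1, h.2.2, h.2.1⟩) (h hx hy q p hq hp)
  exact this hx hy p q hp hq

theorem latticeNhd_finite {ε : ℝ} (hε : 0 < ε) {X : Set (ℝ × ℝ)} (hX : IsCompact X) :
    (latticeNhd ε X).Finite := by
  obtain ⟨C, hC⟩ := hX.isBounded.exists_norm_le
  obtain ⟨n, hn⟩ := exists_nat_ge ((C + ε) / ε)
  have hn' : C + ε ≤ n * ε := by rwa [div_le_iff₀ hε] at hn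
  refine ((Set.finite_Icc (-(n:ℤ)) n).prod (Set.finite_Icc (-(n:ℤ)) n)).subset ?_
  rintro ⟨i, j⟩ ⟨x, hx, h1, h2⟩
  have hxC := hC x hx
  rw [Prod.norm_def] at hxC
  have hx1 := (le_max_left _ _).trans hxC
  have hx2 := (le_max_right _ _).trans hxC
  rw [Real.norm_eq_abs, abs_le] at hx1 hx2
  rw [abs_le] at h1 h2
  have bd : ∀ (i : ℤ) (s : ℝ), -ε ≤ ε * i - s → ε * i - s ≤ ε → -C ≤ s → s ≤ C →
      i ∈ Set.Icc (-(n:ℤ)) n := by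
    intro i s h1 h2 h3 h4
    constructor
    · have : (-(n:ℝ)) ≤ i := by
        by_contra hh
        push Not at hh
        nlinarith
      exact_mod_cast this
    · have : (i:ℝ) ≤ n := by
        by_contra hh
        push Not at hh
        nlinarith
      exact_mod_cast this
  exact ⟨bd i _ h1.1 h1.2 hx1.1 hx1.2, bd j _ h2.1 h2.2 hx2.1 hx2.2⟩

theorem eventually_disjoint_latticeNhd {X Y : Set (ℝ × ℝ)} (hX : IsCompact X) (hY : IsCompact Y)
    (h : Disjoint X Y) : ∀ᶠ ε : ℝ in 𝓝[>] 0, Disjoint (latticeNhd ε X) (latticeNhd ε Y) := by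
  obtain ⟨δ, hδ, hd⟩ := h.exists_thickenings hX hY.isClosed
  have h1 : ∀ᶠ ε : ℝ in 𝓝[>] 0, ε < δ / 2 :=
    Filter.Eventually.filter_mono nhdsWithin_le_nhds (gt_mem_nhds (by positivity))
  filter_upwards [h1] with ε hε
  rw [Set.disjoint_left]
  rintro p ⟨x, hx, hx1, hx2⟩ ⟨y, hy, hy1, hy2⟩
  have key : ∀ z : ℝ × ℝ, |ε * p.1 - z.1| ≤ ε → |ε * p.2 - z.2| ≤ ε →
      dist ((ε * p.1, ε * p.2) : ℝ × ℝ) z < δ := by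
    intro z h1 h2
    rw [Prod.dist_eq, Real.dist_eq, Real.dist_eq]
    exact (max_le h1 h2).trans_lt (by linarith)
  exact Set.disjoint_left.1 hd (Metric.mem_thickening_iff.2 ⟨x, hx, key x hx1 hx2⟩)
    (Metric.mem_thickening_iff.2 ⟨y, hy, key y hy1 hy2⟩)

theorem latticeNhd_mono {ε : ℝ} {X Y : Set (ℝ × ℝ)} (h : X ⊆ Y) :
    latticeNhd ε X ⊆ latticeNhd ε Y := fun _ ⟨x, hx, h'⟩ => ⟨x, h hx, h'⟩

theorem GridMinor.of_isPlanar {V : Type*} [Finite V] {G : SimpleGraph V} (hG : G.IsPlanar) :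
    GridMinor G := by
  classical
  obtain ⟨E⟩ := hG
  choose src tgt hst h0 h1 using E.arc_ends
  have hne : ∀ e, src e ≠ tgt e := by
    intro e h
    have := e.2
    rw [hst e, SimpleGraph.mem_edgeSet, h] at this
    exact G.loopless.irrefl _ this
  let M : V → Set (ℝ × ℝ) := fun v => {E.pos v} ∪ ((⋃ e ∈ {e | src e = v},
    E.arc e '' Set.Icc 0 (1/3)) ∪ ⋃ e ∈ {e | tgt e = v}, E.arc e '' Set.Icc (2/3) 1)
  let K : G.edgeSet → Set (ℝ × ℝ) := fun e => E.arc e '' Set.Icc (1/3) (2/3)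
  have sub0 : Set.Icc (0:ℝ) (1/3) ⊆ Set.Icc 0 1 := Set.Icc_subset_Icc le_rfl (by norm_num)
  have sub1 : Set.Icc (2/3:ℝ) 1 ⊆ Set.Icc 0 1 := Set.Icc_subset_Icc (by norm_num) le_rfl
  have subm : Set.Icc (1/3:ℝ) (2/3) ⊆ Set.Icc 0 1 := Set.Icc_subset_Icc (by norm_num) (by norm_num)
  have Mmem : ∀ v x, x ∈ M v ↔ x = E.pos v ∨ (∃ e, src e = v ∧ ∃ t ∈ Set.Icc (0:ℝ) (1/3),
      E.arc e t = x) ∨ ∃ e, tgt e = v ∧ ∃ t ∈ Set.Icc (2/3:ℝ) 1, E.arc e t = x := by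
    intro v x
    simp [M]
  have Mcpt : ∀ v, IsCompact (M v) := by
    intro v
    refine isCompact_singleton.union (IsCompact.union ?_ ?_)
    · exact (Set.toFinite _).isCompact_biUnion fun e _ =>
        isCompact_Icc.image_of_continuousOn ((E.arc_cont e).mono sub0)
    · exact (Set.toFinite _).isCompact_biUnion fun e _ =>
        isCompact_Icc.image_of_continuousOn ((E.arc_cont e).mono sub1)
  have Kcpt : ∀ e, IsCompact (K e) := fun e =>
    isCompact_Icc.image_of_continuousOn ((E.arc_cont e).mono subm)
  have Kconn : ∀ e, IsPreconnected (K e) := fun e =>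
    isPreconnected_Icc.image _ ((E.arc_cont e).mono subm)
  have Mconn : ∀ v, IsPreconnected (M v) := by
    intro v
    refine isPreconnected_of_forall (E.pos v) ?_
    intro y hy
    rcases (Mmem v y).1 hy with rfl | ⟨e, rfl, t, ht, rfl⟩ | ⟨e, rfl, t, ht, rfl⟩
    · exact ⟨{E.pos v}, Set.subset_union_left, rfl, rfl, isPreconnected_singleton⟩
    · refine ⟨E.arc e '' Set.Icc 0 (1/3), ?_, ⟨0, by norm_num, h0 e⟩, ⟨t, ht, rfl⟩,
        isPreconnected_Icc.image _ ((E.arc_cont e).mono sub0)⟩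
      rintro _ ⟨s, hs, rfl⟩
      exact (Mmem _ _).2 (Or.inr (Or.inl ⟨e, rfl, s, hs, rfl⟩))
    · refine ⟨E.arc e '' Set.Icc (2/3) 1, ?_, ⟨1, by norm_num, h1 e⟩, ⟨t, ht, rfl⟩,
        isPreconnected_Icc.image _ ((E.arc_cont e).mono sub1)⟩
      rintro _ ⟨s, hs, rfl⟩
      exact (Mmem _ _).2 (Or.inr (Or.inr ⟨e, rfl, s, hs, rfl⟩))
  -- a point of `M v` is `pos v` or an interior point of an edge
  have Mcase : ∀ v x, x ∈ M v → x = E.pos v ∨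
      (∃ e, src e = v ∧ ∃ t ∈ Set.Ioc (0:ℝ) (1/3), E.arc e t = x) ∨
      ∃ e, tgt e = v ∧ ∃ t ∈ Set.Ico (2/3:ℝ) 1, E.arc e t = x := by
    intro v x hx
    rcases (Mmem v x).1 hx with h | ⟨e, he, t, ht, hx⟩ | ⟨e, he, t, ht, hx⟩
    · exact Or.inl h
    · rcases eq_or_lt_of_le ht.1 with h | h
      · left; rw [← hx, ← h, h0, he]
      · exact Or.inr (Or.inl ⟨e, he, t, ⟨h, ht.2⟩, hx⟩)
    · rcases eq_or_lt_of_le ht.2 with h | h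
      · left; rw [← hx, h, h1, he]
      · exact Or.inr (Or.inr ⟨e, he, t, ⟨ht.1, h⟩, hx⟩)
  have int : ∀ e f s t, s ∈ Set.Ioo (0:ℝ) 1 → t ∈ Set.Ioo (0:ℝ) 1 → E.arc e s = E.arc f t →
      e = f ∧ s = t := by
    intro e f s t hs ht h
    by_cases hef : e = f
    · subst hef
      exact ⟨rfl, E.arc_inj e ⟨hs.1.le, hs.2.le⟩ ⟨ht.1.le, ht.2.le⟩ h⟩
    · exact absurd h (E.arc_disjoint e f hef s hs t ht)
  have avoid : ∀ e t v, t ∈ Set.Ioo (0:ℝ) 1 → E.arc e t ≠ E.pos v := fun e t v ht h =>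
    E.arc_avoid e t ht ⟨v, h.symm⟩
  have io0 : ∀ t : ℝ, t ∈ Set.Ioc (0:ℝ) (1/3) → t ∈ Set.Ioo (0:ℝ) 1 := fun t h =>
    ⟨h.1, by linarith [h.2]⟩
  have io1 : ∀ t : ℝ, t ∈ Set.Ico (2/3:ℝ) 1 → t ∈ Set.Ioo (0:ℝ) 1 := fun t h =>
    ⟨by linarith [h.1], h.2⟩
  have iom : ∀ t : ℝ, t ∈ Set.Icc (1/3:ℝ) (2/3) → t ∈ Set.Ioo (0:ℝ) 1 := fun t h =>
    ⟨by linarith [h.1], by linarith [h.2]⟩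
  have MM : ∀ u v, u ≠ v → Disjoint (M u) (M v) := by
    intro u v huv
    rw [Set.disjoint_left]
    intro x hu hv
    rcases Mcase u x hu with rfl | ⟨e, he, s, hs, rfl⟩ | ⟨e, he, s, hs, rfl⟩ <;>
    rcases Mcase v _ hv with hx | ⟨f, hf, t, ht, hx⟩ | ⟨f, hf, t, ht, hx⟩
    · exact huv (E.inj hx)
    · exact avoid f t u (io0 t ht) hx
    · exact avoid f t u (io1 t ht) hx
    · exact avoid e s v (io0 s hs) hx
    · obtain ⟨rfl, rfl⟩ := int _ _ _ _ (io0 t ht) (io0 s hs) hx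
      exact huv (he.symm.trans hf)
    · obtain ⟨rfl, rfl⟩ := int _ _ _ _ (io1 t ht) (io0 s hs) hx
      linarith [ht.1, hs.2]
    · exact avoid e s v (io1 s hs) hx
    · obtain ⟨rfl, rfl⟩ := int _ _ _ _ (io0 t ht) (io1 s hs) hx
      linarith [hs.1, ht.2]
    · obtain ⟨rfl, rfl⟩ := int _ _ _ _ (io1 t ht) (io1 s hs) hx
      exact huv (he.symm.trans hf)
  have KK : ∀ e f, e ≠ f → Disjoint (K e) (K f) := by
    intro e f hef
    rw [Set.disjoint_left]
    rintro _ ⟨s, hs, rfl⟩ ⟨t, ht, h⟩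
    exact hef (int _ _ _ _ (iom t ht) (iom s hs) h).1.symm
  have MK : ∀ v e, v ≠ src e → v ≠ tgt e → Disjoint (M v) (K e) := by
    intro v e hs ht
    rw [Set.disjoint_left]
    rintro _ hx ⟨s, hs', rfl⟩
    rcases Mcase v _ hx with hx | ⟨f, hf, t, ht', hx⟩ | ⟨f, hf, t, ht', hx⟩
    · exact avoid e s v (iom s hs') hx
    · obtain ⟨rfl, rfl⟩ := int _ _ _ _ (io0 t ht') (iom s hs') hx
      exact hs hf.symm
    · obtain ⟨rfl, rfl⟩ := int _ _ _ _ (io1 t ht') (iom s hs') hx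
      exact ht hf.symm
  have ev : ∀ᶠ ε : ℝ in 𝓝[>] 0, 0 < ε ∧
      (∀ u v, u ≠ v → Disjoint (latticeNhd ε (M u)) (latticeNhd ε (M v))) ∧
      (∀ e f, e ≠ f → Disjoint (latticeNhd ε (K e)) (latticeNhd ε (K f))) ∧
      (∀ v e, v ≠ src e → v ≠ tgt e → Disjoint (latticeNhd ε (M v)) (latticeNhd ε (K e))) := by
    refine (eventually_mem_nhdsWithin.mono fun x hx => hx).and (.and ?_ (.and ?_ ?_))
    · refine Filter.eventually_all.2 fun u => Filter.eventually_all.2 fun v =>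
        Filter.eventually_imp_distrib_left.2 fun h => ?_
      exact eventually_disjoint_latticeNhd (Mcpt u) (Mcpt v) (MM u v h)
    · refine Filter.eventually_all.2 fun u => Filter.eventually_all.2 fun v =>
        Filter.eventually_imp_distrib_left.2 fun h => ?_
      exact eventually_disjoint_latticeNhd (Kcpt u) (Kcpt v) (KK u v h)
    · refine Filter.eventually_all.2 fun u => Filter.eventually_all.2 fun v =>
        Filter.eventually_imp_distrib_left.2 fun h => Filter.eventually_imp_distrib_left.2 fun h' => ?_
      exact eventually_disjoint_latticeNhd (Mcpt u) (Kcpt v) (MK u v h h')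
  obtain ⟨ε, hε, hMM, hKK, hMK⟩ := ev.exists
  have inter : ∀ {X Y : Set (ℝ × ℝ)} (x), x ∈ X → x ∈ Y →
      (latticeNhd ε X ∩ latticeNhd ε Y).Nonempty := by
    intro X Y x hx hy
    obtain ⟨p, hp⟩ := latticeNhd_nonempty hε (Set.singleton_nonempty x)
    exact ⟨p, latticeNhd_mono (Set.singleton_subset_iff.2 hx) hp,
      latticeNhd_mono (Set.singleton_subset_iff.2 hy) hp⟩
  obtain ⟨φ, hφ, hφ'⟩ := exists_isModel_of_regions (r := gridAdj) (fun _ _ => gridAdj_symm)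
    (fun v => latticeNhd ε (M v)) (fun e => latticeNhd ε (K e)) src tgt
    (fun v => latticeNhd_nonempty hε ⟨E.pos v, Or.inl rfl⟩)
    (fun v => latticeNhd_conn hε (Mconn v)) (fun e => latticeNhd_conn hε (Kconn e)) hMM hKK hMK hne
    (fun e => inter (E.arc e (1/3))
      ((Mmem _ _).2 (Or.inr (Or.inl ⟨e, rfl, 1/3, by norm_num, rfl⟩))) ⟨1/3, by norm_num, rfl⟩)
    (fun e => inter (E.arc e (2/3))
      ((Mmem _ _).2 (Or.inr (Or.inr ⟨e, rfl, 2/3, by norm_num, rfl⟩))) ⟨2/3, by norm_num, rfl⟩)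
    G.Adj (fun u v h => by
      have := hst ⟨s(u, v), h⟩
      rw [eq_comm, Sym2.eq_iff] at this
      exact ⟨_, this⟩)
  refine ⟨φ, hφ, fun w => ?_⟩
  refine ((latticeNhd_finite hε (Mcpt w)).union
    (Set.finite_iUnion fun e => latticeNhd_finite hε (Kcpt e))).subset fun a ha => ?_
  rcases hφ' a w ha with h | ⟨e, h⟩
  · exact Or.inl h
  · exact Or.inr (Set.mem_iUnion.2 ⟨e, h⟩)

end PlanarFrugal

namespace PlanarFrugal

open Relation

section Boundary

variable {E F : Type*} [Fintype E]

open Classical in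
/-- The boundary over `ZMod 2` of an edge vector `x`, for edges with ends `l e` and `r e`. -/
noncomputable def bd (l r : E → F) (x : E → ZMod 2) (v : F) : ZMod 2 :=
  ∑ e, x e * ((if l e = v then 1 else 0) + (if r e = v then 1 else 0))

/-- The coboundary over `ZMod 2` of a vertex function. -/
def cobd (l r : E → F) (f : F → ZMod 2) (e : E) : ZMod 2 := f (l e) + f (r e)

end Boundary

/-- Grid edges: `(false, p)` leaves `p` to the right and `(true, p)` upwards. -/
abbrev GridEdge := Bool × ℤ × ℤ

namespace GridEdge

/-- The second end of a grid edge; the first one is `g.2`. -/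
def fin (g : GridEdge) : ℤ × ℤ := if g.1 then (g.2.1, g.2.2 + 1) else (g.2.1 + 1, g.2.2)

/-- The second cell bordering a grid edge; the first one is `g.2`. -/
def cell (g : GridEdge) : ℤ × ℤ := if g.1 then (g.2.1 - 1, g.2.2) else (g.2.1, g.2.2 - 1)

/-- The boundary of a finite set of grid edges. -/
noncomputable def bdry : (GridEdge →₀ ZMod 2) →ₗ[ZMod 2] (ℤ × ℤ →₀ ZMod 2) :=
  Finsupp.linearCombination (ZMod 2) fun g => Finsupp.single g.2 1 + Finsupp.single g.fin 1

theorem exists_of_gridAdj {a b : ℤ × ℤ} (h : gridAdj a b) :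
    ∃ g : GridEdge, (g.2 = a ∧ g.fin = b) ∨ (g.2 = b ∧ g.fin = a) := by
  obtain ⟨a1, a2⟩ := a
  obtain ⟨b1, b2⟩ := b
  rcases h with ⟨h1, h2 | h2⟩ | ⟨h1, h2 | h2⟩ <;> dsimp at h1 h2
  · exact ⟨(true, a1, a2), Or.inl ⟨rfl, by simp [fin, h1, h2]⟩⟩
  · exact ⟨(true, b1, b2), Or.inr ⟨rfl, by simp [fin, h1, h2]⟩⟩
  · exact ⟨(false, a1, a2), Or.inl ⟨rfl, by simp [fin, h1, h2]⟩⟩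
  · exact ⟨(false, b1, b2), Or.inr ⟨rfl, by simp [fin, h1, h2]⟩⟩

theorem bdry_single (g : GridEdge) :
    bdry (Finsupp.single g 1) = Finsupp.single g.2 1 + Finsupp.single g.fin 1 := by
  simp [bdry]

theorem bdry_apply (z : GridEdge →₀ ZMod 2) (i j : ℤ) :
    bdry z (i, j) = z (false, i, j) + z (false, i - 1, j) + z (true, i, j) + z (true, i, j - 1) := by
  induction z using Finsupp.induction_linear with
  | zero => simp
  | add f g hf hg => rw [map_add, Finsupp.add_apply, hf, hg]; simp only [Finsupp.add_apply]; ring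
  | single g c =>
    obtain ⟨b, k, m⟩ := g
    rw [bdry, Finsupp.linearCombination_single]
    cases b <;> simp [fin, Finsupp.single_apply] <;> split_ifs <;> first | omega | simp

/-- A finite even set of grid edges is the coboundary of a set of cells. -/
theorem exists_cells (z : GridEdge →₀ ZMod 2) (hz : bdry z = 0) :
    ∃ c : ℤ × ℤ → ZMod 2, ∀ g : GridEdge, z g = c g.2 + c g.cell := by
  have hz' : ∀ i j, z (false, i, j) + z (false, i - 1, j) + z (true, i, j) + z (true, i, j - 1) = 0 :=
    fun i j => by rw [← bdry_apply, hz]; rfl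
  have two : ∀ a : ZMod 2, a + a = 0 := CharTwo.add_self_eq_zero
  obtain ⟨N, hN⟩ : ∃ N : ℤ, ∀ b i j, i ≤ N → z (b, i, j) = 0 := by
    obtain ⟨N, hN⟩ := (z.support.image fun g => g.2.1).bddBelow
    refine ⟨N - 1, fun b i j h => ?_⟩
    by_contra hne
    have := hN (Finset.mem_coe.2 (Finset.mem_image_of_mem (fun g : GridEdge => g.2.1)
      (Finsupp.mem_support_iff.2 hne)))
    simp only at this
    omega
  let c : ℤ × ℤ → ZMod 2 := fun p => ∑ n ∈ Finset.range (p.1 - N).toNat, z (true, N + 1 + n, p.2)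
  have key : ∀ (m : ℕ) (j : ℤ), (∑ n ∈ Finset.range m, z (true, N + 1 + n, j)) +
      (∑ n ∈ Finset.range m, z (true, N + 1 + n, j - 1)) = z (false, N + m, j) := by
    intro m j
    induction m with
    | zero => simp [hN]
    | succ m ih =>
      rw [Finset.sum_range_succ, Finset.sum_range_succ]
      have h := hz' (N + 1 + m) j
      have e1 : N + 1 + (m:ℤ) - 1 = N + m := by ring
      have e2 : N + ((m + 1 : ℕ) : ℤ) = N + 1 + m := by push_cast; ring
      rw [e1] at h
      rw [e2]
      have h3 : z (false, N + 1 + m, j) + z (false, N + 1 + m, j) = 0 := two _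
      have h4 : z (false, N + m, j) + z (false, N + m, j) = 0 := two _
      linear_combination ih + h - h3
  refine ⟨c, ?_⟩
  rintro ⟨b, i, j⟩
  cases b
  · simp only [cell, c, Bool.false_eq_true, if_false]
    rw [key]
    rcases le_total i N with h | h
    · rw [hN _ _ _ h, hN]; omega
    · congr 3; omega
  · simp only [cell, c, if_true]
    rcases le_or_gt i N with h | h
    · rw [hN _ _ _ h, Int.toNat_of_nonpos (by omega), Int.toNat_of_nonpos (by omega)]; simp
    · obtain ⟨n, rfl⟩ : ∃ n : ℕ, i = N + 1 + n := ⟨(i - N - 1).toNat, by omega⟩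
      have e1 : (N + 1 + (n:ℤ) - N).toNat = n + 1 := by omega
      have e2 : (N + 1 + (n:ℤ) - 1 - N).toNat = n := by omega
      rw [e1, e2, Finset.sum_range_succ]
      have h3 := two (∑ x ∈ Finset.range n, z (true, N + 1 + x, j))
      linear_combination -h3

end GridEdge

open GridEdge in
/-- A graph which is a grid minor has a combinatorial dual. -/
theorem GridMinor.exists_dual {W : Type*} [Fintype W] {H : SimpleGraph W} [Fintype H.edgeSet]
    (hH : GridMinor H) (s t : H.edgeSet → W) (hst : ∀ e : H.edgeSet, (e : Sym2 W) = s(s e, t e)) :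
    ∃ (F : Type) (_ : Fintype F) (l r : H.edgeSet → F),
      ∀ z : H.edgeSet → ZMod 2, (∀ w, bd s t z w = 0) ↔ ∃ f, z = cobd l r f := by
  classical
  obtain ⟨φ, hφ, hfin⟩ := hH
  have two : ∀ a : ZMod 2, a + a = 0 := CharTwo.add_self_eq_zero
  have hne : ∀ e, s e ≠ t e := by
    intro e h
    have := e.2
    rw [hst e, SimpleGraph.mem_edgeSet, h] at this
    exact H.loopless.irrefl _ this
  have hι : ∀ e : H.edgeSet, ∃ g : GridEdge, ∃ u v, φ g.2 = some u ∧ φ g.fin = some v ∧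
      (e : Sym2 W) = s(u, v) := by
    intro e
    have := e.2
    rw [hst e, SimpleGraph.mem_edgeSet] at this
    obtain ⟨a, b, hab, ha, hb⟩ := hφ.adj _ _ this
    obtain ⟨g, ⟨rfl, rfl⟩ | ⟨rfl, rfl⟩⟩ := exists_of_gridAdj hab
    · exact ⟨g, _, _, ha, hb, hst e⟩
    · exact ⟨g, _, _, hb, ha, (hst e).trans Sym2.eq_swap⟩
  choose ι p q hp hq hpq using hι
  have ιinj : Function.Injective ι := by
    intro e e' h
    have h1 := hp e
    have h2 := hq e
    rw [h, hp e', Option.some.injEq] at h1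
    rw [h, hq e', Option.some.injEq] at h2
    exact Subtype.ext ((hpq e).trans (by rw [hpq e', h1, h2]))
  have hsum : ∀ (e : H.edgeSet) (w : W), ((if s e = w then 1 else 0) + (if t e = w then 1 else 0) :
      ZMod 2) = (if p e = w then 1 else 0) + (if q e = w then 1 else 0) := by
    intro e w
    rcases Sym2.eq_iff.1 ((hst e).symm.trans (hpq e)) with ⟨h1, h2⟩ | ⟨h1, h2⟩
    · rw [h1, h2]
    · rw [h1, h2, add_comm]
  let inside : GridEdge → Prop := fun g => ∃ w, φ g.2 = some w ∧ φ g.fin = some w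
  let del : GridEdge → Prop := fun g => ¬ inside g ∧ g ∉ Set.range ι
  let rel : ℤ × ℤ → ℤ × ℤ → Prop := fun a b => ∃ g, del g ∧ a = g.2 ∧ b = g.cell
  let l : H.edgeSet → Quot rel := fun e => Quot.mk _ (ι e).2
  let r : H.edgeSet → Quot rel := fun e => Quot.mk _ (ι e).cell
  have main : ∀ z : H.edgeSet → ZMod 2, (∀ w, bd s t z w = 0) ↔
      ∃ f : Quot rel → ZMod 2, ∀ e, z e = f (l e) + f (r e) := by
    intro z
    constructor
    · intro hz
      choose base hbase using hφ.nonempty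
      have path : ∀ w a, φ a = some w → ∃ y : GridEdge →₀ ZMod 2,
          (∀ g, y g ≠ 0 → inside g) ∧
          bdry y = Finsupp.single a 1 + Finsupp.single (base w) 1 := by
        intro w a ha
        have h := hφ.conn w (base w) a (hbase w) ha
        clear ha
        induction h with
        | refl =>
          refine ⟨0, by simp, ?_⟩
          rw [map_zero]
          ext x
          exact (two _).symm
        | tail _ h2 ih =>
          rename_i b c _
          obtain ⟨y, hy1, hy2⟩ := ih
          obtain ⟨hbc, hb, hc⟩ := h2
          obtain ⟨g, hg⟩ := exists_of_gridAdj hbc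
          refine ⟨y + Finsupp.single g 1, ?_, ?_⟩
          · intro g' hg'
            by_cases h : g' = g
            · subst h
              rcases hg with ⟨h1, h2⟩ | ⟨h1, h2⟩
              · exact ⟨w, by rw [h1, hb], by rw [h2, hc]⟩
              · exact ⟨w, by rw [h1, hc], by rw [h2, hb]⟩
            · apply hy1
              rwa [Finsupp.add_apply, Finsupp.single_eq_of_ne h, add_zero] at hg'
          · rw [map_add, hy2, bdry_single]
            have h2 : (Finsupp.single b (1 : ZMod 2)) + Finsupp.single b 1 = 0 := by
              ext x; exact two _
            rcases hg with ⟨h1, h3⟩ | ⟨h1, h3⟩ <;> rw [h1, h3]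
            all_goals
              trans Finsupp.single c 1 + Finsupp.single (base w) 1 +
                (Finsupp.single b (1 : ZMod 2) + Finsupp.single b 1)
              · abel
              · rw [h2, add_zero]
      choose! y hy1 hy2 using path
      let Z : GridEdge →₀ ZMod 2 := ∑ e, z e • (Finsupp.single (ι e) 1 + y (p e) (ι e).2 +
        y (q e) (ι e).fin)
      have hZ : bdry Z = 0 := by
        have h1 : ∀ e, bdry (Finsupp.single (ι e) 1 + y (p e) (ι e).2 + y (q e) (ι e).fin) =
            Finsupp.single (base (p e)) 1 + Finsupp.single (base (q e)) 1 := by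
          intro e
          rw [map_add, map_add, bdry_single, hy2 _ _ (hp e), hy2 _ _ (hq e)]
          have h2 : ∀ b : ℤ × ℤ, (Finsupp.single b (1 : ZMod 2)) + Finsupp.single b 1 = 0 := by
            intro b; ext x; exact two _
          rw [← add_zero (Finsupp.single (base (p e)) (1 : ZMod 2) + _), ← h2 (ι e).2,
            ← add_zero (Finsupp.single (base (p e)) (1 : ZMod 2) + _ + _), ← h2 (ι e).fin]
          abel
        have h2 : ∀ e, Finsupp.single (base (p e)) (1 : ZMod 2) + Finsupp.single (base (q e)) 1 =
            ∑ w, ((if s e = w then 1 else 0) + (if t e = w then 1 else 0) : ZMod 2) •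
              Finsupp.single (base w) (1 : ZMod 2) := by
          intro e
          simp_rw [hsum, add_smul, Finset.sum_add_distrib, ite_smul, zero_smul, one_smul]
          simp
        simp only [Z, map_sum, map_smul, h1, h2, Finset.smul_sum, smul_smul]
        rw [Finset.sum_comm]
        simp_rw [← Finset.sum_smul]
        exact Finset.sum_eq_zero fun w _ => by
          have := hz w
          rw [bd] at this
          rw [this, zero_smul]
      obtain ⟨c, hc⟩ := exists_cells Z hZ
      have hout : ∀ g, ¬ inside g → ∀ w a, φ a = some w → y w a g = 0 := by
        intro g hg w a ha
        by_contra h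
        exact hg (hy1 w a ha g h)
      have hιin : ∀ e, ¬ inside (ι e) := by
        rintro e ⟨w, h1, h2⟩
        rw [hp, Option.some.injEq] at h1
        rw [hq, Option.some.injEq] at h2
        have := e.2
        rw [hpq e, SimpleGraph.mem_edgeSet, h1, h2] at this
        exact H.loopless.irrefl _ this
      have hZout : ∀ g, ¬ inside g → Z g = ∑ e, z e * (if ι e = g then 1 else 0) := by
        intro g hg
        simp only [Z, Finsupp.coe_finsetSum, Finset.sum_apply, Finsupp.smul_apply,
          Finsupp.add_apply, smul_eq_mul]
        refine Finset.sum_congr rfl fun e _ => ?_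
        rw [hout g hg _ _ (hp e), hout g hg _ _ (hq e), add_zero, add_zero,
          Finsupp.single_apply]
      refine ⟨Quot.lift c ?_, ?_⟩
      · rintro a b ⟨g, ⟨hg1, hg2⟩, rfl, rfl⟩
        have h := hc g
        rw [hZout g hg1, Finset.sum_eq_zero] at h
        · have := two (c g.cell)
          linear_combination -this - h
        · intro e _
          rw [if_neg (fun h => hg2 ⟨e, h⟩), mul_zero]
      · intro e
        have h := hc (ι e)
        rw [hZout _ (hιin e)] at h
        simp only [ιinj.eq_iff, mul_ite, mul_one, mul_zero, Finset.sum_ite_eq', Finset.mem_univ,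
          if_true] at h
        exact h
    · rintro ⟨f, hf⟩ w
      let c : ℤ × ℤ → ZMod 2 := fun a => f (Quot.mk _ a)
      let g : GridEdge → ZMod 2 := fun e => c e.2 + c e.cell
      have gdel : ∀ e, del e → g e = 0 := by
        intro e he
        have : (Quot.mk rel e.2) = Quot.mk rel e.cell := Quot.sound ⟨e, he, rfl, rfl⟩
        simp only [g, c, this, two]
      let Fib := (hfin w).toFinset
      have hFib : ∀ a, a ∈ Fib ↔ φ a = some w := fun a => by simp [Fib]
      let S : Finset GridEdge := Fib.biUnion fun a =>
        {(false, a), (true, a), (false, a.1 - 1, a.2), (true, a.1, a.2 - 1)}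
      have inc : ∀ e : GridEdge, e.2 ∈ Fib ∨ e.fin ∈ Fib → e ∈ S := by
        rintro ⟨b, i, j⟩ h
        simp only [S, Finset.mem_biUnion]
        rcases h with h | h
        · exact ⟨_, h, by cases b <;> simp⟩
        · exact ⟨_, h, by cases b <;> simp [fin]⟩
      have hloc : ∀ a ∈ Fib, ∑ e ∈ S, g e * ((if e.2 = a then 1 else 0) +
          (if e.fin = a then 1 else 0)) = 0 := by
        intro a ha
        rw [← Finset.sum_subset (s₁ := {(false, a), (true, a), (false, a.1 - 1, a.2),
          (true, a.1, a.2 - 1)})]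
        · rw [Finset.sum_insert, Finset.sum_insert, Finset.sum_insert, Finset.sum_singleton]
          · obtain ⟨i, j⟩ := a
            simp only [fin, cell, g, Bool.false_eq_true, if_false, if_true, Prod.mk.injEq,
              sub_add_cancel, and_true, true_and, add_eq_left,
              one_ne_zero, sub_eq_self]
            linear_combination two (c (i, j)) + two (c (i, j - 1)) + two (c (i - 1, j)) +
              two (c (i - 1, j - 1))
          all_goals
            simp only [Finset.mem_insert, Finset.mem_singleton, Prod.ext_iff, Bool.false_eq_true,
              Bool.true_eq_false, false_and, false_or, true_and, or_false, not_false_eq_true]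
          all_goals omega
        · exact Finset.subset_biUnion_of_mem (fun a : ℤ × ℤ => ({(false, a), (true, a),
            (false, a.1 - 1, a.2), (true, a.1, a.2 - 1)} : Finset GridEdge)) ha
        · rintro ⟨b, i, j⟩ _ he
          rw [if_neg, if_neg]
          · simp
          · rintro rfl
            cases b <;> simp [fin] at he
          · rintro rfl
            cases b <;> simp at he
      have htot : ∑ e ∈ S, g e * ((if e.2 ∈ Fib then 1 else 0) + (if e.fin ∈ Fib then 1 else 0))
          = 0 := by
        have := Finset.sum_eq_zero hloc
        rw [Finset.sum_comm] at this
        refine Eq.trans (Finset.sum_congr rfl fun e _ => ?_) this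
        rw [← Finset.mul_sum, Finset.sum_add_distrib]
        simp
      rw [bd]
      refine Eq.trans ?_ htot
      let T : Finset GridEdge := Finset.univ.image ι
      have e1 : ∑ e, z e * ((if s e = w then 1 else 0) + (if t e = w then 1 else 0)) =
          ∑ e ∈ T, g e * ((if e.2 ∈ Fib then 1 else 0) + (if e.fin ∈ Fib then 1 else 0)) := by
        rw [Finset.sum_image ιinj.injOn]
        refine Finset.sum_congr rfl fun e _ => ?_
        rw [hsum, hf e]
        simp only [hFib, hp, hq, Option.some.injEq]
        rfl
      rw [e1]
      have e2 : ∀ A B : Finset GridEdge, (∀ e ∈ A, e ∉ B → g e * ((if e.2 ∈ Fib then 1 else 0) +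
          (if e.fin ∈ Fib then 1 else 0)) = 0) → ∑ e ∈ A, g e * ((if e.2 ∈ Fib then 1 else 0) +
          (if e.fin ∈ Fib then 1 else 0)) = ∑ e ∈ A ∩ B, g e * ((if e.2 ∈ Fib then 1 else 0) +
          (if e.fin ∈ Fib then 1 else 0)) := by
        intro A B h
        symm
        refine Finset.sum_subset Finset.inter_subset_left fun e he he' => h e he fun h => he' ?_
        exact Finset.mem_inter.2 ⟨he, h⟩
      rw [e2 S T, e2 T S, Finset.inter_comm]
      · intro e _ he
        rw [if_neg (fun h => he (inc e (Or.inl h))), if_neg (fun h => he (inc e (Or.inr h)))]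
        simp
      · intro e _ he
        by_cases hin : inside e
        · obtain ⟨u, h1, h2⟩ := hin
          simp only [hFib, h1, h2, two, mul_zero]
        · rw [gdel e ⟨hin, fun ⟨e', h⟩ => he (h ▸ Finset.mem_image_of_mem _ (Finset.mem_univ _))⟩,
            zero_mul]
  have hfinR : (Set.range l ∪ Set.range r).Finite := (Set.finite_range l).union (Set.finite_range r)
  refine ⟨(Set.range l ∪ Set.range r : Set (Quot rel)), hfinR.fintype,
    fun e => ⟨l e, Or.inl ⟨e, rfl⟩⟩, fun e => ⟨r e, Or.inr ⟨e, rfl⟩⟩, fun z => ?_⟩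
  rw [main]
  constructor
  · rintro ⟨f, hf⟩
    exact ⟨fun x => f x, funext hf⟩
  · rintro ⟨f, hf⟩
    refine ⟨fun x => if h : x ∈ Set.range l ∪ Set.range r then f ⟨x, h⟩ else 0, fun e => ?_⟩
    have h1 : l e ∈ Set.range l ∪ Set.range r := Or.inl ⟨e, rfl⟩
    have h2 : r e ∈ Set.range l ∪ Set.range r := Or.inr ⟨e, rfl⟩
    simp only [hf, cobd, dif_pos h1, dif_pos h2]

end PlanarFrugal

namespace PlanarFrugal

open Relation

section Boundary

variable {E F : Type*} [Fintype E]

/-- The boundary as a linear map. -/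
noncomputable def bdLin (l r : E → F) : (E → ZMod 2) →ₗ[ZMod 2] (F → ZMod 2) where
  toFun := bd l r
  map_add' x y := by
    ext v; simp only [bd, Pi.add_apply, add_mul, Finset.sum_add_distrib]
  map_smul' c x := by
    ext v; simp only [bd, Pi.smul_apply, smul_eq_mul, Finset.mul_sum, mul_assoc, RingHom.id_apply]

/-- The coboundary as a linear map. -/
def cobdLin (l r : E → F) : (F → ZMod 2) →ₗ[ZMod 2] (E → ZMod 2) where
  toFun := cobd l r
  map_add' x y := by ext v; simp only [cobd, Pi.add_apply]; ring
  map_smul' c x := by ext v; simp only [cobd, Pi.smul_apply, smul_eq_mul, RingHom.id_apply]; ring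

theorem sum_bd [Fintype F] (l r : E → F) (x : E → ZMod 2) : ∑ v, bd l r x v = 0 := by
  classical
  simp only [bd]
  rw [Finset.sum_comm]
  refine Finset.sum_eq_zero fun e _ => ?_
  rw [← Finset.mul_sum, Finset.sum_add_distrib]
  simp [CharTwo.add_self_eq_zero]

theorem finrank_ker_bd [Fintype F] [Nonempty F] (l r : E → F) :
    Fintype.card E + 1 ≤ Module.finrank (ZMod 2) (LinearMap.ker (bdLin l r)) + Fintype.card F := by
  classical
  have h1 := LinearMap.finrank_range_add_finrank_ker (bdLin l r)
  let S : (F → ZMod 2) →ₗ[ZMod 2] ZMod 2 := ∑ v, LinearMap.proj v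
  have hS : ∀ x, S x = ∑ v, x v := fun x => by simp [S]
  have h2 := LinearMap.finrank_range_add_finrank_ker S
  have h3 : LinearMap.range S = ⊤ := by
    rw [LinearMap.range_eq_top]
    intro c
    refine ⟨Pi.single (Classical.arbitrary F) c, ?_⟩
    rw [hS]; simp
  have h4 : LinearMap.range (bdLin l r) ≤ LinearMap.ker S := by
    rintro _ ⟨x, rfl⟩
    rw [LinearMap.mem_ker, hS]
    exact sum_bd l r x
  have h5 := Submodule.finrank_mono h4
  rw [h3, finrank_top, Module.finrank_self, Module.finrank_fintype_fun_eq_card] at h2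
  rw [Module.finrank_fintype_fun_eq_card] at h1
  omega

open Classical in
theorem cobd_eq_sum [Fintype F] (l r : E → F) (f : F → ZMod 2) :
    cobd l r f = ∑ x, f x • cobd l r (Pi.single x 1) := by
  ext e
  simp only [cobd, Finset.sum_apply, Pi.smul_apply, smul_eq_mul, mul_add, Finset.sum_add_distrib,
    Pi.single_apply, mul_ite, mul_one, mul_zero, Finset.sum_ite_eq, Finset.mem_univ, if_true]

open Classical in
theorem finrank_range_cobd [Fintype F] (l r : E → F) :
    (∀ x : F, cobd l r (Pi.single x 1) = 0) ∨
    Module.finrank (ZMod 2) (LinearMap.range (cobdLin l r)) + 1 ≤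
      (Finset.univ.filter fun x : F => cobd l r (Pi.single x 1) ≠ 0).card := by
  by_contra hcon
  push Not at hcon
  obtain ⟨⟨x₀, hx₀⟩, h⟩ := hcon
  set F' := Finset.univ.filter fun x : F => cobd l r (Pi.single x 1) ≠ 0 with hF'
  have hx : x₀ ∈ F' := by simp [hF', hx₀]
  let T := (F'.erase x₀).image fun x => cobd l r (Pi.single x 1)
  have hT : ∀ x, x ≠ x₀ → cobd l r (Pi.single x 1) ∈ Submodule.span (ZMod 2) (T : Set (E → ZMod 2)) := by
    intro x hx
    by_cases h0 : cobd l r (Pi.single x 1) = 0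
    · rw [h0]; exact Submodule.zero_mem _
    · apply Submodule.subset_span
      exact Finset.mem_coe.2 (Finset.mem_image_of_mem _ (by simp [hF', hx, h0]))
  have hT' : ∀ x, cobd l r (Pi.single x 1) ∈ Submodule.span (ZMod 2) (T : Set (E → ZMod 2)) := by
    intro x
    by_cases hx : x = x₀
    · subst hx
      have h1 := cobd_eq_sum l r (fun _ => 1)
      have h2 : cobd l r (fun _ : F => 1) = 0 := by
        ext e; exact CharTwo.add_self_eq_zero _
      rw [h2, ← Finset.add_sum_erase _ _ (Finset.mem_univ x), one_smul] at h1
      rw [eq_neg_of_add_eq_zero_left h1.symm]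
      refine Submodule.neg_mem _ (Submodule.sum_mem _ fun y hy => ?_)
      exact Submodule.smul_mem _ _ (hT y (Finset.ne_of_mem_erase hy))
    · exact hT x hx
  have hle : LinearMap.range (cobdLin l r) ≤ Submodule.span (ZMod 2) (T : Set (E → ZMod 2)) := by
    rintro _ ⟨f, rfl⟩
    change cobd l r f ∈ _
    rw [cobd_eq_sum]
    exact Submodule.sum_mem _ fun x _ => Submodule.smul_mem _ _ (hT' x)
  have h1 := Submodule.finrank_mono hle
  have h2 := finrank_span_finset_le_card (R := ZMod 2) T
  have h3 : T.card ≤ (F'.erase x₀).card := Finset.card_image_le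
  rw [Finset.card_erase_of_mem hx] at h3
  have h4 : 0 < F'.card := Finset.card_pos.2 ⟨_, hx⟩
  rw [Set.finrank] at h2
  omega

theorem two_mul_card_ge_of_girth [Fintype F] (l r : E → F) (g : ℕ)
    (hg : ∀ f, cobd l r f ≠ 0 → g ≤ (Finset.univ.filter fun e => cobd l r f e ≠ 0).card) :
    Module.finrank (ZMod 2) (LinearMap.range (cobdLin l r)) = 0 ∨
    g * (Module.finrank (ZMod 2) (LinearMap.range (cobdLin l r)) + 1) ≤ 2 * Fintype.card E := by
  classical
  rcases finrank_range_cobd l r with h | h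
  · left
    have : LinearMap.range (cobdLin l r) = ⊥ := by
      rw [eq_bot_iff]
      rintro _ ⟨f, rfl⟩
      change cobd l r f ∈ _
      rw [cobd_eq_sum]
      simp [h]
    rw [this, finrank_bot]
  · right
    set F' := Finset.univ.filter fun x : F => cobd l r (Pi.single x 1) ≠ 0 with hF'
    have h1 : F'.card * g ≤ ∑ x ∈ F', (Finset.univ.filter
        fun e => cobd l r (Pi.single x 1) e ≠ 0).card := by
      rw [← smul_eq_mul]
      refine Finset.card_nsmul_le_sum _ _ _ fun x hx => hg _ ?_
      simpa [hF'] using hx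
    have h2 : ∑ x ∈ F', (Finset.univ.filter fun e => cobd l r (Pi.single x 1) e ≠ 0).card ≤
        ∑ e : E, 2 := by
      simp_rw [Finset.card_filter]
      rw [Finset.sum_comm]
      refine Finset.sum_le_sum fun e _ => ?_
      rw [← Finset.card_filter]
      refine (Finset.card_le_card (t := {l e, r e}) ?_).trans Finset.card_le_two
      intro x hx
      rw [Finset.mem_filter] at hx
      by_contra hne
      simp only [Finset.mem_insert, Finset.mem_singleton, not_or] at hne
      apply hx.2
      simp [cobd, Ne.symm hne.1, Ne.symm hne.2]
    simp only [Finset.sum_const, Finset.card_univ, smul_eq_mul] at h2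
    calc g * _ ≤ g * F'.card := Nat.mul_le_mul_left _ h
      _ = F'.card * g := mul_comm _ _
      _ ≤ _ := h1.trans h2
      _ = _ := mul_comm _ _

/-- In an even edge vector, every edge at a vertex is matched by another one. -/
theorem exists_other_edge {l r : E → F} {x : E → ZMod 2} {v : F} (h : bd l r x v = 0) {e : E}
    (he : x e ≠ 0) (hv : (l e = v ∧ r e ≠ v) ∨ (r e = v ∧ l e ≠ v)) :
    ∃ e', e' ≠ e ∧ x e' ≠ 0 ∧ (l e' = v ∨ r e' = v) := by
  classical
  by_contra hcon
  push Not at hcon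
  rw [bd, Finset.sum_eq_single e] at h
  · rcases hv with ⟨h1, h2⟩ | ⟨h1, h2⟩ <;> simp [h1, h2] at h <;> exact he h
  · intro e' _ hne
    by_cases h0 : x e' = 0
    · simp [h0]
    · obtain ⟨h1, h2⟩ := hcon e' hne h0
      simp [h1, h2]
  · simp

end Boundary

section EdgeBounds

variable {W : Type*} [Fintype W] {H : SimpleGraph W}

theorem exists_edge_ends (H : SimpleGraph W) :
    ∃ s t : H.edgeSet → W, ∀ e : H.edgeSet, (e : Sym2 W) = s(s e, t e) := by
  have : ∀ e : H.edgeSet, ∃ p : W × W, (e : Sym2 W) = s(p.1, p.2) := by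
    rintro ⟨e, _⟩
    induction e with | h a b => exact ⟨(a, b), rfl⟩
  choose p hp using this
  exact ⟨fun e => (p e).1, fun e => (p e).2, hp⟩

theorem exists_other_edge_simple [Fintype H.edgeSet] {s t : H.edgeSet → W}
    (hst : ∀ e : H.edgeSet, (e : Sym2 W) = s(s e, t e)) {x : H.edgeSet → ZMod 2}
    (hx : ∀ w, bd s t x w = 0) {a b : W} (hab : H.Adj a b)
    (h : x ⟨s(a, b), hab⟩ ≠ 0) :
    ∃ c, ∃ hc : H.Adj b c, c ≠ a ∧ x ⟨s(b, c), hc⟩ ≠ 0 := by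
  have key : (s ⟨s(a, b), hab⟩ = b ∧ t ⟨s(a, b), hab⟩ ≠ b) ∨
      (t ⟨s(a, b), hab⟩ = b ∧ s ⟨s(a, b), hab⟩ ≠ b) := by
    have := hst ⟨s(a, b), hab⟩
    rcases Sym2.eq_iff.1 this with ⟨h1, h2⟩ | ⟨h1, h2⟩
    · exact Or.inr ⟨h2.symm, h1 ▸ hab.ne⟩
    · exact Or.inl ⟨h2.symm, h1 ▸ hab.ne⟩
  obtain ⟨⟨e, he⟩, hne, hxe, hb⟩ := exists_other_edge (hx b) h key
  have hbe : b ∈ e := by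
    have := hst ⟨e, he⟩
    rw [show e = _ from this]
    rcases hb with h | h <;> simp [h]
  obtain ⟨c, rfl⟩ := hbe
  refine ⟨c, he, ?_, hxe⟩
  rintro rfl
  exact hne (Subtype.ext Sym2.eq_swap)

theorem GridMinor.edge_bound [Nonempty W] [Fintype H.edgeSet] (hH : GridMinor H) (g : ℕ)
    (hg : ∀ s t : H.edgeSet → W, (∀ e : H.edgeSet, (e : Sym2 W) = s(s e, t e)) →
      ∀ x, (∀ w, bd s t x w = 0) → x ≠ 0 → g ≤ (Finset.univ.filter fun e => x e ≠ 0).card) :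
    H.edgeFinset.card + 1 ≤ Fintype.card W ∨
    ∃ m, H.edgeFinset.card + 2 ≤ Fintype.card W + m ∧ g * m ≤ 2 * H.edgeFinset.card := by
  obtain ⟨s, t, hst⟩ := exists_edge_ends H
  obtain ⟨F, _, l, r, hd⟩ := hH.exists_dual s t hst
  rw [SimpleGraph.edgeFinset_card]
  have h1 := finrank_ker_bd s t
  have h2 : LinearMap.ker (bdLin s t) = LinearMap.range (cobdLin l r) := by
    ext z
    rw [LinearMap.mem_ker, LinearMap.mem_range]
    refine Iff.trans ?_ ((hd z).trans ?_)
    · exact funext_iff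
    · exact ⟨fun ⟨f, hf⟩ => ⟨f, hf.symm⟩, fun ⟨f, hf⟩ => ⟨f, hf.symm⟩⟩
  rw [h2] at h1
  rcases two_mul_card_ge_of_girth l r g (fun f hf => hg s t hst _ ((hd _).2 ⟨f, rfl⟩) hf) with h | h
  · left; omega
  · exact Or.inr ⟨_, by omega, h⟩

theorem GridMinor.card_edges_le [Nonempty W] [Fintype H.edgeSet] (hH : GridMinor H) :
    H.edgeFinset.card + 1 ≤ Fintype.card W ∨
    H.edgeFinset.card + 6 ≤ 3 * Fintype.card W := by
  classical
  refine (hH.edge_bound 3 ?_).imp_right fun ⟨m, h1, h2⟩ => by omega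
  intro s t hst x hx hne
  obtain ⟨⟨e, he⟩, hxe⟩ := Function.ne_iff.1 hne
  induction e with | h a b =>
  obtain ⟨c, hc, hca, hxc⟩ := exists_other_edge_simple hst hx he hxe
  have he' : H.Adj b a := SimpleGraph.Adj.symm he
  have hxe' : x ⟨s(b, a), he'⟩ ≠ 0 := by
    rwa [show (⟨s(b, a), he'⟩ : H.edgeSet) = ⟨s(a, b), he⟩ from Subtype.ext Sym2.eq_swap]
  obtain ⟨d, hd, hda, hxd⟩ := exists_other_edge_simple hst hx he' hxe'
  have hab : a ≠ b := H.ne_of_adj he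
  have hbc : b ≠ c := hc.ne
  have had : a ≠ d := hd.ne
  calc 3 = ({⟨s(a, b), he⟩, ⟨s(b, c), hc⟩, ⟨s(a, d), hd⟩} : Finset H.edgeSet).card := by
        rw [Finset.card_insert_of_notMem, Finset.card_pair]
        · simp only [ne_eq]; grind
        · simp only [Finset.mem_insert, Finset.mem_singleton]; grind
    _ ≤ _ := Finset.card_le_card fun e he => by
        simp only [Finset.mem_insert, Finset.mem_singleton] at he
        rw [Finset.mem_filter]
        rcases he with rfl | rfl | rfl
        · exact ⟨Finset.mem_univ _, hxe⟩
        · exact ⟨Finset.mem_univ _, hxc⟩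
        · exact ⟨Finset.mem_univ _, hxd⟩

theorem GridMinor.card_edges_le_of_bipartite [Nonempty W] [Fintype H.edgeSet] (hH : GridMinor H)
    (side : W → Prop) (hside : ∀ u v, H.Adj u v → (side u ↔ ¬ side v)) :
    H.edgeFinset.card + 1 ≤ Fintype.card W ∨
    H.edgeFinset.card + 4 ≤ 2 * Fintype.card W := by
  classical
  refine (hH.edge_bound 4 ?_).imp_right fun ⟨m, h1, h2⟩ => by omega
  intro s t hst x hx hne
  obtain ⟨⟨e, he⟩, hxe⟩ := Function.ne_iff.1 hne
  induction e with | h a b =>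
  obtain ⟨c, hc, hca, hxc⟩ := exists_other_edge_simple hst hx he hxe
  obtain ⟨d, hd, hdb, hxd⟩ := exists_other_edge_simple hst hx hc hxc
  have he' : H.Adj b a := SimpleGraph.Adj.symm he
  have hxe' : x ⟨s(b, a), he'⟩ ≠ 0 := by
    rwa [show (⟨s(b, a), he'⟩ : H.edgeSet) = ⟨s(a, b), he⟩ from Subtype.ext Sym2.eq_swap]
  obtain ⟨f, hf, hfa, hxf⟩ := exists_other_edge_simple hst hx he' hxe'
  have hab : a ≠ b := H.ne_of_adj he
  have hbc : b ≠ c := hc.ne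
  have haf : a ≠ f := hf.ne
  have hcd : c ≠ d := hd.ne
  have s1 := hside _ _ he
  have s2 := hside _ _ hc
  have s3 := hside _ _ hd
  have s4 := hside _ _ hf
  have hcf : c ≠ f := by rintro rfl; tauto
  calc 4 = ({⟨s(a, b), he⟩, ⟨s(b, c), hc⟩, ⟨s(c, d), hd⟩, ⟨s(a, f), hf⟩} :
        Finset H.edgeSet).card := by
        rw [Finset.card_insert_of_notMem, Finset.card_insert_of_notMem, Finset.card_pair]
        all_goals
          simp only [ne_eq, Finset.mem_insert, Finset.mem_singleton]
          grind
    _ ≤ _ := Finset.card_le_card fun e he => by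
        simp only [Finset.mem_insert, Finset.mem_singleton] at he
        rw [Finset.mem_filter]
        rcases he with rfl | rfl | rfl | rfl
        · exact ⟨Finset.mem_univ _, hxe⟩
        · exact ⟨Finset.mem_univ _, hxc⟩
        · exact ⟨Finset.mem_univ _, hxd⟩
        · exact ⟨Finset.mem_univ _, hxf⟩

theorem not_gridMinor_K33 : ¬ GridMinor (completeBipartiteGraph (Fin 3) (Fin 3)) := by
  classical
  intro h
  have h1 := h.card_edges_le_of_bipartite (fun x => x.isLeft) (by
    rintro (u | u) (v | v) h <;> simp_all)
  have h2 : 9 ≤ (completeBipartiteGraph (Fin 3) (Fin 3)).edgeFinset.card := by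
    calc 9 = (Finset.univ : Finset (Fin 3 × Fin 3)).card := by simp
      _ ≤ _ := Finset.card_le_card_of_injOn (fun p => s(Sum.inl p.1, Sum.inr p.2))
          (fun p _ => by simp) (fun p _ q _ h => by simpa [Prod.ext_iff] using h)
  simp only [Fintype.card_sum, Fintype.card_fin] at h1
  omega

/-- No three vertices are all joined to each of `u`, `v` and a star-shaped set `C`. -/
theorem GridMinor.no_K33_star (hH : GridMinor H) {u v y : W} (huv : u ≠ v) (C : Set W)
    (hy : y ∈ C) (hC : ∀ z ∈ C, z = y ∨ H.Adj y z) (hu : u ∉ C) (hv : v ∉ C)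
    {w : Fin 3 → W} (hw : Function.Injective w) (hwC : ∀ i, w i ∉ C)
    (hwu : ∀ i, H.Adj (w i) u) (hwv : ∀ i, H.Adj (w i) v)
    (hwy : ∀ i, ∃ z ∈ C, H.Adj (w i) z) : False := by
  classical
  refine not_gridMinor_K33 (hH.of_model (f := fun x => if x ∈ C then some (Sum.inl 2) else
    if x = u then some (Sum.inl 0) else if x = v then some (Sum.inl 1) else
    if h : ∃ i, w i = x then some (Sum.inr h.choose) else none) ?_)
  set f : W → Option (Fin 3 ⊕ Fin 3) := fun x => if x ∈ C then some (Sum.inl 2) else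
    if x = u then some (Sum.inl 0) else if x = v then some (Sum.inl 1) else
    if h : ∃ i, w i = x then some (Sum.inr h.choose) else none with hf
  have f2 : ∀ x, f x = some (Sum.inl 2) ↔ x ∈ C := by
    intro x; simp only [hf]; split_ifs <;> simp_all
  have f0 : ∀ x, f x = some (Sum.inl 0) ↔ x = u := by
    intro x; simp only [hf]; (split_ifs <;> simp_all); grind
  have f1 : ∀ x, f x = some (Sum.inl 1) ↔ x = v := by
    intro x; simp only [hf]; (split_ifs <;> simp_all); grind
  have fw : ∀ x i, f x = some (Sum.inr i) ↔ x = w i := by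
    intro x i
    have e1 : w i ∉ C := hwC i
    have e2 : w i ≠ u := (hwu i).ne
    have e3 : w i ≠ v := (hwv i).ne
    constructor
    · intro h
      simp only [hf] at h
      split_ifs at h with h1 h2 h3 h4
      · simp at h
      · simp at h
      · simp at h
      · simp only [Option.some.injEq, Sum.inr.injEq] at h
        rw [← h]; exact h4.choose_spec.symm
    · rintro rfl
      have h4 : ∃ j, w j = w i := ⟨i, rfl⟩
      simp only [hf, if_neg e1, if_neg e2, if_neg e3, dif_pos h4]
      rw [hw h4.choose_spec]
  have adj : ∀ (a b : Fin 3), ∃ x z, H.Adj x z ∧ f x = some (Sum.inl a) ∧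
      f z = some (Sum.inr b) := by
    intro a b
    fin_cases a
    · exact ⟨u, w b, (hwu b).symm, (f0 _).2 rfl, (fw _ _).2 rfl⟩
    · exact ⟨v, w b, (hwv b).symm, (f1 _).2 rfl, (fw _ _).2 rfl⟩
    · obtain ⟨z, hz, hwz⟩ := hwy b
      exact ⟨z, w b, hwz.symm, (f2 _).2 hz, (fw _ _).2 rfl⟩
  refine ⟨?_, ?_, ?_⟩
  · rintro (a | b)
    · obtain ⟨x, z, _, h, _⟩ := adj a 0; exact ⟨x, h⟩
    · obtain ⟨x, z, _, _, h⟩ := adj 0 b; exact ⟨z, h⟩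
  · rintro (i | i) a b ha hb
    · fin_cases i
      · cases (f0 _).1 ha; cases (f0 _).1 hb; exact .refl
      · cases (f1 _).1 ha; cases (f1 _).1 hb; exact .refl
      · have h1 : ∀ a, f a = some (Sum.inl 2) → ReflTransGen (fun x y => H.Adj x y ∧
            f x = some (Sum.inl 2) ∧ f y = some (Sum.inl 2)) y a := by
          intro a ha
          rcases hC a ((f2 _).1 ha) with rfl | h
          · exact .refl
          · exact .single ⟨h, (f2 _).2 hy, ha⟩
        exact (reflTransGen_symm (fun x y h => ⟨h.1.symm, h.2.2, h.2.1⟩) (h1 a ha)).trans (h1 b hb)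
    · cases (fw _ _).1 ha; cases (fw _ _).1 hb; exact .refl
  · rintro (i | i) (j | j) h
    · simp at h
    · exact adj i j
    · obtain ⟨x, z, h1, h2, h3⟩ := adj j i
      exact ⟨z, x, h1.symm, h3, h2⟩
    · simp at h

end EdgeBounds

end PlanarFrugal

namespace PlanarFrugal

section TJoin

variable {E F : Type*} 

open Classical in
/-- The indicator function of a vertex over `ZMod 2`. -/
noncomputable def pt (x v : F) : ZMod 2 := if x = v then 1 else 0

/-- The boundary over `ZMod 2` of a finite set of edges. -/
noncomputable def fbd (l r : E → F) (L : Finset E) (v : F) : ZMod 2 :=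
  ∑ e ∈ L, (pt (l e) v + pt (r e) v)

/-- The edge `e` is not a loop and ends in `b`. -/
def IsAt (l r : E → F) (b : F) (e : E) : Prop := ¬ (l e = b ↔ r e = b)

theorem pt_self (x : F) : pt x x = 1 := if_pos rfl

theorem pt_ne {x v : F} (h : x ≠ v) : pt x v = 0 := if_neg h

theorem z2_add_self (a : ZMod 2) : a + a = 0 := CharTwo.add_self_eq_zero a

theorem z2_cases (a : ZMod 2) : a = 0 ∨ a = 1 := by revert a; decide

theorem IsAt.exists_other {l r : E → F} {b : F} {e : E} (h : IsAt l r b e) :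
    ∃ d, d ≠ b ∧ (d = l e ∨ d = r e) ∧ ∀ x, pt (l e) x + pt (r e) x = pt b x + pt d x := by
  unfold IsAt at h
  by_cases h1 : l e = b
  · refine ⟨r e, fun h2 => h (by simp [h1, h2]), Or.inr rfl, fun x => by rw [h1]⟩
  · refine ⟨l e, h1, Or.inl rfl, fun x => ?_⟩
    have h2 : r e = b := by by_contra h2; exact h (by simp [h1, h2])
    rw [h2, add_comm]

theorem fbd_union [DecidableEq E] (l r : E → F) {A B : Finset E} (h : Disjoint A B) (v : F) :
    fbd l r (A ∪ B) v = fbd l r A v + fbd l r B v := Finset.sum_union h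

theorem fbd_sdiff [DecidableEq E] (l r : E → F) {A B : Finset E} (h : B ⊆ A) (v : F) :
    fbd l r (A \ B) v = fbd l r A v + fbd l r B v := by
  have h1 : fbd l r (A \ B) v + fbd l r B v = fbd l r A v := Finset.sum_sdiff h
  have h2 := z2_add_self (fbd l r B v)
  linear_combination h1 - h2

theorem fbd_symmDiff [DecidableEq E] (l r : E → F) (A B : Finset E) (v : F) :
    fbd l r (symmDiff A B) v = fbd l r A v + fbd l r B v := by
  have h1 : symmDiff A B = (A \ B) ∪ (B \ A) := rfl
  rw [h1, fbd_union l r (disjoint_sdiff_sdiff)]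
  have hA : fbd l r (A \ B) v + fbd l r (A ∩ B) v = fbd l r A v := by
    rw [← Finset.sdiff_inter_self_left]; exact Finset.sum_sdiff Finset.inter_subset_left
  have hB : fbd l r (B \ A) v + fbd l r (A ∩ B) v = fbd l r B v := by
    rw [← Finset.sdiff_inter_self_right]; exact Finset.sum_sdiff Finset.inter_subset_right
  have h2 := z2_add_self (fbd l r (A ∩ B) v)
  linear_combination hA + hB - h2

theorem fbd_singleton (l r : E → F) (e : E) (v : F) :
    fbd l r {e} v = pt (l e) v + pt (r e) v := Finset.sum_singleton _ _

theorem fbd_empty (l r : E → F) (v : F) : fbd l r ∅ v = 0 := rfl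

theorem sum_fbd [Fintype F] (l r : E → F) (L : Finset E) : ∑ v, fbd l r L v = 0 := by
  classical
  simp only [fbd]
  rw [Finset.sum_comm]
  refine Finset.sum_eq_zero fun e _ => ?_
  simp [Finset.sum_add_distrib, pt, z2_add_self]

theorem exists_isAt_of_fbd_ne_zero {l r : E → F} {L : Finset E} {v : F} (h : fbd l r L v ≠ 0) :
    ∃ e ∈ L, IsAt l r v e := by
  obtain ⟨e, he, h⟩ := Finset.exists_ne_zero_of_sum_ne_zero h
  refine ⟨e, he, fun hiff => h ?_⟩
  by_cases h1 : l e = v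
  · rw [h1, hiff.1 h1]; exact z2_add_self _
  · rw [pt_ne h1, pt_ne (fun h2 => h1 (hiff.2 h2)), add_zero]

theorem exists_component (l r : E → F) (L : Finset E) (d : F) :
    ∃ A : Set F, d ∈ A ∧ (∀ v ∈ A, ∃ L₁ ⊆ L, ∀ x, fbd l r L₁ x = pt d x + pt v x) ∧
      ∀ e ∈ L, (l e ∈ A ↔ r e ∈ A) := by
  classical
  refine ⟨{v | ∃ L₁ ⊆ L, ∀ x, fbd l r L₁ x = pt d x + pt v x},
    ⟨∅, Finset.empty_subset _, fun x => by rw [fbd_empty, z2_add_self]⟩, fun v h => h, ?_⟩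
  intro e he
  have sub : ∀ L₁ ⊆ L, symmDiff L₁ {e} ⊆ L := by
    intro L₁ h x hx
    rcases Finset.mem_symmDiff.1 hx with h1 | h1
    · exact h h1.1
    · rw [Finset.mem_singleton.1 h1.1]; exact he
  constructor
  · rintro ⟨L₁, h1, h2⟩
    refine ⟨symmDiff L₁ {e}, sub _ h1, fun x => ?_⟩
    rw [fbd_symmDiff, h2, fbd_singleton]
    linear_combination z2_add_self (pt (l e) x)
  · rintro ⟨L₁, h1, h2⟩
    refine ⟨symmDiff L₁ {e}, sub _ h1, fun x => ?_⟩
    rw [fbd_symmDiff, h2, fbd_singleton]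
    linear_combination z2_add_self (pt (r e) x)

open Classical in
theorem fbd_filter_of_closed {l r : E → F} {L : Finset E} {A : Set F}
    (h : ∀ e ∈ L, (l e ∈ A ↔ r e ∈ A)) (x : F) :
    fbd l r (L.filter fun e => l e ∈ A) x = if x ∈ A then fbd l r L x else 0 := by
  split_ifs with hx
  · simp only [fbd]
    refine Finset.sum_subset (Finset.filter_subset _ _) fun e he he' => ?_
    have h1 : l e ∉ A := fun h1 => he' (Finset.mem_filter.2 ⟨he, h1⟩)
    have h2 : r e ∉ A := fun h2 => h1 ((h e he).2 h2)
    rw [pt_ne (fun h : l e = x => h1 (h ▸ hx)), pt_ne (fun h : r e = x => h2 (h ▸ hx)), add_zero]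
  · refine Finset.sum_eq_zero fun e he => ?_
    rw [Finset.mem_filter] at he
    have h2 := (h e he.1).1 he.2
    rw [pt_ne (fun h : l e = x => hx (h ▸ he.2)), pt_ne (fun h : r e = x => hx (h ▸ h2)), add_zero]

theorem exists_other_of_component [Fintype F] {l r : E → F} {L : Finset E} {A : Set F}
    (h : ∀ e ∈ L, (l e ∈ A ↔ r e ∈ A)) {d : F} (hd : d ∈ A) (hdL : fbd l r L d ≠ 0) :
    ∃ c ∈ A, c ≠ d ∧ fbd l r L c ≠ 0 := by
  classical
  by_contra hcon
  push Not at hcon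
  have h1 := sum_fbd l r (L.filter fun e => l e ∈ A)
  rw [Finset.sum_eq_single d] at h1
  · rw [fbd_filter_of_closed h, if_pos hd] at h1
    exact hdL h1
  · intro c _ hc
    rw [fbd_filter_of_closed h]
    split_ifs with hcA
    · exact hcon c hcA hc
    · rfl
  · simp

/-- Edge sets without nonempty even subset. -/
def IsForest (l r : E → F) (L : Finset E) : Prop :=
  ∀ z ⊆ L, (∀ v, fbd l r z v = 0) → z = ∅

theorem IsForest.leaf [Fintype F] {l r : E → F} {L : Finset E} (hL : IsForest l r L) {b c : F}
    (hbc : b ≠ c) (hbd : ∀ x, fbd l r L x = pt b x + pt c x) :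
    ∃ f ∈ L, IsAt l r b f ∧ ∀ g ∈ L, g ≠ f → l g ≠ b ∧ r g ≠ b := by
  classical
  obtain ⟨f, hf, hfb⟩ := exists_isAt_of_fbd_ne_zero (l := l) (r := r) (L := L) (v := b)
    (by rw [hbd, pt_self, pt_ne hbc.symm]; decide)
  refine ⟨f, hf, hfb, ?_⟩
  obtain ⟨d, hdb, -, hd⟩ := hfb.exists_other
  have hL' : ∀ x, fbd l r (L.erase f) x = pt d x + pt c x := by
    intro x
    rw [← Finset.sdiff_singleton_eq_erase, fbd_sdiff l r (Finset.singleton_subset_iff.2 hf), hbd,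
      fbd_singleton, hd]
    linear_combination z2_add_self (pt b x)
  by_cases hdc : d = c
  · have : L.erase f = ∅ := hL _ (Finset.erase_subset _ _) (fun v => by
      rw [hL', hdc, z2_add_self])
    intro g hg hgf
    have := Finset.mem_erase.2 ⟨hgf, hg⟩
    simp_all
  obtain ⟨A, hdA, hA, hcl⟩ := exists_component l r (L.erase f) d
  have hbA : b ∉ A := by
    intro hb
    obtain ⟨L₁, hL₁, h1⟩ := hA b hb
    have hf' : f ∉ L₁ := fun h => (Finset.mem_erase.1 (hL₁ h)).1 rfl
    have h2 := hL (L₁ ∪ {f}) (Finset.union_subset (hL₁.trans (Finset.erase_subset _ _))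
      (Finset.singleton_subset_iff.2 hf)) (fun v => by
        rw [fbd_union l r (by simpa using hf'), h1, fbd_singleton, hd]
        linear_combination z2_add_self (pt b v) + z2_add_self (pt d v))
    simp at h2
  have hcA : c ∈ A := by
    obtain ⟨q, hq, hqd, h⟩ := exists_other_of_component hcl hdA
      (by rw [hL', pt_self, pt_ne (Ne.symm hdc)]; decide)
    rw [hL', pt_ne hqd.symm, zero_add] at h
    have : c = q := by by_contra hne; exact h (pt_ne hne)
    rwa [this]
  have hempty : (L.erase f) \ ((L.erase f).filter fun e => l e ∈ A) = ∅ := by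
    refine hL _ (Finset.sdiff_subset.trans (Finset.erase_subset _ _)) fun v => ?_
    rw [fbd_sdiff l r (Finset.filter_subset _ _), fbd_filter_of_closed hcl]
    split_ifs with hv
    · exact z2_add_self _
    · rw [hL', pt_ne (fun h : d = v => hv (h ▸ hdA)), pt_ne (fun h : c = v => hv (h ▸ hcA))]; rfl
  intro g hg hgf
  have hg' := Finset.mem_erase.2 ⟨hgf, hg⟩
  have : g ∈ (L.erase f).filter fun e => l e ∈ A := by
    by_contra h
    have : g ∈ (L.erase f) \ ((L.erase f).filter fun e => l e ∈ A) :=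
      Finset.mem_sdiff.2 ⟨hg', h⟩
    rw [hempty] at this
    simp at this
  have h1 := (Finset.mem_filter.1 this).2
  exact ⟨fun h => hbA (h ▸ h1), fun h => hbA (h ▸ (hcl g hg').1 h1)⟩

theorem exists_isAt_or_fbd_eq_zero {l r : E → F} {L : Finset E} {v : F}
    (h : ∀ e ∈ L, ¬ IsAt l r v e) : fbd l r L v = 0 := by
  by_contra hne
  obtain ⟨e, he, h'⟩ := exists_isAt_of_fbd_ne_zero hne
  exact h e he h'

open Classical in
theorem fbd_eq_card (l r : E → F) (L : Finset E) (v : F) :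
    fbd l r L v = ((L.filter fun e => IsAt l r v e).card : ZMod 2) := by
  rw [Finset.card_filter]
  push_cast
  refine Finset.sum_congr rfl fun e _ => ?_
  unfold IsAt pt
  by_cases h1 : l e = v <;> by_cases h2 : r e = v <;> simp [h1, h2, z2_add_self]

/-- The circuits through a vertex of an inclusion-minimal even edge set. -/
theorem exists_arc_of_minimal {l r : E → F} {z : Finset E} (hz : ∀ v, fbd l r z v = 0)
    (hmin : ∀ y ⊆ z, (∀ v, fbd l r y v = 0) → y = ∅ ∨ y = z) {b q : F} {e g : E} (he : e ∈ z)
    (heb : IsAt l r b e) (hg : g ∈ z) (hgq : IsAt l r q g) :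
    ∃ Z ⊆ z, ∀ x, fbd l r Z x = pt b x + pt q x := by
  classical
  obtain ⟨A, hbA, hA, hcl⟩ := exists_component l r z b
  have hev : ∀ v, fbd l r (z.filter fun e => l e ∈ A) v = 0 := by
    intro v
    rw [fbd_filter_of_closed hcl, hz]; simp
  have heA : l e ∈ A := by
    by_cases h : l e = b
    · rwa [h]
    · have : r e = b := by by_contra h2; exact heb (by simp [h, h2])
      rw [hcl e he, this]; exact hbA
  rcases hmin _ (Finset.filter_subset _ _) hev with h | h
  · have : e ∈ z.filter fun e => l e ∈ A := Finset.mem_filter.2 ⟨he, heA⟩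
    rw [h] at this
    simp at this
  · have hgA : l g ∈ A := by
      rw [← h] at hg
      exact (Finset.mem_filter.1 hg).2
    refine hA q ?_
    by_cases h' : l g = q
    · rwa [← h']
    · have : r g = q := by by_contra h2; exact hgq (by simp [h', h2])
      rw [← this, ← hcl g hg]; exact hgA

/-- `K` is a lightest edge set whose boundary consists of two vertices, and has as few edges as
possible among these. -/
structure IsLightest (l r : E → F) (ω : E → ℤ) (K : Finset E) (s b : F) : Prop where
  ne : s ≠ b
  bd : ∀ x, fbd l r K x = pt s x + pt b x
  le : ∀ K' x y, x ≠ y → (∀ v, fbd l r K' v = pt x v + pt y v) → ∑ e ∈ K, ω e ≤ ∑ e ∈ K', ω e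
  card_le : ∀ K' x y, x ≠ y → (∀ v, fbd l r K' v = pt x v + pt y v) →
    ∑ e ∈ K', ω e ≤ ∑ e ∈ K, ω e → K.card ≤ K'.card
  neg : ∑ e ∈ K, ω e < 0

theorem exists_isLightest [Fintype E] (l r : E → F) (ω : E → ℤ) {e₀ : E} (h₀ : l e₀ ≠ r e₀)
    (h₁ : ω e₀ < 0) : ∃ K s b, IsLightest l r ω K s b := by
  classical
  set P : Finset (Finset E) := Finset.univ.filter fun K =>
    ∃ x y, x ≠ y ∧ ∀ v, fbd l r K v = pt x v + pt y v
  have h0P : {e₀} ∈ P := Finset.mem_filter.2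
    ⟨Finset.mem_univ _, _, _, h₀, fun v => fbd_singleton l r e₀ v⟩
  obtain ⟨K, hK, hmin⟩ := Finset.exists_min_image P
    (fun K => toLex (∑ e ∈ K, ω e, K.card)) ⟨_, h0P⟩
  simp only [Prod.Lex.toLex_le_toLex] at hmin
  obtain ⟨s, b, hsb, hbd⟩ := (Finset.mem_filter.1 hK).2
  refine ⟨K, s, b, hsb, hbd, fun K' x y hxy h => ?_, fun K' x y hxy h h' => ?_, ?_⟩
  · have := hmin K' (Finset.mem_filter.2 ⟨Finset.mem_univ _, x, y, hxy, h⟩)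
    omega
  · have := hmin K' (Finset.mem_filter.2 ⟨Finset.mem_univ _, x, y, hxy, h⟩)
    omega
  · have := hmin _ h0P
    simp only [Finset.sum_singleton] at this
    omega

namespace IsLightest

variable {l r : E → F} {ω : E → ℤ} {K : Finset E} {s b : F}

theorem isForest (hK : IsLightest l r ω K s b)
    (hω : ∀ z : Finset E, (∀ v, fbd l r z v = 0) → 0 ≤ ∑ e ∈ z, ω e) : IsForest l r K := by
  classical
  intro z hz hev
  have h1 : ∑ e ∈ K \ z, ω e + ∑ e ∈ z, ω e = ∑ e ∈ K, ω e := Finset.sum_sdiff hz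
  have h2 := hK.card_le (K \ z) s b hK.ne (fun v => by
    rw [fbd_sdiff l r hz, hev, add_zero, hK.bd]) (by have := hω z hev; omega)
  have h3 := Finset.card_sdiff_add_card_eq_card hz
  exact Finset.card_eq_zero.1 (by omega)

/-- The end of a lightest path: a star with exactly one negative edge. -/
theorem exists_star [Fintype F] (hK : IsLightest l r ω K s b)
    (hω : ∀ z : Finset E, (∀ v, fbd l r z v = 0) → 0 ≤ ∑ e ∈ z, ω e)
    (hne : ∀ e, l e ≠ r e → ω e ≠ 0) :
    ∃ f ∈ K, IsAt l r b f ∧ (∀ g ∈ K, g ≠ f → l g ≠ b ∧ r g ≠ b) ∧ ω f < 0 ∧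
      ∀ g, IsAt l r b g → g ≠ f → 0 < ω g := by
  classical
  obtain ⟨f, hfK, hfb, hf⟩ := (hK.isForest hω).leaf hK.ne.symm (fun x => by
    rw [hK.bd, add_comm])
  have hnl : ∀ g, IsAt l r b g → ω g ≠ 0 := fun g hg => hne g fun h => hg (by rw [h])
  refine ⟨f, hfK, hfb, hf, ?_, fun g hg hgf => ?_⟩
  · obtain ⟨d, hdb, -, hd⟩ := hfb.exists_other
    have h1 : ∑ e ∈ K \ {f}, ω e + ∑ e ∈ {f}, ω e = ∑ e ∈ K, ω e :=
      Finset.sum_sdiff (Finset.singleton_subset_iff.2 hfK)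
    rw [Finset.sum_singleton] at h1
    have hbd : ∀ v, fbd l r (K \ {f}) v = pt s v + pt d v := fun v => by
      rw [fbd_sdiff l r (Finset.singleton_subset_iff.2 hfK), fbd_singleton, hd, hK.bd]
      linear_combination z2_add_self (pt b v)
    by_cases hsd : s = d
    · have := hω _ (fun v => by rw [hbd v, hsd, z2_add_self])
      have := hK.neg
      omega
    · have h2 := hK.le _ _ _ hsd hbd
      have h3 := hnl f hfb
      by_contra hcon
      have h4 := hK.card_le _ _ _ hsd hbd (by omega)
      have h5 := Finset.card_sdiff_add_card_eq_card (Finset.singleton_subset_iff.2 hfK)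
      rw [Finset.card_singleton] at h5
      omega
  · have hgK : g ∉ K := fun h => by
      have := hf g h hgf
      exact hg (by simp [this])
    obtain ⟨d, hdb, -, hd⟩ := hg.exists_other
    have h1 : ∑ e ∈ K ∪ {g}, ω e = ∑ e ∈ K, ω e + ω g := by
      rw [Finset.sum_union (by simpa using hgK), Finset.sum_singleton]
    have hbd : ∀ v, fbd l r (K ∪ {g}) v = pt s v + pt d v := fun v => by
      rw [fbd_union l r (by simpa using hgK), fbd_singleton, hd, hK.bd]
      linear_combination z2_add_self (pt b v)
    have h3 := hnl g hg
    by_cases hsd : s = d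
    · have := hω _ (fun v => by rw [hbd v, hsd, z2_add_self])
      have := hK.neg
      omega
    · have h2 := hK.le _ _ _ hsd hbd
      omega

end IsLightest

end TJoin

end PlanarFrugal

namespace PlanarFrugal

section TJoinShift

variable {E F : Type*} {l r : E → F} {ω : E → ℤ} {K : Finset E} {s b : F}

/-- An inclusion-minimal even set of weight zero cannot pass through the end of a lightest path
without using the last edge of that path. -/
theorem IsLightest.not_minimal [Fintype F] (hK : IsLightest l r ω K s b)
    (hω : ∀ z : Finset E, (∀ v, fbd l r z v = 0) → 0 ≤ ∑ e ∈ z, ω e)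
    {f : E} (hf : ∀ g ∈ K, g ≠ f → l g ≠ b ∧ r g ≠ b)
    (hpos : ∀ g, IsAt l r b g → g ≠ f → 0 < ω g) {z : Finset E} (hz : ∀ v, fbd l r z v = 0)
    (hmin : ∀ y ⊆ z, (∀ v, fbd l r y v = 0) → y = ∅ ∨ y = z) (hfz : f ∉ z)
    (hz0 : ∑ e ∈ z, ω e = 0) {e : E} (he : e ∈ z) (heb : IsAt l r b e) : False := by
  classical
  have hnot : ∀ g, IsAt l r b g → g ≠ f → g ∉ K := fun g hg hgf hgK => by
    have := hf g hgK hgf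
    exact hg (by simp [this])
  have hef : e ≠ f := fun h => hfz (h ▸ he)
  have heK := hnot e heb hef
  obtain ⟨c, hcb, -, hc⟩ := heb.exists_other
  have hez : {e} ⊆ z := Finset.singleton_subset_iff.2 he
  have hLbd : ∀ v, fbd l r (z \ {e}) v = pt b v + pt c v := fun v => by
    rw [fbd_sdiff l r hez, hz, fbd_singleton, hc, zero_add]
  have hDbd : ∀ v, fbd l r (symmDiff K (z \ {e})) v = pt s v + pt c v := fun v => by
    rw [fbd_symmDiff, hLbd, hK.bd]
    linear_combination z2_add_self (pt b v)
  have hKz : ∑ e ∈ K ∩ z, ω e < 0 := by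
    have h1 : ∑ g ∈ z \ {e}, ω g + ∑ g ∈ {e}, ω g = ∑ e ∈ z, ω e := Finset.sum_sdiff hez
    rw [Finset.sum_singleton] at h1
    have h2 : ∑ g ∈ symmDiff K (z \ {e}), ω g =
        ∑ g ∈ K \ (z \ {e}), ω g + ∑ g ∈ (z \ {e}) \ K, ω g :=
      Finset.sum_union disjoint_sdiff_sdiff
    have h3 : ∑ g ∈ K \ (z \ {e}), ω g + ∑ g ∈ K ∩ (z \ {e}), ω g = ∑ g ∈ K, ω g := by
      rw [← Finset.sdiff_inter_self_left]; exact Finset.sum_sdiff Finset.inter_subset_left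
    have h4 : ∑ g ∈ (z \ {e}) \ K, ω g + ∑ g ∈ K ∩ (z \ {e}), ω g = ∑ g ∈ z \ {e}, ω g := by
      rw [← Finset.sdiff_inter_self_right]; exact Finset.sum_sdiff Finset.inter_subset_right
    have h5 : K ∩ (z \ {e}) = K ∩ z := by
      ext g
      simp only [Finset.mem_inter, Finset.mem_sdiff, Finset.mem_singleton]
      constructor
      · tauto
      · rintro ⟨h, h'⟩
        exact ⟨h, h', fun h2 => heK (h2 ▸ h)⟩
    rw [h5] at h3 h4
    have h6 := hpos e heb hef
    have h7 := hK.neg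
    by_cases hsc : s = c
    · have := hω _ (fun v => by rw [hDbd v, hsc, z2_add_self])
      omega
    · have := hK.le _ _ _ hsc hDbd
      omega
  have hsub : K \ (K ∩ z) = K \ z := Finset.sdiff_inter_self_left K z
  have hKmz : ∀ v, fbd l r (K \ z) v = pt s v + pt b v + fbd l r (K ∩ z) v := fun v => by
    rw [← hsub, fbd_sdiff l r Finset.inter_subset_left, hK.bd]
  have hKzb : fbd l r (K ∩ z) b = 0 := exists_isAt_or_fbd_eq_zero fun g hg hgb =>
    hnot g hgb (fun h => hfz (h ▸ (Finset.mem_inter.1 hg).2)) (Finset.mem_inter.1 hg).1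
  have hb1 : fbd l r (K \ z) b = 1 := by
    rw [hKmz, hKzb, pt_ne hK.ne, pt_self]; rfl
  obtain ⟨A, hbA, hA, hcl⟩ := exists_component l r (K \ z) b
  obtain ⟨q, hqA, hqb, hqs, hq⟩ : ∃ q ∈ A, q ≠ b ∧ q ≠ s ∧ fbd l r (K \ z) q ≠ 0 := by
    by_contra hcon
    push Not at hcon
    obtain ⟨q, hqA, hqb, hq⟩ := exists_other_of_component hcl hbA (by rw [hb1]; decide)
    have hqs : q = s := by by_contra h; exact hq (hcon q hqA hqb h)
    subst hqs
    have hev : ∀ v, fbd l r (K \ ((K \ z).filter fun e => l e ∈ A)) v = 0 := fun v => by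
      rw [fbd_sdiff l r ((Finset.filter_subset _ _).trans Finset.sdiff_subset),
        fbd_filter_of_closed hcl, hK.bd]
      by_cases hvb : v = b
      · subst hvb
        rw [if_pos hbA, hb1, pt_ne hK.ne, pt_self]; rfl
      by_cases hvs : v = q
      · subst hvs
        rw [if_pos hqA, pt_self, pt_ne hK.ne.symm, (z2_cases _).resolve_left hq]; rfl
      · rw [pt_ne (Ne.symm hvb), pt_ne (Ne.symm hvs)]
        split_ifs with hvA
        · rw [hcon v hvA hvb hvs]; rfl
        · rfl
    have h1 := hK.isForest hω _ Finset.sdiff_subset hev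
    have h2 : K ∩ z = ∅ := by
      rw [Finset.sdiff_eq_empty_iff_subset] at h1
      ext g
      simp only [Finset.mem_inter, Finset.notMem_empty, iff_false]
      rintro ⟨h, h'⟩
      exact (Finset.mem_sdiff.1 (Finset.mem_filter.1 (h1 h)).1).2 h'
    rw [h2] at hKz
    simp at hKz
  obtain ⟨g, hg, hgq⟩ := exists_isAt_of_fbd_ne_zero (l := l) (r := r) (L := K ∩ z) (v := q) (by
    rw [hKmz, pt_ne hqs.symm, pt_ne hqb.symm] at hq
    simpa using hq)
  obtain ⟨Z, hZz, hZ⟩ := exists_arc_of_minimal hz hmin he heb (Finset.mem_inter.1 hg).2 hgq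
  obtain ⟨K₁, hK₁, hK₁bd⟩ := hA q hqA
  have hdis : ∀ y ⊆ z, Disjoint K₁ y := fun y hy =>
    Finset.disjoint_of_subset_left hK₁ (Finset.disjoint_of_subset_right hy Finset.sdiff_disjoint)
  have hK₁K : K₁ ⊆ K := hK₁.trans Finset.sdiff_subset
  have h1 := hω (K₁ ∪ Z) (fun v => by
    rw [fbd_union l r (hdis Z hZz), hZ, hK₁bd]
    exact z2_add_self _)
  have h2 := hω (K₁ ∪ (z \ Z)) (fun v => by
    rw [fbd_union l r (hdis _ Finset.sdiff_subset), fbd_sdiff l r hZz, hz, hZ, hK₁bd, zero_add]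
    exact z2_add_self _)
  rw [Finset.sum_union (hdis _ hZz)] at h1
  rw [Finset.sum_union (hdis _ Finset.sdiff_subset)] at h2
  have h3 : ∑ e ∈ z \ Z, ω e + ∑ e ∈ Z, ω e = ∑ e ∈ z, ω e := Finset.sum_sdiff hZz
  have h4 : ∑ e ∈ K \ K₁, ω e + ∑ e ∈ K₁, ω e = ∑ e ∈ K, ω e := Finset.sum_sdiff hK₁K
  have h5 := hK.card_le (K \ K₁) s q hqs.symm (fun v => by
    rw [fbd_sdiff l r hK₁K, hK.bd, hK₁bd]
    linear_combination z2_add_self (pt b v)) (by omega)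
  have h6 := Finset.card_sdiff_add_card_eq_card hK₁K
  have h7 : K₁ = ∅ := Finset.card_eq_zero.1 (by omega)
  have h8 := hK₁bd b
  rw [h7, fbd_empty, pt_self, pt_ne hqb] at h8
  exact absurd h8 (by decide)

open Classical in
/-- Decreasing the absolute value of a weight by one on the star at the end of a lightest path
keeps all even sets nonnegative. -/
theorem IsLightest.nonneg_shift [Fintype F] (hK : IsLightest l r ω K s b)
    (hω : ∀ z : Finset E, (∀ v, fbd l r z v = 0) → 0 ≤ ∑ e ∈ z, ω e)
    (hpar : ∀ z : Finset E, (∀ v, fbd l r z v = 0) → Even (∑ e ∈ z, ω e))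
    {f : E} (hfat : IsAt l r b f) (hf : ∀ g ∈ K, g ≠ f → l g ≠ b ∧ r g ≠ b)
    (hpos : ∀ g, IsAt l r b g → g ≠ f → 0 < ω g) (z : Finset E) (hz : ∀ v, fbd l r z v = 0) :
    0 ≤ ∑ e ∈ z, (ω e + if IsAt l r b e then (if e = f then 1 else -1) else 0) := by
  set δ : E → ℤ := fun e => if IsAt l r b e then (if e = f then 1 else -1) else 0 with hδ
  induction z using Finset.strongInduction with
  | H z ih =>
    by_cases hmin : ∀ y ⊆ z, (∀ v, fbd l r y v = 0) → y = ∅ ∨ y = z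
    swap
    · push Not at hmin
      obtain ⟨y, hyz, hy, hy0, hyne⟩ := hmin
      rw [← Finset.sum_sdiff hyz]
      refine add_nonneg (ih _ ?_ fun v => by rw [fbd_sdiff l r hyz, hz, hy]; rfl)
        (ih _ (Finset.ssubset_iff_subset_ne.2 ⟨hyz, hyne⟩) hy)
      exact Finset.sdiff_ssubset hyz hy0
    rw [Finset.sum_add_distrib]
    by_cases hex : ∃ e ∈ z, IsAt l r b e
    swap
    · push Not at hex
      have : ∑ e ∈ z, δ e = 0 := Finset.sum_eq_zero fun e he => if_neg (hex e he)
      rw [this, add_zero]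
      exact hω z hz
    obtain ⟨e, he, heb⟩ := hex
    obtain ⟨c, hcb, -, hc⟩ := heb.exists_other
    have hsub : {e} ⊆ z := Finset.singleton_subset_iff.2 he
    have hfor : IsForest l r (z \ {e}) := by
      intro y hy hev
      refine (hmin y (hy.trans Finset.sdiff_subset) hev).resolve_right fun h => ?_
      have := hy (h.symm ▸ he)
      simp at this
    obtain ⟨g, hg, hgb, hgu⟩ := hfor.leaf hcb.symm (fun v => by
      rw [fbd_sdiff l r hsub, hz, fbd_singleton, hc, zero_add])
    have hsub' : {g} ⊆ z \ {e} := Finset.singleton_subset_iff.2 hg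
    have hsum : ∑ e ∈ z, δ e = δ g + δ e := by
      rw [← Finset.sum_sdiff hsub, ← Finset.sum_sdiff hsub', Finset.sum_singleton,
        Finset.sum_singleton, Finset.sum_eq_zero, zero_add]
      intro x hx
      rw [Finset.mem_sdiff, Finset.mem_singleton] at hx
      refine if_neg fun h => h ?_
      have := hgu x hx.1 hx.2
      simp [this]
    rw [hsum]
    have hge : g ≠ e := by simpa using (Finset.mem_sdiff.1 hg).2
    have hgz : g ∈ z := (Finset.mem_sdiff.1 hg).1
    have h0 := hω z hz
    simp only [hδ, if_pos heb, if_pos hgb]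
    by_cases hef : e = f
    · rw [if_pos hef, if_neg (fun h => hge (h.trans hef.symm))]
      omega
    by_cases hgf : g = f
    · rw [if_neg hef, if_pos hgf]
      omega
    rw [if_neg hef, if_neg hgf]
    by_contra hcon
    obtain ⟨m, hm⟩ := hpar z hz
    refine hK.not_minimal hω hf hpos hz hmin ?_ (by omega) he heb
    intro hfz
    have := hgu f (by simp [hfz, Ne.symm hef]) (Ne.symm hgf)
    exact hfat (by simp [this])

end TJoinShift

end PlanarFrugal

namespace PlanarFrugal

section TJoinBound

variable {E F : Type*}

theorem sum_symmDiff_singleton [DecidableEq E] {M : Type*} [AddCommMonoid M] (g : E → M)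
    (z : Finset E) {e : E} (he : g e = 0) : ∑ x ∈ symmDiff z {e}, g x = ∑ x ∈ z, g x := by
  have h1 : ∑ x ∈ z \ {e}, g x = ∑ x ∈ symmDiff z {e}, g x := by
    refine Finset.sum_subset Finset.subset_union_left fun x hx hx' => ?_
    simp only [Finset.mem_symmDiff, Finset.mem_sdiff, Finset.mem_singleton] at hx hx'
    have : x = e := by tauto
    rw [this, he]
  have h2 : ∑ x ∈ z \ {e}, g x = ∑ x ∈ z, g x := by
    refine Finset.sum_subset Finset.sdiff_subset fun x hx hx' => ?_
    simp only [Finset.mem_sdiff, Finset.mem_singleton] at hx hx'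
    have : x = e := by tauto
    rw [this, he]
  rw [← h1, h2]

open Classical in
/-- Identifying the two ends of an edge creates no new even sets, up to toggling that edge. -/
theorem even_of_collapse [Fintype F] {l r : E → F} {e : E} (he : l e ≠ r e) {z : Finset E}
    (hz : ∀ v, fbd (fun x => if l x = r e then l e else l x)
      (fun x => if r x = r e then l e else r x) z v = 0) :
    (∀ v, fbd l r z v = 0) ∨ ∀ v, fbd l r (symmDiff z {e}) v = 0 := by
  have hσ : ∀ x v : F, v ≠ l e → v ≠ r e → pt (if x = r e then l e else x) v = pt x v := by
    intro x v h1 h2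
    split_ifs with h
    · rw [h, pt_ne h1.symm, pt_ne h2.symm]
    · rfl
  have h0 : ∀ v, v ≠ l e → v ≠ r e → fbd l r z v = 0 := by
    intro v h1 h2
    rw [← hz v]
    refine Finset.sum_congr rfl fun x _ => ?_
    rw [hσ _ v h1 h2, hσ _ v h1 h2]
  have h1 := sum_fbd l r z
  rw [Finset.sum_eq_add (l e) (r e) he (fun c _ hc => h0 c hc.1 hc.2) (by simp) (by simp)] at h1
  have h2 : fbd l r z (l e) = fbd l r z (r e) := by
    have := z2_add_self (fbd l r z (r e))
    linear_combination h1 - this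
  rcases z2_cases (fbd l r z (l e)) with h | h
  · left
    intro v
    by_cases hv : v = l e
    · rw [hv, h]
    by_cases hv' : v = r e
    · rw [hv', ← h2, h]
    exact h0 v hv hv'
  · right
    intro v
    rw [fbd_symmDiff, fbd_singleton]
    by_cases hv : v = l e
    · rw [hv, h, pt_self, pt_ne he.symm]; rfl
    by_cases hv' : v = r e
    · rw [hv', ← h2, h, pt_self, pt_ne he]; rfl
    rw [h0 v hv hv', pt_ne (Ne.symm hv), pt_ne (Ne.symm hv')]; rfl

/-- The weight `w` with its sign changed on `J`. -/
noncomputable def signed (w : E → ℕ) (J : Finset E) (e : E) : ℤ :=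
  open Classical in if e ∈ J then -(w e : ℤ) else w e

open Classical in
/-- In a bridgeless graph, a minimum weight set of edges `J` whose complement meets every cut in
an even number of edges has at most one third of the total weight. -/
theorem three_mul_sum_le [Fintype E] [Fintype F] (J : Finset E) (n : ℕ) (l r : E → F)
    (w : E → ℕ) (hn : ∑ e, w e + (Finset.univ.filter fun e => l e ≠ r e).card ≤ n)
    (heven : ∀ A : Set F, Even (Finset.univ.filter fun e => e ∉ J ∧ ¬ (l e ∈ A ↔ r e ∈ A)).card)
    (hbridge : ∀ A : Set F, (Finset.univ.filter fun e => ¬ (l e ∈ A ↔ r e ∈ A)).card ≠ 1)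
    (hpar : ∀ z : Finset E, (∀ v, fbd l r z v = 0) → Even (∑ e ∈ z, w e))
    (hmin : ∀ z : Finset E, (∀ v, fbd l r z v = 0) → 0 ≤ ∑ e ∈ z, signed w J e) :
    3 * ∑ e ∈ J, w e ≤ ∑ e, w e := by
  induction n using Nat.strong_induction_on generalizing l r w with
  | h n ih =>
  by_cases hzero : ∃ e, l e ≠ r e ∧ w e = 0
  · obtain ⟨e, he, hwe⟩ := hzero
    have hσe : signed w J e = 0 := by simp [signed, hwe]
    refine ih (∑ e, w e + (Finset.univ.filter fun x =>
        (if l x = r e then l e else l x) ≠ if r x = r e then l e else r x).card)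
      ?_ (fun x => if l x = r e then l e else l x) (fun x => if r x = r e then l e else r x) w le_rfl
      (fun A => heven ((fun x => if x = r e then l e else x) ⁻¹' A))
      (fun A => hbridge ((fun x => if x = r e then l e else x) ⁻¹' A)) ?_ ?_
    · refine lt_of_lt_of_le (Nat.add_lt_add_left (Finset.card_lt_card ?_) _) hn
      refine (Finset.ssubset_iff_of_subset ?_).2 ⟨e, by simp [he], by simp [he]⟩
      intro x hx
      simp only [Finset.mem_filter, Finset.mem_univ, true_and] at hx ⊢
      intro h
      exact hx (by rw [h])
    · intro z hz
      rcases even_of_collapse he hz with h | h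
      · exact hpar z h
      · rw [← sum_symmDiff_singleton w z hwe]; exact hpar _ h
    · intro z hz
      rcases even_of_collapse he hz with h | h
      · exact hmin z h
      · rw [← sum_symmDiff_singleton _ z hσe]; exact hmin _ h
  push Not at hzero
  by_cases hJ : ∃ e ∈ J, l e ≠ r e
  swap
  · push Not at hJ
    have : ∑ e ∈ J, w e = 0 := Finset.sum_eq_zero fun e he => by
      have := hmin {e} fun v => by rw [fbd_singleton, hJ e he, z2_add_self]
      rw [Finset.sum_singleton, signed, if_pos he] at this
      omega
    rw [this]; simp
  obtain ⟨e₀, he₀, hne₀⟩ := hJ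
  have hne : ∀ e, l e ≠ r e → signed w J e ≠ 0 := by
    intro e he
    have := hzero e he
    unfold signed
    split_ifs <;> omega
  obtain ⟨K, s, b, hK⟩ := exists_isLightest l r (signed w J) hne₀ (by
    have := hzero _ hne₀
    rw [signed, if_pos he₀]; omega)
  obtain ⟨f, hfK, hfb, hf, hfneg, hpos⟩ := hK.exists_star hmin hne
  have hfJ : f ∈ J := by
    by_contra h
    rw [signed, if_neg h] at hfneg
    omega
  have hgJ : ∀ g, IsAt l r b g → g ≠ f → g ∉ J := by
    intro g hg hgf h
    have := hpos g hg hgf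
    rw [signed, if_pos h] at this
    omega
  have hw1 : ∀ g, IsAt l r b g → 1 ≤ w g := by
    intro g hg
    have := hzero g (fun h => hg (by rw [h]))
    omega
  set w' : E → ℕ := fun e => if IsAt l r b e then w e - 1 else w e with hw'
  have hww : ∀ e, w e = w' e + if IsAt l r b e then 1 else 0 := by
    intro e
    simp only [hw']
    split_ifs with h
    · have := hw1 e h; omega
    · rfl
  have hwz : ∀ z : Finset E, ∑ e ∈ z, w e = ∑ e ∈ z, w' e +
      (z.filter fun e => IsAt l r b e).card := by
    intro z
    rw [Finset.card_filter, ← Finset.sum_add_distrib]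
    exact Finset.sum_congr rfl fun e _ => hww e
  have hσ : ∀ e, signed w' J e =
      signed w J e + if IsAt l r b e then (if e = f then 1 else -1) else 0 := by
    intro e
    simp only [signed, hw']
    by_cases h : IsAt l r b e
    · have h1 := hw1 e h
      by_cases hef : e = f
      · subst hef
        simp only [h, hfJ, if_true]
        omega
      · simp only [h, hgJ e h hef, hef, if_true, if_false]
        omega
    · simp [h]
  have hJf : J.filter (fun e => IsAt l r b e) = {f} := by
    ext g
    simp only [Finset.mem_filter, Finset.mem_singleton]
    constructor
    · rintro ⟨h, h'⟩
      by_contra hgf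
      exact hgJ g h' hgf h
    · rintro rfl
      exact ⟨hfJ, hfb⟩
  have hcard : 3 ≤ (Finset.univ.filter fun e => IsAt l r b e).card := by
    obtain ⟨m, hm⟩ := heven {b}
    have h1 := hbridge {b}
    simp only [Set.mem_singleton_iff] at hm h1
    have h2 : (Finset.univ.filter fun e => IsAt l r b e) =
        (Finset.univ.filter fun e => e ∉ J ∧ ¬ (l e = b ↔ r e = b)) ∪ {f} := by
      ext g
      simp only [Finset.mem_filter, Finset.mem_univ, true_and, Finset.mem_union,
        Finset.mem_singleton]
      constructor
      · intro h
        by_cases hgf : g = f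
        · exact Or.inr hgf
        · exact Or.inl ⟨hgJ g h hgf, h⟩
      · rintro (h | rfl)
        · exact h.2
        · exact hfb
    have h3 : (Finset.univ.filter fun e => IsAt l r b e).card = m + m + 1 := by
      rw [h2, Finset.card_union_of_disjoint (by simp [hfJ]), hm, Finset.card_singleton]
    have h4 : (Finset.univ.filter fun e => IsAt l r b e).card ≠ 1 := by
      convert h1
    omega
  have hJsum := hwz J
  rw [hJf, Finset.card_singleton] at hJsum
  have hsum := hwz Finset.univ
  have := ih (∑ e, w' e + (Finset.univ.filter fun e => l e ≠ r e).card) (by omega) l r w'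
    le_rfl heven hbridge (fun z hz => ?_)
    (fun z hz => ?_)
  · omega
  · have h1 := hpar z hz
    rw [hwz z] at h1
    have h2 := hz b
    rw [fbd_eq_card, ZMod.natCast_eq_zero_iff_even] at h2
    exact (Nat.even_add.1 h1).2 h2
  · simp only [hσ]
    refine hK.nonneg_shift hmin (fun z hz => ?_) hfb hf hpos z hz
    obtain ⟨m, hm⟩ := hpar z hz
    have : ∑ e ∈ z, signed w J e = ∑ e ∈ z, (w e : ℤ) - 2 * ∑ e ∈ z, if e ∈ J then (w e : ℤ) else 0 := by
      rw [Finset.mul_sum, ← Finset.sum_sub_distrib]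
      refine Finset.sum_congr rfl fun e _ => ?_
      unfold signed
      split_ifs <;> ring
    rw [this, ← Nat.cast_sum, hm]
    refine ⟨m - ∑ e ∈ z, if e ∈ J then (w e : ℤ) else 0, ?_⟩
    push_cast
    ring

end TJoinBound

end PlanarFrugal

namespace PlanarFrugal

section MaxCut

variable {E F : Type*}

theorem sum_symmDiff_z2 [DecidableEq E] (g : E → ZMod 2) (A B : Finset E) :
    ∑ e ∈ symmDiff A B, g e = ∑ e ∈ A, g e + ∑ e ∈ B, g e := by
  have h1 : symmDiff A B = (A \ B) ∪ (B \ A) := rfl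
  rw [h1, Finset.sum_union (disjoint_sdiff_sdiff)]
  have hA : ∑ e ∈ A \ B, g e + ∑ e ∈ A ∩ B, g e = ∑ e ∈ A, g e := by
    rw [← Finset.sdiff_inter_self_left]; exact Finset.sum_sdiff Finset.inter_subset_left
  have hB : ∑ e ∈ B \ A, g e + ∑ e ∈ A ∩ B, g e = ∑ e ∈ B, g e := by
    rw [← Finset.sdiff_inter_self_right]; exact Finset.sum_sdiff Finset.inter_subset_right
  linear_combination hA + hB - z2_add_self (∑ e ∈ A ∩ B, g e)

theorem sum_cobd [Fintype F] (l r : E → F) (f : F → ZMod 2) (z : Finset E) :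
    ∑ e ∈ z, cobd l r f e = ∑ v, f v * fbd l r z v := by
  classical
  simp only [fbd, Finset.mul_sum]
  rw [Finset.sum_comm]
  refine Finset.sum_congr rfl fun e _ => ?_
  simp [cobd, pt, mul_add, Finset.sum_add_distrib]

/-- The annihilator of the cycle space is the cut space. -/
theorem exists_eq_cobd [Fintype E] [Fintype F] (l r : E → F) (x : E → ZMod 2)
    (hx : ∀ z : E → ZMod 2, (∀ v, bd l r z v = 0) → ∑ e, x e * z e = 0) :
    ∃ h : F → ZMod 2, ∀ e, x e = h (l e) + h (r e) := by
  classical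
  let ξ : Module.Dual (ZMod 2) (E → ZMod 2) :=
    { toFun := fun z => ∑ e, x e * z e
      map_add' := fun y z => by simp [mul_add, Finset.sum_add_distrib]
      map_smul' := fun c z => by
        simp only [Pi.smul_apply, smul_eq_mul, RingHom.id_apply, Finset.mul_sum]
        exact Finset.sum_congr rfl fun e _ => by ring }
  have hξ : ξ ∈ (LinearMap.ker (bdLin l r)).dualAnnihilator := by
    rw [Submodule.mem_dualAnnihilator]
    intro z hz
    exact hx z fun v => congrFun (LinearMap.mem_ker.1 hz) v
  rw [← LinearMap.range_dualMap_eq_dualAnnihilator_ker] at hξ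
  obtain ⟨φ, hφ⟩ := hξ
  refine ⟨fun v => φ (Pi.single v 1), fun e => ?_⟩
  have h1 : ξ (Pi.single e 1) = x e := by
    change ∑ e', x e' * (Pi.single e 1 : E → ZMod 2) e' = x e
    simp [Pi.single_apply]
  have h2 : bdLin l r (Pi.single e 1) = Pi.single (l e) 1 + Pi.single (r e) 1 := by
    funext v
    change bd l r (Pi.single e 1) v = _
    simp [bd, Pi.single_apply, eq_comm]
  rw [← h1, ← hφ, ← map_add, ← h2]
  rfl

theorem sum_fiber_card {I : Type*} [Fintype I] [DecidableEq E] (m : I → E) (T : Finset E) :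
    ∑ e ∈ T, (Finset.univ.filter fun i => m i = e).card =
      (Finset.univ.filter fun i => m i ∈ T).card := by
  rw [Finset.card_eq_sum_card_fiberwise (f := m) (t := T) (fun i hi => by simpa using hi)]
  refine Finset.sum_congr rfl fun e he => ?_
  congr 1
  ext i
  simp only [Finset.mem_filter, Finset.mem_univ, true_and]
  exact ⟨fun h => ⟨h ▸ he, h⟩, fun h => h.2⟩

open Classical in
/-- A planar multigraph has a cut containing two thirds of its edges. -/
theorem GridMinor.exists_cut {W : Type*} [Fintype W] {H : SimpleGraph W} (hH : GridMinor H)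
    {I : Type*} [Fintype I] (α β : I → W) (hαβ : ∀ i, H.Adj (α i) (β i)) :
    ∃ S : Set W, 2 * Fintype.card I ≤
      3 * (Finset.univ.filter fun i => ¬ (α i ∈ S ↔ β i ∈ S)).card := by
  obtain ⟨s, t, hst⟩ := exists_edge_ends H
  obtain ⟨F, _, l, r, hd⟩ := hH.exists_dual s t hst
  let m : I → H.edgeSet := fun i => ⟨s(α i, β i), hαβ i⟩
  let μ : H.edgeSet → ℕ := fun e => (Finset.univ.filter fun i => m i = e).card
  let w : H.edgeSet → ℕ := fun e => 2 * μ e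
  obtain ⟨J, hJ, hJmin⟩ := Finset.exists_min_image
    (Finset.univ.filter fun J : Finset H.edgeSet => ∀ f, ∑ e ∈ Jᶜ, cobd l r f e = 0)
    (fun J => ∑ e ∈ J, w e) ⟨Finset.univ, by simp⟩
  rw [Finset.mem_filter] at hJ
  have hJ := hJ.2
  have hind : ∀ (A : Set F) e, cobd l r (fun v => if v ∈ A then 1 else 0) e =
      if ¬ (l e ∈ A ↔ r e ∈ A) then 1 else 0 := by
    intro A e
    unfold cobd
    by_cases h1 : l e ∈ A <;> by_cases h2 : r e ∈ A <;> simp [h1, h2, z2_add_self]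
  have key := three_mul_sum_le J _ l r w le_rfl ?_ ?_ ?_ ?_
  · have hx : ∀ z : H.edgeSet → ZMod 2, (∀ v, bd s t z v = 0) →
        ∑ e, (if e ∈ J then 0 else 1) * z e = 0 := by
      intro z hz
      obtain ⟨f, rfl⟩ := (hd z).1 hz
      refine Eq.trans (Finset.sum_subset (Finset.subset_univ Jᶜ) ?_).symm ((?_ : _ = _).trans (hJ f))
      rotate_left
      · refine Finset.sum_congr rfl fun e he => ?_
        rw [if_neg (by simpa using he), one_mul]
      · intro e _ he
        rw [if_pos (by simpa using he), zero_mul]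
    obtain ⟨h, hh⟩ := exists_eq_cobd s t _ hx
    refine ⟨{v | h v = 1}, ?_⟩
    have hcut : ∀ i, (¬ (α i ∈ {v | h v = 1} ↔ β i ∈ {v | h v = 1})) ↔ m i ∉ J := by
      intro i
      have h1 := hh (m i)
      have h2 : h (s (m i)) + h (t (m i)) = h (α i) + h (β i) := by
        rcases Sym2.eq_iff.1 (hst (m i)) with ⟨h3, h4⟩ | ⟨h3, h4⟩
        · rw [h3, h4]
        · rw [h3, h4, add_comm]
      rw [h2] at h1
      clear h2
      simp only [Set.mem_ofPred_eq]
      generalize h (α i) = a at *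
      generalize h (β i) = b at *
      by_cases hm : m i ∈ J
      · simp only [hm, if_true, not_true, iff_false, not_not] at h1 ⊢
        revert h1; revert a b; decide
      · simp only [hm, if_false, not_false_iff, iff_true] at h1 ⊢
        revert h1; revert a b; decide
    have hfil : (Finset.univ.filter fun i => ¬ (α i ∈ {v | h v = 1} ↔ β i ∈ {v | h v = 1})) =
        (Finset.univ.filter fun i => m i ∈ J)ᶜ := by
      ext i
      rw [Finset.mem_filter, hcut, Finset.mem_compl, Finset.mem_filter]
      simp
    have hgoal : 2 * Fintype.card I ≤ 3 * (Finset.univ.filter fun i => m i ∈ J)ᶜ.card := by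
      have h1 : ∑ e ∈ J, w e = 2 * (Finset.univ.filter fun i => m i ∈ J).card := by
        rw [← sum_fiber_card, Finset.mul_sum]
      have h2 : ∑ e, w e = 2 * Fintype.card I := by
        rw [← Finset.mul_sum, sum_fiber_card]
        simp
      rw [h1, h2] at key
      have h3 := Finset.card_compl_add_card (Finset.univ.filter fun i => m i ∈ J)
      omega
    rw [← hfil] at hgoal
    convert hgoal
  · intro A
    have h1 := hJ fun v => if v ∈ A then 1 else 0
    simp only [hind] at h1
    rw [← ZMod.natCast_eq_zero_iff_even, ← h1, ← Finset.filter_filter, Finset.card_filter]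
    push_cast
    refine Finset.sum_congr ?_ fun e _ => rfl
    ext e; simp
  · intro A hA
    obtain ⟨e, he⟩ := Finset.card_eq_one.1 hA
    have hz := (hd _).2 ⟨fun v => if v ∈ A then 1 else 0, rfl⟩
    have hx : ∀ e', cobd l r (fun v => if v ∈ A then 1 else 0) e' = if e' = e then 1 else 0 := by
      intro e'
      rw [hind]
      have : ¬ (l e' ∈ A ↔ r e' ∈ A) ↔ e' = e := by
        rw [← Finset.mem_singleton, ← he]; simp
      simp only [this]
    have h1 := hz (s e)
    have hne : t e ≠ s e := by
      have h2 : (e : Sym2 W) ∈ H.edgeSet := e.2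
      rw [hst e] at h2
      exact (SimpleGraph.Adj.ne h2).symm
    simp [bd, hx, hne] at h1
  · intro z _
    rw [← Finset.mul_sum]
    exact even_two_mul _
  · intro z hz
    have h1 := hJmin (symmDiff J z) (by
      rw [Finset.mem_filter]
      refine ⟨Finset.mem_univ _, fun f => ?_⟩
      have h2 : (symmDiff J z)ᶜ = symmDiff Jᶜ z := by
        ext e; simp only [Finset.mem_compl, Finset.mem_symmDiff]; tauto
      rw [h2, sum_symmDiff_z2, hJ, sum_cobd]
      simp [hz])
    have h2 : ∑ e ∈ symmDiff J z, w e = ∑ e ∈ J \ z, w e + ∑ e ∈ z \ J, w e :=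
      Finset.sum_union disjoint_sdiff_sdiff
    have h3 : ∑ e ∈ J \ z, w e + ∑ e ∈ J ∩ z, w e = ∑ e ∈ J, w e := by
      rw [← Finset.sdiff_inter_self_left]; exact Finset.sum_sdiff Finset.inter_subset_left
    have h4 : ∑ e ∈ z \ J, signed w J e + ∑ e ∈ J ∩ z, signed w J e = ∑ e ∈ z, signed w J e := by
      rw [← Finset.sdiff_inter_self_right]; exact Finset.sum_sdiff Finset.inter_subset_right
    have h5 : ∑ e ∈ z \ J, signed w J e = ((∑ e ∈ z \ J, w e : ℕ) : ℤ) := by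
      push_cast
      exact Finset.sum_congr rfl fun e he => if_neg (Finset.mem_sdiff.1 he).2
    have h6 : ∑ e ∈ J ∩ z, signed w J e = -((∑ e ∈ J ∩ z, w e : ℕ) : ℤ) := by
      push_cast
      rw [← Finset.sum_neg_distrib]
      exact Finset.sum_congr rfl fun e he => if_pos (Finset.mem_inter.1 he).1
    omega

end MaxCut

end PlanarFrugal

namespace PlanarFrugal

section Konig

open Finset

/-- A regular bipartite multigraph has a perfect matching. -/
theorem exists_perfect_matching {E L P : Type*} [DecidableEq E] [Fintype L] [Fintype P]
    [DecidableEq L] [DecidableEq P] (α : E → L) (β : E → P) (X : Finset E) {R : ℕ} (hR : 0 < R)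
    (hα : ∀ u, (X.filter fun e => α e = u).card = R)
    (hβ : ∀ u, (X.filter fun e => β e = u).card = R) :
    ∃ M ⊆ X, (∀ u, (M.filter fun e => α e = u).card = 1) ∧
      ∀ u, (M.filter fun e => β e = u).card = 1 := by
  have hcard : ∀ A : Finset L, (X.filter fun e => α e ∈ A).card = R * A.card := by
    intro A
    rw [card_eq_sum_card_fiberwise (f := α) (t := A) (fun e he => by
      simpa using (mem_filter.1 he).2), sum_const_nat (m := R), mul_comm]
    intro u hu
    rw [← hα u]
    congr 1
    ext e
    simp only [mem_filter]
    exact ⟨fun h => ⟨h.1.1, h.2⟩, fun h => ⟨⟨h.1, h.2 ▸ hu⟩, h.2⟩⟩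
  have hcard' : ∀ A : Finset P, (X.filter fun e => β e ∈ A).card = R * A.card := by
    intro A
    rw [card_eq_sum_card_fiberwise (f := β) (t := A) (fun e he => by
      simpa using (mem_filter.1 he).2), sum_const_nat (m := R), mul_comm]
    intro u hu
    rw [← hβ u]
    congr 1
    ext e
    simp only [mem_filter]
    exact ⟨fun h => ⟨h.1.1, h.2⟩, fun h => ⟨⟨h.1, h.2 ▸ hu⟩, h.2⟩⟩
  have hLP : Fintype.card L = Fintype.card P := by
    have h1 := hcard univ
    have h2 := hcard' univ
    simp only [mem_univ, filter_true] at h1 h2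
    rw [h1] at h2
    exact Nat.eq_of_mul_eq_mul_left hR h2
  have hall : ∀ A : Finset L, A.card ≤
      (A.biUnion fun u => (X.filter fun e => α e = u).image β).card := by
    intro A
    refine Nat.le_of_mul_le_mul_left ?_ hR
    rw [← hcard, ← hcard']
    refine card_le_card fun e he => ?_
    simp only [mem_filter, mem_biUnion, mem_image] at he ⊢
    exact ⟨he.1, α e, he.2, e, ⟨he.1, rfl⟩, rfl⟩
  obtain ⟨f, hf, hfX⟩ := (all_card_le_biUnion_card_iff_exists_injective _).1 hall
  have : ∀ u, ∃ e ∈ X, α e = u ∧ β e = f u := by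
    intro u
    obtain ⟨e, he, h⟩ := mem_image.1 (hfX u)
    exact ⟨e, (mem_filter.1 he).1, (mem_filter.1 he).2, h⟩
  choose m hmX hmα hmβ using this
  have hbij : Function.Bijective f := (Fintype.bijective_iff_injective_and_card f).2 ⟨hf, hLP⟩
  refine ⟨univ.image m, ?_, fun u => ?_, fun u => ?_⟩
  · intro e he
    obtain ⟨u, -, rfl⟩ := mem_image.1 he
    exact hmX u
  · rw [card_eq_one]
    refine ⟨m u, ?_⟩
    ext e
    simp only [mem_filter, mem_image, mem_univ, true_and, mem_singleton]
    constructor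
    · rintro ⟨⟨v, rfl⟩, h⟩
      rw [hmα] at h; rw [h]
    · rintro rfl
      exact ⟨⟨u, rfl⟩, hmα u⟩
  · obtain ⟨v, rfl⟩ := hbij.2 u
    rw [card_eq_one]
    refine ⟨m v, ?_⟩
    ext e
    simp only [mem_filter, mem_image, mem_univ, true_and, mem_singleton]
    constructor
    · rintro ⟨⟨v', rfl⟩, h⟩
      rw [hmβ] at h; rw [hf h]
    · rintro rfl
      exact ⟨⟨v, rfl⟩, hmβ v⟩

theorem exists_edge_colouring_of_regular {E L P : Type*} [DecidableEq E] [Fintype L] [Fintype P]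
    [DecidableEq L] [DecidableEq P] (α : E → L) (β : E → P) (R : ℕ) (X : Finset E)
    (hα : ∀ u, (X.filter fun e => α e = u).card = R)
    (hβ : ∀ u, (X.filter fun e => β e = u).card = R) :
    ∃ φ : E → ℕ, (∀ e ∈ X, φ e < R) ∧
      ∀ e ∈ X, ∀ e' ∈ X, e ≠ e' → (α e = α e' ∨ β e = β e') → φ e ≠ φ e' := by
  induction R generalizing X with
  | zero =>
    have : X = ∅ := by
      refine eq_empty_of_forall_notMem fun e he => ?_
      have := card_eq_zero.1 (hα (α e))
      exact notMem_empty e (this ▸ mem_filter.2 ⟨he, rfl⟩)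
    subst this
    exact ⟨fun _ => 0, by simp, by simp⟩
  | succ R ih =>
    obtain ⟨M, hMX, hMα, hMβ⟩ := exists_perfect_matching α β X R.succ_pos hα hβ
    have hsd : ∀ p : E → Prop, ∀ [DecidablePred p], ((X \ M).filter p).card + (M.filter p).card =
        (X.filter p).card := by
      intro p _
      rw [← card_union_of_disjoint, ← filter_union, sdiff_union_of_subset hMX]
      exact disjoint_filter_filter sdiff_disjoint
    obtain ⟨φ, hφ, hφ'⟩ := ih (X \ M) (fun u => by
        have := hsd fun e => α e = u
        rw [hα, hMα] at this; omega) (fun u => by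
        have := hsd fun e => β e = u
        rw [hβ, hMβ] at this; omega)
    have hM : ∀ e ∈ M, ∀ e' ∈ M, e ≠ e' → ¬ (α e = α e' ∨ β e = β e') := by
      rintro e he e' he' hne (h | h)
      · exact hne (card_le_one.1 (hMα (α e')).le e (by simp [he, h]) e' (by simp [he']))
      · exact hne (card_le_one.1 (hMβ (β e')).le e (by simp [he, h]) e' (by simp [he']))
    refine ⟨fun e => if e ∈ M then R else φ e, fun e he => ?_, fun e he e' he' hne h => ?_⟩
    · by_cases heM : e ∈ M
      · simp [heM]
      · simp only [heM, if_false]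
        have := hφ e (mem_sdiff.2 ⟨he, heM⟩)
        omega
    · by_cases heM : e ∈ M <;> by_cases heM' : e' ∈ M <;> simp only [heM, heM', if_true, if_false]
      · exact absurd h (hM e heM e' heM' hne)
      · have := hφ e' (mem_sdiff.2 ⟨he', heM'⟩)
        omega
      · have := hφ e (mem_sdiff.2 ⟨he, heM⟩)
        omega
      · exact hφ' e (mem_sdiff.2 ⟨he, heM⟩) e' (mem_sdiff.2 ⟨he', heM'⟩) hne h

theorem sum_sigma_fin {U : Type*} [Fintype U] [DecidableEq U] (n : U → ℕ) (u : U) :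
    ∑ p : (Σ u : U, Fin (n u)), (if p.1 = u then 1 else 0) = n u := by
  rw [Fintype.sum_sigma]
  have : ∀ v, ∑ _j : Fin (n v), (if v = u then 1 else 0) = if v = u then n v else 0 := by
    intro v
    split_ifs <;> simp
  exact (sum_congr rfl fun v _ => this v).trans (by simp)

/-- König's edge colouring theorem for bipartite multigraphs. -/
theorem exists_edge_colouring {X U W : Type*} [Fintype X] [Fintype U] [Fintype W] [DecidableEq X]
    [DecidableEq U] [DecidableEq W] (α : X → U) (β : X → W) (R : ℕ)
    (hα : ∀ u, (univ.filter fun e => α e = u).card ≤ R)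
    (hβ : ∀ u, (univ.filter fun e => β e = u).card ≤ R) :
    ∃ φ : X → ℕ, (∀ e, φ e < R) ∧ ∀ e e', e ≠ e' → (α e = α e' ∨ β e = β e') → φ e ≠ φ e' := by
  let dα : U → ℕ := fun u => (univ.filter fun e => α e = u).card
  let dβ : W → ℕ := fun u => (univ.filter fun e => β e = u).card
  let E := (X ⊕ X) ⊕ ((Σ u : U, Fin (R - dα u)) ⊕ (Σ u : W, Fin (R - dβ u)))
  let α' : E → U ⊕ W := Sum.elim (Sum.elim (fun e => Sum.inl (α e)) (fun e => Sum.inr (β e)))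
    (Sum.elim (fun p => Sum.inl p.1) (fun p => Sum.inr p.1))
  let β' : E → W ⊕ U := Sum.elim (Sum.elim (fun e => Sum.inl (β e)) (fun e => Sum.inr (α e)))
    (Sum.elim (fun p => Sum.inr p.1) (fun p => Sum.inl p.1))
  have hdα : ∀ u, ∑ e, (if α e = u then 1 else 0) = dα u := fun u => by simp [dα]
  have hdβ : ∀ u, ∑ e, (if β e = u then 1 else 0) = dβ u := fun u => by simp [dβ]
  have hdα' : ∀ u, dα u ≤ R := hα
  have hdβ' : ∀ u, dβ u ≤ R := hβ
  obtain ⟨φ, hφ, hφ'⟩ := exists_edge_colouring_of_regular α' β' R univ (by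
    rintro (u | u)
    · rw [card_filter, Fintype.sum_sum_type, Fintype.sum_sum_type, Fintype.sum_sum_type]
      simp only [α', Sum.elim_inl, Sum.elim_inr, Sum.inl.injEq, reduceCtorEq, if_false, hdα,
        sum_const_zero, sum_sigma_fin]
      have := hdα' u
      omega
    · rw [card_filter, Fintype.sum_sum_type, Fintype.sum_sum_type, Fintype.sum_sum_type]
      simp only [α', Sum.elim_inl, Sum.elim_inr, Sum.inr.injEq, reduceCtorEq, if_false, hdβ,
        sum_const_zero, sum_sigma_fin]
      have := hdβ' u
      omega) (by
    rintro (u | u)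
    · rw [card_filter, Fintype.sum_sum_type, Fintype.sum_sum_type, Fintype.sum_sum_type]
      simp only [β', Sum.elim_inl, Sum.elim_inr, Sum.inl.injEq, reduceCtorEq, if_false, hdβ,
        sum_const_zero, sum_sigma_fin]
      have := hdβ' u
      omega
    · rw [card_filter, Fintype.sum_sum_type, Fintype.sum_sum_type, Fintype.sum_sum_type]
      simp only [β', Sum.elim_inl, Sum.elim_inr, Sum.inr.injEq, reduceCtorEq, if_false, hdα,
        sum_const_zero, sum_sigma_fin]
      have := hdα' u
      omega)
  refine ⟨fun e => φ (Sum.inl (Sum.inl e)), fun e => hφ _ (mem_univ _), fun e e' hne h => ?_⟩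
  refine hφ' _ (mem_univ _) _ (mem_univ _) (fun h => hne (Sum.inl.inj (Sum.inl.inj h))) ?_
  simpa [α', β'] using h

/-- The elements of each fibre can be numbered consecutively. -/
theorem exists_fiber_index {X U : Type*} [Fintype X] [DecidableEq U] (α : X → U) :
    ∃ ι : X → ℕ, (∀ e, ι e < (univ.filter fun e' => α e' = α e).card) ∧
      ∀ e e', α e = α e' → ι e = ι e' → e = e' := by
  classical
  let eq := Fintype.equivFin X
  refine ⟨fun e => (univ.filter fun e' => α e' = α e ∧ eq e' < eq e).card, fun e => ?_,
    fun e e' h h' => ?_⟩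
  · refine card_lt_card ((ssubset_iff_of_subset fun x hx => ?_).2 ⟨e, by simp, by simp⟩)
    simp only [mem_filter, mem_univ, true_and] at hx ⊢
    exact hx.1
  · by_contra hne
    have key : ∀ a b, α a = α b → eq a < eq b →
        (univ.filter fun e' => α e' = α a ∧ eq e' < eq a).card <
        (univ.filter fun e' => α e' = α b ∧ eq e' < eq b).card := by
      intro a b hab hlt
      refine card_lt_card ((ssubset_iff_of_subset fun x hx => ?_).2 ⟨a, by simp [hab, hlt], by simp⟩)
      simp only [mem_filter, mem_univ, true_and] at hx ⊢
      exact ⟨hx.1.trans hab, hx.2.trans hlt⟩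
    rcases lt_or_gt_of_ne (fun h => hne (eq.injective h)) with hlt | hlt
    · exact absurd h' (key e e' h hlt).ne
    · exact absurd h' (key e' e h.symm hlt).ne'

theorem fiber_bottom_card {X U : Type*} [Fintype X] [DecidableEq U] (α : X → U) (ι : X → ℕ)
    (hlt : ∀ e, ι e < (univ.filter fun e' => α e' = α e).card)
    (hinj : ∀ e e', α e = α e' → ι e = ι e' → e = e') (R : ℕ) (u : U) :
    (univ.filter fun e => α e = u ∧ (univ.filter fun e' => α e' = u).card - R ≤ ι e).card ≤ R := by
  set n := (univ.filter fun e' => α e' = u).card with hn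
  have : (univ.filter fun e => α e = u ∧ n - R ≤ ι e).card ≤ (Finset.Ico (n - R) n).card := by
    refine card_le_card_of_injOn ι (fun e he => ?_) (fun e he e' he' h => ?_)
    · simp only [coe_filter, mem_univ, true_and, Set.mem_ofPred_eq] at he
      have := hlt e
      rw [he.1] at this
      simp only [coe_Ico, Set.mem_Ico]
      exact ⟨he.2, this⟩
    · simp only [coe_filter, mem_univ, true_and, Set.mem_ofPred_eq] at he he'
      exact hinj e e' (he.1.trans he'.1.symm) h
  rw [Nat.card_Ico] at this
  omega

/-- Preference keys for the two ends of each edge of a bipartite multigraph, with small sum. -/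
theorem exists_keys {X U : Type*} [Fintype X] [DecidableEq U] (α β : X → U)
    {R : ℕ} (hR : 0 < R) :
    ∃ κ κ' : X → ℕ, (∀ e e', α e = α e' → κ e = κ e' → e = e') ∧
      (∀ e e', β e = β e' → κ' e = κ' e' → e = e') ∧
      ∀ e, κ e + κ' e + 1 ≤ ((univ.filter fun e' => α e' = α e).card - R) +
        ((univ.filter fun e' => β e' = β e).card - R) + R := by
  classical
  obtain ⟨ι, hι, hι'⟩ := exists_fiber_index α
  obtain ⟨ι₂, hι₂, hι₂'⟩ := exists_fiber_index β
  set a : X → ℕ := fun e => (univ.filter fun e' => α e' = α e).card - R with ha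
  set b : X → ℕ := fun e => (univ.filter fun e' => β e' = β e).card - R with hb
  have hfib : ∀ (α : X → U) (ι : X → ℕ)
      (hlt : ∀ e, ι e < (univ.filter fun e' => α e' = α e).card)
      (hinj : ∀ e e', α e = α e' → ι e = ι e' → e = e') (v : (Set.range α) ⊕ X),
      (univ.filter fun e => (if (univ.filter fun e' => α e' = α e).card - R ≤ ι e then
        (Sum.inl ⟨α e, Set.mem_range_self e⟩ : (Set.range α) ⊕ X) else Sum.inr e) = v).card ≤ R := by
    rintro α ι hlt hinj (⟨u, hu⟩ | x)
    · refine le_trans (card_le_card fun e he => ?_) (fiber_bottom_card α ι hlt hinj R u)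
      simp only [mem_filter, mem_univ, true_and] at he ⊢
      split_ifs at he with h
      simp only [Sum.inl.injEq, Subtype.mk.injEq] at he
      exact ⟨he, he ▸ h⟩
    · refine le_trans (card_le_one.2 fun e he e' he' => ?_) hR
      simp only [mem_filter, mem_univ, true_and] at he he'
      split_ifs at he he'
      simp only [Sum.inr.injEq] at he he'
      rw [he, he']
  obtain ⟨φ, hφ, hφ'⟩ := exists_edge_colouring _ _ R (hfib α ι hι hι') (hfib β ι₂ hι₂ hι₂')
  refine ⟨fun e => if a e ≤ ι e then a e + (R - 1 - φ e) else ι e,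
    fun e => if b e ≤ ι₂ e then b e + φ e else ι₂ e, fun e e' h h' => ?_, fun e e' h h' => ?_,
    fun e => ?_⟩
  · have haa : a e = a e' := by simp only [ha, h]
    by_contra hne
    have h1 := hφ e
    have h2 := hφ e'
    simp only [haa] at h'
    by_cases c1 : a e' ≤ ι e <;> by_cases c2 : a e' ≤ ι e' <;> simp only [c1, c2, if_true, if_false] at h'
    · refine hφ' e e' hne (Or.inl ?_) (by omega)
      rw [if_pos (by change a e ≤ _; omega), if_pos (by change a e' ≤ _; omega)]
      simp [h]
    · omega
    · omega
    · exact hne (hι' e e' h h')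
  · have haa : b e = b e' := by simp only [hb, h]
    by_contra hne
    simp only [haa] at h'
    by_cases c1 : b e' ≤ ι₂ e <;> by_cases c2 : b e' ≤ ι₂ e' <;> simp only [c1, c2, if_true, if_false] at h'
    · refine hφ' e e' hne (Or.inr ?_) (by omega)
      rw [if_pos (by change b e ≤ _; omega), if_pos (by change b e' ≤ _; omega)]
      simp [h]
    · omega
    · omega
    · exact hne (hι₂' e e' h h')
  · have h1 := hφ e
    change _ ≤ a e + b e + R
    dsimp only
    split_ifs <;> omega

end Konig

end PlanarFrugal

namespace PlanarFrugal

section Stable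

open Finset

/-- Preferences of the vertices on one side of a bipartite multigraph: `vert e` is the end of the
edge `e`, which prefers edges with small `key`, and accepts at most one edge of each `block`. -/
structure Side (X U : Type*) where
  vert : X → U
  key : X → ℕ
  block : X → X
  key_inj : ∀ e e', vert e = vert e' → key e = key e' → e = e'
  vert_of_block : ∀ e e', block e = block e' → vert e = vert e'

namespace Side

variable {X U : Type*} [Fintype X] (σ : Side X U)

open Classical in
/-- The elements of `S` preferred to `e` at the end of `e`. -/
noncomputable def better (S : Set X) (e : X) : Finset X :=
  univ.filter fun e' => e' ∈ S ∧ σ.vert e' = σ.vert e ∧ σ.key e' < σ.key e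

open Classical in
/-- The elements of `S` rejected when each vertex `u` may accept at most `r u` elements. -/
def reject (r : U → ℕ) (S : Set X) : Set X :=
  {e ∈ S | (∃ e' ∈ S, σ.block e' = σ.block e ∧ σ.key e' < σ.key e) ∨
    r (σ.vert e) ≤ ((σ.better S e).image σ.block).card}

variable {σ}

theorem mem_better {S : Set X} {e e' : X} :
    e' ∈ σ.better S e ↔ e' ∈ S ∧ σ.vert e' = σ.vert e ∧ σ.key e' < σ.key e := by
  simp [better]

theorem better_mono {S T : Set X} (h : S ⊆ T) (e : X) : σ.better S e ⊆ σ.better T e := by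
  intro e' he'
  rw [mem_better] at he' ⊢
  exact ⟨h he'.1, he'.2⟩

theorem card_better_le (S : Set X) (e : X) : (σ.better S e).card ≤ σ.key e := by
  rw [← card_range (σ.key e)]
  refine card_le_card_of_injOn σ.key (fun e' he' => ?_) (fun a ha b hb h => ?_)
  · have := (mem_better.1 (mem_coe.1 he')).2.2
    simpa using this
  · exact σ.key_inj a b ((mem_better.1 (mem_coe.1 ha)).2.1.trans
      (mem_better.1 (mem_coe.1 hb)).2.1.symm) h

theorem reject_mono (r : U → ℕ) {S T : Set X} (h : S ⊆ T) : σ.reject r S ⊆ σ.reject r T := by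
  classical
  rintro e ⟨heS, he⟩
  refine ⟨h heS, he.imp (fun ⟨e', h1, h2⟩ => ⟨e', h h1, h2⟩) fun h1 => h1.trans ?_⟩
  exact card_le_card (image_subset_image (better_mono h e))

theorem eq_of_block {r : U → ℕ} {S : Set X} {e e' : X} (he : e ∈ S \ σ.reject r S)
    (he' : e' ∈ S \ σ.reject r S) (h : σ.block e = σ.block e') : e = e' := by
  refine σ.key_inj e e' (σ.vert_of_block e e' h) ?_
  by_contra hne
  rcases lt_or_gt_of_ne hne with hlt | hlt
  · exact he'.2 ⟨he'.1, Or.inl ⟨e, he.1, h, hlt⟩⟩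
  · exact he.2 ⟨he.1, Or.inl ⟨e', he'.1, h.symm, hlt⟩⟩

open Classical in
theorem card_accept_le (r : U → ℕ) (S : Set X) (u : U) :
    (univ.filter fun e => e ∈ S \ σ.reject r S ∧ σ.vert e = u).card ≤ r u := by
  set K := univ.filter fun e => e ∈ S \ σ.reject r S ∧ σ.vert e = u with hK
  rcases K.eq_empty_or_nonempty with h | h
  · simp [h]
  obtain ⟨e, he, hmax⟩ := exists_max_image K σ.key h
  have hmem : ∀ x, x ∈ K ↔ x ∈ S \ σ.reject r S ∧ σ.vert x = u := fun x => by simp [hK]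
  have he' := (hmem e).1 he
  have h1 : ¬ r (σ.vert e) ≤ ((σ.better S e).image σ.block).card := fun h1 =>
    he'.1.2 ⟨he'.1.1, Or.inr h1⟩
  rw [he'.2] at h1
  have h2 : (K.erase e).card ≤ ((σ.better S e).image σ.block).card := by
    refine card_le_card_of_injOn σ.block (fun x hx => ?_) (fun x hx y hy hxy => ?_)
    · have hx := mem_erase.1 (mem_coe.1 hx)
      have hx' := (hmem x).1 hx.2
      refine mem_coe.2 (mem_image_of_mem _ (mem_better.2 ⟨hx'.1.1, hx'.2.trans he'.2.symm, ?_⟩))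
      refine lt_of_le_of_ne (hmax x hx.2) fun h => hx.1 ?_
      exact σ.key_inj x e (hx'.2.trans he'.2.symm) h
    · exact eq_of_block ((hmem x).1 (mem_erase.1 (mem_coe.1 hx)).2).1
        ((hmem y).1 (mem_erase.1 (mem_coe.1 hy)).2).1 hxy
  rw [card_erase_of_mem he] at h2
  omega

open Classical in
theorem le_card_better_accept {r : U → ℕ} {S : Set X} {e : X}
    (h : r (σ.vert e) ≤ ((σ.better S e).image σ.block).card) :
    r (σ.vert e) ≤ (σ.better (S \ σ.reject r S) e).card := by
  -- `L` consists of the best elements of their blocks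
  set L : Set X := {x ∈ S | ∀ y ∈ S, σ.block y = σ.block x → σ.key x ≤ σ.key y} with hL
  have hlead : ∀ x, ((σ.better S x).image σ.block).card ≤ (σ.better L x).card := by
    intro x
    refine le_trans (card_le_card fun b hb => ?_) (card_image_le (f := σ.block))
    obtain ⟨y, hy, rfl⟩ := mem_image.1 hb
    rw [mem_better] at hy
    obtain ⟨m, hm, hmin⟩ := exists_min_image
      (univ.filter fun m => m ∈ S ∧ σ.block m = σ.block y) σ.key ⟨y, by simp [hy.1]⟩
    simp only [mem_filter, mem_univ, true_and] at hm hmin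
    refine mem_image.2 ⟨m, mem_better.2 ⟨⟨hm.1, fun z hz hzm => hmin z ⟨hz, hzm.trans hm.2⟩⟩, ?_, ?_⟩,
      hm.2⟩
    · exact (σ.vert_of_block _ _ hm.2).trans hy.2.1
    · exact lt_of_le_of_lt (hmin y ⟨hy.1, rfl⟩) hy.2.2
  by_cases hall : ∀ x ∈ σ.better L e, x ∈ S \ σ.reject r S
  · refine (h.trans (hlead e)).trans (card_le_card fun x hx => ?_)
    exact mem_better.2 ⟨hall x hx, (mem_better.1 hx).2⟩
  push Not at hall
  obtain ⟨m, hm, hmin⟩ := exists_min_image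
    (univ.filter fun m => m ∈ σ.better L e ∧ m ∉ S \ σ.reject r S) σ.key
    (by obtain ⟨x, hx⟩ := hall; exact ⟨x, by simp only [mem_filter, mem_univ, true_and]; exact hx⟩)
  simp only [mem_filter, mem_univ, true_and] at hm hmin
  have hmL := mem_better.1 hm.1
  have hmR : m ∈ σ.reject r S := by
    by_contra hcon
    exact hm.2 ⟨hmL.1.1, hcon⟩
  rcases hmR.2 with ⟨y, hyS, hyb, hyk⟩ | hcap
  · have := hmL.1.2 y hyS hyb
    omega
  · rw [hmL.2.1] at hcap
    refine (hcap.trans (hlead m)).trans (card_le_card fun x hx => ?_)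
    rw [mem_better] at hx
    have hlt : σ.key x < σ.key e := hx.2.2.trans hmL.2.2
    have hve := hx.2.1.trans hmL.2.1
    refine mem_better.2 ⟨?_, hve, hlt⟩
    by_contra hcon
    have := hmin x ⟨mem_better.2 ⟨hx.1, hve, hlt⟩, hcon⟩
    omega

theorem of_mem_reject {r : U → ℕ} {S : Set X} {e : X} (he : e ∈ σ.reject r S) :
    (∃ e' ∈ S \ σ.reject r S, e' ≠ e ∧ σ.block e' = σ.block e) ∨
      r (σ.vert e) ≤ (σ.better (S \ σ.reject r S) e).card := by
  classical
  rcases he.2 with ⟨y, hyS, hyb, hyk⟩ | h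
  swap
  · exact Or.inr (le_card_better_accept h)
  obtain ⟨m, hm, hmin⟩ := exists_min_image
    (univ.filter fun m => m ∈ S ∧ σ.block m = σ.block e) σ.key ⟨y, by simp [hyS, hyb]⟩
  simp only [mem_filter, mem_univ, true_and] at hm hmin
  have hmy := hmin y ⟨hyS, hyb⟩
  by_cases hmR : m ∈ σ.reject r S
  · right
    rcases hmR.2 with ⟨x, hxS, hxb, hxk⟩ | h
    · have := hmin x ⟨hxS, hxb.trans hm.2⟩
      omega
    · have hv := σ.vert_of_block _ _ hm.2
      rw [hv] at h
      refine le_card_better_accept (h.trans (card_le_card (image_subset_image fun x hx => ?_)))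
      rw [mem_better] at hx ⊢
      exact ⟨hx.1, hx.2.1.trans hv, by omega⟩
  · exact Or.inl ⟨m, ⟨hm.1, hmR⟩, fun h => by rw [h] at hmy; omega, hm.2⟩

end Side

variable {X U : Type*} [Fintype X]

/-- What happens to an edge which is not assigned. -/
def Side.Blocked (σ : Side X U) (r : U → ℕ) (K : Set X) (e : X) : Prop :=
  (∃ e' ∈ K, e' ≠ e ∧ σ.block e' = σ.block e) ∨ r (σ.vert e) ≤ (σ.better K e).card

/-- The constraints on a set of edges receiving the same colour. -/
def Side.Admissible (σ : Side X U) (r : U → ℕ) (K : Set X) : Prop :=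
  (∀ e ∈ K, ∀ e' ∈ K, σ.block e = σ.block e' → e = e') ∧
    ∀ u, {e | e ∈ K ∧ σ.vert e = u}.ncard ≤ r u

theorem Side.admissible_accept (σ : Side X U) (r : U → ℕ) (S : Set X) :
    σ.Admissible r (S \ σ.reject r S) := by
  classical
  refine ⟨fun e he e' he' => eq_of_block he he', fun u => ?_⟩
  refine le_trans (le_of_eq ?_) (σ.card_accept_le r S u)
  rw [← Set.ncard_coe_finset]
  congr 1
  ext e
  simp

/-- Stable assignments exist. -/
theorem exists_stable (σ τ : Side X U) (r r' : U → ℕ) (E : Set X) :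
    ∃ K ⊆ E, σ.Admissible r K ∧ τ.Admissible r' K ∧
      ∀ e ∈ E, e ∉ K → σ.Blocked r K e ∨ τ.Blocked r' K e := by
  let f : Set X →o Set X :=
    { toFun := fun S => E \ τ.reject r' (E \ σ.reject r S)
      monotone' := fun S T h => Set.sdiff_subset_sdiff_right
        (Side.reject_mono r' (Set.sdiff_subset_sdiff_right (Side.reject_mono r h))) }
  set S := f.lfp with hSdef
  have hS : E \ τ.reject r' (E \ σ.reject r S) = S := f.map_lfp
  set T := E \ σ.reject r S with hT
  have h1 : S ∩ T = S \ σ.reject r S := by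
    rw [hT, ← Set.inter_sdiff_assoc, Set.inter_eq_left.2]
    rw [← hS]; exact Set.sdiff_subset
  have h2 : S ∩ T = T \ τ.reject r' T := by
    rw [Set.inter_comm]
    nth_rw 1 [← hS]
    rw [← Set.inter_sdiff_assoc, Set.inter_eq_left.2]
    rw [hT]; exact Set.sdiff_subset
  refine ⟨S ∩ T, Set.inter_subset_right.trans Set.sdiff_subset, ?_, ?_, fun e heE heK => ?_⟩
  · rw [h1]; exact σ.admissible_accept r S
  · rw [h2]; exact τ.admissible_accept r' T
  · by_cases heS : e ∈ S
    · have heT : e ∉ T := fun h => heK ⟨heS, h⟩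
      have : e ∈ σ.reject r S := by
        by_contra h
        exact heT ⟨heE, h⟩
      left
      rw [h1]
      exact Side.of_mem_reject this
    · have : e ∈ τ.reject r' T := by
        by_contra h
        rw [← hS] at heS
        exact heS ⟨heE, h⟩
      right
      rw [h2]
      exact Side.of_mem_reject this

theorem exists_stable_family (σ τ : Side X U) {N : ℕ} (r r' : Fin N → U → ℕ)
    (B : X → Finset (Fin N)) (A : Finset (Fin N)) :
    ∃ K : Fin N → Set X, (∀ a, ∀ e ∈ K a, a ∉ B e) ∧
      (∀ a a', a ≠ a' → Disjoint (K a) (K a')) ∧ (∀ a, a ∉ A → K a = ∅) ∧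
      (∀ a, σ.Admissible (r a) (K a)) ∧ (∀ a, τ.Admissible (r' a) (K a)) ∧
      ∀ e, (∀ a, e ∉ K a) → ∀ a ∈ A, a ∉ B e →
        σ.Blocked (r a) (K a) e ∨ τ.Blocked (r' a) (K a) e := by
  classical
  induction A using Finset.induction_on with
  | empty => exact ⟨fun _ => ∅, by simp, by simp, by simp, by simp [Side.Admissible],
      by simp [Side.Admissible], by simp⟩
  | insert a A ha ih =>
    obtain ⟨K, hB, hdis, hemp, had, had', hbl⟩ := ih
    obtain ⟨K₀, hK₀, had₀, had₀', hbl₀⟩ := exists_stable σ τ (r a) (r' a)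
      {e | (∀ a', e ∉ K a') ∧ a ∉ B e}
    have hd₀ : ∀ a', Disjoint K₀ (K a') := fun a' =>
      Set.disjoint_left.2 fun e he => (hK₀ he).1 a'
    refine ⟨Function.update K a K₀, fun a' e he => ?_, fun a₁ a₂ hne => ?_, fun a' ha' => ?_,
      fun a' => ?_, fun a' => ?_, fun e he a' ha' hBe => ?_⟩
    · by_cases h : a' = a
      · subst h
        rw [Function.update_self] at he
        exact (hK₀ he).2
      · rw [Function.update_of_ne h] at he
        exact hB a' e he
    · by_cases h₁ : a₁ = a
      · subst h₁
        rw [Function.update_self, Function.update_of_ne hne.symm]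
        exact hd₀ a₂
      · rw [Function.update_of_ne h₁]
        by_cases h₂ : a₂ = a
        · subst h₂
          rw [Function.update_self]
          exact (hd₀ a₁).symm
        · rw [Function.update_of_ne h₂]
          exact hdis a₁ a₂ hne
    · rw [mem_insert, not_or] at ha'
      rw [Function.update_of_ne ha'.1]
      exact hemp a' ha'.2
    · by_cases h : a' = a
      · subst h
        rwa [Function.update_self]
      · rw [Function.update_of_ne h]
        exact had a'
    · by_cases h : a' = a
      · subst h
        rwa [Function.update_self]
      · rw [Function.update_of_ne h]
        exact had' a'
    · have heK : ∀ a', e ∉ K a' := by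
        intro a'
        by_cases h : a' = a
        · subst h; rw [hemp a' ha]; simp
        · have := he a'
          rwa [Function.update_of_ne h] at this
      by_cases h : a' = a
      · subst h
        have := he a'
        rw [Function.update_self] at this ⊢
        exact hbl₀ e ⟨heK, hBe⟩ this
      · rw [Function.update_of_ne h]
        exact hbl e heK a' (mem_of_mem_insert_of_ne ha' h) hBe

open Classical in
/-- The number of other elements in the block of `e`. -/
noncomputable def Side.mates (σ : Side X U) (e : X) : ℕ :=
  (univ.filter fun e' => e' ≠ e ∧ σ.block e' = σ.block e).card

open Classical in
theorem Side.sum_blocked_le (σ : Side X U) {N k : ℕ} (r m : Fin N → U → ℕ)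
    (hr : ∀ a u, k ≤ r a u + m a u) (K : Fin N → Set X)
    (hdis : ∀ a a', a ≠ a' → Disjoint (K a) (K a')) (e : X) :
    k * (univ.filter fun a => σ.Blocked (r a) (K a) e).card ≤
      k * σ.mates e + (∑ a, m a (σ.vert e) + σ.key e) := by
  have h1 : ∑ a, (σ.better (K a) e).card ≤ σ.key e := by
    rw [← card_biUnion]
    · refine (card_le_card fun x hx => ?_).trans (card_better_le Set.univ e)
      obtain ⟨a, -, hx⟩ := mem_biUnion.1 hx
      exact better_mono (Set.subset_univ _) e hx
    · intro a _ a' _ hne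
      refine disjoint_left.2 fun x hx hx' => ?_
      exact Set.disjoint_left.1 (hdis a a' hne) (mem_better.1 hx).1 (mem_better.1 hx').1
  have h2 : ∑ a, (univ.filter fun e' => e' ∈ K a ∧ e' ≠ e ∧ σ.block e' = σ.block e).card ≤
      σ.mates e := by
    rw [← card_biUnion]
    · refine card_le_card fun x hx => ?_
      obtain ⟨a, -, hx⟩ := mem_biUnion.1 hx
      simp only [mem_filter, mem_univ, true_and] at hx ⊢
      exact hx.2
    · intro a _ a' _ hne
      refine disjoint_left.2 fun x hx hx' => ?_
      simp only [mem_filter, mem_univ, true_and] at hx hx'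
      exact Set.disjoint_left.1 (hdis a a' hne) hx.1 hx'.1
  have h3 : ∀ a, k * (if σ.Blocked (r a) (K a) e then 1 else 0) ≤
      k * (univ.filter fun e' => e' ∈ K a ∧ e' ≠ e ∧ σ.block e' = σ.block e).card +
        (m a (σ.vert e) + (σ.better (K a) e).card) := by
    intro a
    split_ifs with h
    · rcases h with ⟨e', h1, h2, h3⟩ | h
      · have : 0 < (univ.filter fun e' => e' ∈ K a ∧ e' ≠ e ∧ σ.block e' = σ.block e).card :=
          card_pos.2 ⟨e', by simp [h1, h2, h3]⟩
        have := Nat.mul_le_mul_left k this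
        simp only [Nat.succ_eq_add_one, zero_add] at this
        omega
      · have := hr a (σ.vert e)
        omega
    · simp
  have h4 := sum_le_sum fun a (_ : a ∈ univ) => h3 a
  rw [sum_add_distrib, sum_add_distrib, ← mul_sum, ← mul_sum, ← card_filter] at h4
  have := Nat.mul_le_mul_left k h2
  omega

/-- Colouring the edges of a bipartite multigraph so that no colour appears too often at a vertex,
with forbidden colours and blocks of edges requiring distinct colours. -/
theorem exists_assignment (σ τ : Side X U) {N k : ℕ} (r r' m m' : Fin N → U → ℕ)
    (hr : ∀ a u, k ≤ r a u + m a u) (hr' : ∀ a u, k ≤ r' a u + m' a u)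
    (B : X → Finset (Fin N))
    (hlt : ∀ e, k * (B e).card + k * (σ.mates e + τ.mates e) + (∑ a, m a (σ.vert e) + σ.key e) +
      (∑ a, m' a (τ.vert e) + τ.key e) < N * k) :
    ∃ c : X → Fin N, (∀ e, c e ∉ B e) ∧
      (∀ e e', e ≠ e' → (σ.block e = σ.block e' ∨ τ.block e = τ.block e') → c e ≠ c e') ∧
      (∀ a u, {e | c e = a ∧ σ.vert e = u}.ncard ≤ r a u) ∧
      ∀ a u, {e | c e = a ∧ τ.vert e = u}.ncard ≤ r' a u := by
  classical
  obtain ⟨K, hB, hdis, -, had, had', hbl⟩ := exists_stable_family σ τ r r' B univ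
  have hcov : ∀ e, ∃ a, e ∈ K a := by
    intro e
    by_contra hcon
    push Not at hcon
    have h0 := hbl e hcon
    have h1 : (univ : Finset (Fin N)) ⊆ B e ∪ ((univ.filter fun a => σ.Blocked (r a) (K a) e) ∪
        (univ.filter fun a => τ.Blocked (r' a) (K a) e)) := by
      intro a _
      simp only [mem_union, mem_filter, mem_univ, true_and]
      by_cases h : a ∈ B e
      · exact Or.inl h
      · exact Or.inr (h0 a (mem_univ a) h)
    have h2 := (card_le_card h1).trans ((card_union_le _ _).trans
      (Nat.add_le_add_left (card_union_le _ _) _))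
    rw [card_univ, Fintype.card_fin] at h2
    have h3 := σ.sum_blocked_le r m hr K hdis e
    have h4 := τ.sum_blocked_le r' m' hr' K hdis e
    have h5 := hlt e
    have h6 := Nat.mul_le_mul_left k h2
    rw [mul_add, mul_add] at h6
    rw [mul_add, mul_comm N k] at h5
    omega
  choose c hc using hcov
  have hcK : ∀ a e, c e = a ↔ e ∈ K a := by
    intro a e
    refine ⟨fun h => h ▸ hc e, fun h => ?_⟩
    by_contra hne
    exact Set.disjoint_left.1 (hdis _ _ hne) (hc e) h
  refine ⟨c, fun e => hB _ e (hc e), fun e e' hne h hcc => ?_, fun a u => ?_, fun a u => ?_⟩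
  · have h1 := hc e
    rw [hcc] at h1
    rcases h with h | h
    · exact hne ((had _).1 e h1 e' (hc e') h)
    · exact hne ((had' _).1 e h1 e' (hc e') h)
  · simp only [hcK]; exact (had a).2 u
  · simp only [hcK]; exact (had' a).2 u

end Stable

end PlanarFrugal

namespace PlanarFrugal

open Relation Finset

open scoped Classical

section Minors

variable {W : Type*} [Fintype W] {H : SimpleGraph W}

theorem isModel_of_star {K : Type*} {s : K → K → Prop} {f : W → Option K} (x : K → W)
    (hx : ∀ i, f (x i) = some i) (hstar : ∀ i y, f y = some i → y = x i ∨ H.Adj (x i) y)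
    (hadj : ∀ i j, s i j → ∃ a b, H.Adj a b ∧ f a = some i ∧ f b = some j) :
    IsModel H.Adj s f := by
  refine ⟨fun i => ⟨x i, hx i⟩, fun i a b ha hb => ?_, hadj⟩
  have hto : ∀ y, f y = some i →
      ReflTransGen (fun p q => H.Adj p q ∧ f p = some i ∧ f q = some i) (x i) y := by
    intro y hy
    rcases hstar i y hy with rfl | h
    · exact .refl
    · exact .single ⟨h, hx i, hy⟩
  exact (reflTransGen_symm (fun p q h => ⟨h.1.symm, h.2.2, h.2.1⟩) (hto a ha)).trans (hto b hb)

/-- Contracting disjoint stars: the sum of the degrees in the resulting graph. -/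
theorem GridMinor.sum_card_lt_of_stars (hH : GridMinor H) {K : Type*} [Fintype K] [Nonempty K]
    {f : W → Option K} (x : K → W) (hx : ∀ i, f (x i) = some i)
    (hstar : ∀ i y, f y = some i → y = x i ∨ H.Adj (x i) y) (T : K → Finset K)
    (hT : ∀ i, ∀ j ∈ T i, j ≠ i ∧ ∃ a b, H.Adj a b ∧ f a = some i ∧ f b = some j) :
    ∑ i, #(T i) < 6 * Fintype.card K := by
  let Q : SimpleGraph K := SimpleGraph.fromRel fun i j => j ∈ T i
  have hQ : GridMinor Q := by
    refine hH.of_model (isModel_of_star x hx hstar fun i j hij => ?_)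
    rw [SimpleGraph.fromRel_adj] at hij
    rcases hij.2 with h | h
    · exact (hT _ _ h).2
    · obtain ⟨a, b, h1, h2, h3⟩ := (hT _ _ h).2
      exact ⟨b, a, h1.symm, h3, h2⟩
  have h1 : ∑ i, #(T i) ≤ ∑ i, Q.degree i := by
    refine sum_le_sum fun i _ => card_le_card fun j hj => ?_
    rw [SimpleGraph.mem_neighborFinset, SimpleGraph.fromRel_adj]
    exact ⟨(hT i j hj).1.symm, Or.inl hj⟩
  rw [Q.sum_degrees_eq_twice_card_edges] at h1
  rcases hQ.card_edges_le with h | h <;> omega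

/-- Contracting disjoint stars to a bipartite graph: the number of edges. -/
theorem GridMinor.sum_card_le_of_bipartite_stars (hH : GridMinor H) {A B : Type*} [Fintype A]
    [Fintype B] {f : W → Option (A ⊕ B)} (x : A ⊕ B → W) (hx : ∀ i, f (x i) = some i)
    (hstar : ∀ i y, f y = some i → y = x i ∨ H.Adj (x i) y) (T : A → Finset B)
    (hT : ∀ i, ∀ j ∈ T i, ∃ a b, H.Adj a b ∧ f a = some (Sum.inl i) ∧ f b = some (Sum.inr j)) :
    ∑ i, #(T i) ≤ 2 * (Fintype.card A + Fintype.card B) := by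
  rcases isEmpty_or_nonempty (A ⊕ B) with hK | hK
  · have : IsEmpty A := ⟨fun a => hK.false (Sum.inl a)⟩
    simp
  let R : A ⊕ B → A ⊕ B → Prop := fun p q => ∃ i j, p = Sum.inl i ∧ q = Sum.inr j ∧ j ∈ T i
  let Q : SimpleGraph (A ⊕ B) := SimpleGraph.fromRel R
  have hQ : GridMinor Q := by
    refine hH.of_model (isModel_of_star x hx hstar fun p q hij => ?_)
    rw [SimpleGraph.fromRel_adj] at hij
    rcases hij.2 with ⟨i, j, rfl, rfl, h⟩ | ⟨i, j, rfl, rfl, h⟩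
    · exact hT _ _ h
    · obtain ⟨a, b, h1, h2, h3⟩ := hT _ _ h
      exact ⟨b, a, h1.symm, h3, h2⟩
  have h1 : ∑ i, #(T i) ≤ #Q.edgeFinset := by
    rw [← Finset.card_sigma]
    refine Finset.card_le_card_of_injOn (fun p => s(Sum.inl p.1, Sum.inr p.2)) ?_ ?_
    · rintro ⟨i, j⟩ hij
      simp only [coe_sigma, Set.mem_sigma_iff, mem_coe] at hij
      simp only [SimpleGraph.coe_edgeFinset, SimpleGraph.mem_edgeSet]
      exact (SimpleGraph.fromRel_adj _ _ _).2 ⟨by simp, Or.inl ⟨i, j, rfl, rfl, hij.2⟩⟩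
    · rintro ⟨i, j⟩ - ⟨i', j'⟩ - h
      simp only [Sym2.eq_iff] at h
      rcases h with ⟨h, h'⟩ | ⟨h, -⟩
      · rw [Sum.inl.inj h, Sum.inr.inj h']
      · cases h
  have h2 := hQ.card_edges_le_of_bipartite (fun p => p.isLeft) (by
    intro p q hij
    rw [SimpleGraph.fromRel_adj] at hij
    rcases hij.2 with ⟨i, j, rfl, rfl, h⟩ | ⟨i, j, rfl, rfl, h⟩ <;> simp)
  rw [Fintype.card_sum] at h2
  rcases h2 with h | h <;> omega

/-- The neighbours of a vertex. -/
noncomputable def nbr (H : SimpleGraph W) (v : W) : Finset W := {u | H.Adj v u}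

@[simp] theorem mem_nbr {u v : W} : u ∈ nbr H v ↔ H.Adj v u := by simp [nbr]

theorem GridMinor.sum_nbr_inter_lt (hH : GridMinor H) {S : Finset W} (hS : S.Nonempty) :
    ∑ v ∈ S, #(nbr H v ∩ S) < 6 * #S := by
  have : Nonempty S := hS.coe_sort
  have := hH.sum_card_lt_of_stars (K := S)
    (f := fun w => if h : w ∈ S then some ⟨w, h⟩ else none) (fun i => i.1)
    (fun i => by simp) (fun i y hy => by
      left
      split_ifs at hy with h
      exact congrArg Subtype.val (Option.some.inj hy))
    (fun i => {j | H.Adj i.1 j.1}) (fun i j hj => by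
      simp only [mem_filter, mem_univ, true_and] at hj
      exact ⟨fun h => hj.ne (congrArg Subtype.val h.symm), i.1, j.1, hj, by simp⟩)
  rw [Fintype.card_coe] at this
  refine lt_of_le_of_lt (le_of_eq ?_) this
  rw [← Finset.sum_coe_sort S]
  refine sum_congr rfl fun i _ => ?_
  refine (Finset.card_bij (fun (j : S) _ => j.1) ?_ ?_ ?_).symm
  · intro j hj; simpa using hj
  · intro j _ j' _ h; exact Subtype.ext h
  · intro j hj; simp only [mem_inter, mem_nbr] at hj; exact ⟨⟨j, hj.2⟩, by simpa using hj.1, rfl⟩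

theorem GridMinor.sum_nbr_inter_le_of_disjoint (hH : GridMinor H) {S T : Finset W}
    (hST : Disjoint S T) : ∑ v ∈ S, #(nbr H v ∩ T) ≤ 2 * (#S + #T) := by
  have hn : ∀ w, w ∈ T → w ∉ S := fun w h1 h2 => Finset.disjoint_left.1 hST h2 h1
  have := hH.sum_card_le_of_bipartite_stars (A := S) (B := T)
    (f := fun w => if h : w ∈ S then some (Sum.inl ⟨w, h⟩) else
      if h : w ∈ T then some (Sum.inr ⟨w, h⟩) else none) (Sum.elim (fun i => i.1) (fun i => i.1))
    (by rintro (i | i) <;> simp [hn]) (by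
      rintro i y hy
      left
      split_ifs at hy with h h'
      · rw [← Option.some.inj hy]; rfl
      · rw [← Option.some.inj hy]; rfl)
    (fun i => {j | H.Adj i.1 j.1}) (fun i j hj => by
      simp only [mem_filter, mem_univ, true_and] at hj
      exact ⟨i.1, j.1, hj, by simp, by simp [hn]⟩)
  rw [Fintype.card_coe, Fintype.card_coe] at this
  refine le_trans (le_of_eq ?_) this
  rw [← Finset.sum_coe_sort S]
  refine sum_congr rfl fun i _ => ?_
  refine (Finset.card_bij (fun (j : T) _ => j.1) ?_ ?_ ?_).symm
  · intro j hj; simpa using hj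
  · intro j _ j' _ h; exact Subtype.ext h
  · intro j hj; simp only [mem_inter, mem_nbr] at hj; exact ⟨⟨j, hj.2⟩, by simpa using hj.1, rfl⟩

end Minors

end PlanarFrugal

namespace PlanarFrugal

open Finset

open scoped Classical

universe u

section Colouring

variable {W : Type u} [Fintype W] {H : SimpleGraph W} {N k Δ : ℕ}

/-- A colouring of the vertices in `D` which is proper and has no colour more than `k` times in
a neighbourhood. -/
structure IsPartial (H : SimpleGraph W) (k : ℕ) (D : Finset W) (c : W → Fin N) : Prop where
  proper : ∀ u ∈ D, ∀ v ∈ D, H.Adj u v → c u ≠ c v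
  frugal : ∀ v a, #{u ∈ nbr H v ∩ D | c u = a} ≤ k

theorem IsPartial.mono {D D' : Finset W} {c : W → Fin N} (hc : IsPartial H k D c) (h : D' ⊆ D) :
    IsPartial H k D' c :=
  ⟨fun u hu v hv => hc.proper u (h hu) v (h hv), fun v a => (card_le_card
    (filter_subset_filter _ (inter_subset_inter_left h))).trans (hc.frugal v a)⟩

/-- The colours used at least `m` times in a set: `m` times their number is at most the size. -/
theorem mul_card_frequent_le (S : Finset W) (c : W → Fin N) (m : ℕ) :
    m * #{a : Fin N | m ≤ #{u ∈ S | c u = a}} ≤ #S := by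
  calc m * #{a : Fin N | m ≤ #{u ∈ S | c u = a}}
      = ∑ a : Fin N with m ≤ #{u ∈ S | c u = a}, m := by rw [sum_const, smul_eq_mul, mul_comm]
    _ ≤ ∑ a : Fin N with m ≤ #{u ∈ S | c u = a}, #{u ∈ S | c u = a} :=
        sum_le_sum fun a ha => (mem_filter.1 ha).2
    _ ≤ ∑ a : Fin N, #{u ∈ S | c u = a} :=
        sum_le_sum_of_subset (filter_subset _ _)
    _ = #S := (card_eq_sum_card_fiberwise (fun _ _ => mem_univ _)).symm

theorem IsPartial.exists_insert {D : Finset W} {c : W → Fin N} (hc : IsPartial H k D c) {w : W}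
    (hw : w ∉ D)
    (hlt : k * #(nbr H w ∩ D) + ∑ u ∈ nbr H w, #(nbr H u ∩ D) < N * k) :
    ∃ c' : W → Fin N, IsPartial H k (insert w D) c' := by
  let F : Finset (Fin N) := (nbr H w ∩ D).image c ∪
    (nbr H w).biUnion fun u => {a : Fin N | k ≤ #{v ∈ nbr H u ∩ D | c v = a}}
  have hF : #F * k < N * k := by
    refine lt_of_le_of_lt ?_ hlt
    have h1 : #F ≤ #(nbr H w ∩ D) +
        ∑ u ∈ nbr H w, #{a : Fin N | k ≤ #{v ∈ nbr H u ∩ D | c v = a}} :=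
      (card_union_le _ _).trans (add_le_add card_image_le card_biUnion_le)
    calc #F * k ≤ _ := Nat.mul_le_mul_right k h1
      _ = k * #(nbr H w ∩ D) +
        ∑ u ∈ nbr H w, k * #{a : Fin N | k ≤ #{v ∈ nbr H u ∩ D | c v = a}} := by
          rw [mul_comm, mul_add, mul_sum]
      _ ≤ _ := Nat.add_le_add_left (sum_le_sum fun u _ => mul_card_frequent_le _ _ _) _
  have hF' : #F < N := lt_of_mul_lt_mul_right hF (Nat.zero_le _)
  obtain ⟨a, ha⟩ : ∃ a, a ∉ F := by
    by_contra! h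
    rw [eq_univ_of_forall h, card_univ, Fintype.card_fin] at hF'
    exact hF'.false
  simp only [F, mem_union, mem_image, mem_biUnion, not_or, not_exists, not_and, mem_filter,
    mem_univ, true_and, not_le, mem_inter, mem_nbr] at ha
  obtain ⟨ha1, ha2⟩ := ha
  have hu : ∀ u ∈ D, Function.update c w a u = c u := fun u hu =>
    Function.update_of_ne (fun h : u = w => hw (h ▸ hu)) _ _
  refine ⟨Function.update c w a, ⟨fun u hu' v hv' huv => ?_, fun v b => ?_⟩⟩
  · rcases mem_insert.1 hu' with h1 | h1
    · rcases mem_insert.1 hv' with h2 | h2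
      · exact (huv.ne (h1.trans h2.symm)).elim
      · rw [hu v h2, h1, Function.update_self]
        exact fun h => ha1 v ⟨h1 ▸ huv, h2⟩ h.symm
    · rcases mem_insert.1 hv' with h2 | h2
      · rw [hu u h1, h2, Function.update_self]
        exact fun h => ha1 u ⟨h2 ▸ huv.symm, h1⟩ h
      · rw [hu u h1, hu v h2]
        exact hc.proper u h1 v h2 huv
  · have hsub : ∀ x ∈ ({x ∈ nbr H v ∩ insert w D | Function.update c w a x = b} : Finset W),
        x ≠ w → x ∈ ({x ∈ nbr H v ∩ D | c x = b} : Finset W) := by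
      intro x hx hxw
      simp only [mem_filter, mem_inter, mem_insert, mem_nbr] at hx ⊢
      have hxD : x ∈ D := hx.1.2.resolve_left hxw
      exact ⟨⟨hx.1.1, hxD⟩, hu x hxD ▸ hx.2⟩
    by_cases hvw : H.Adj w v ∧ a = b
    · obtain ⟨hvw, rfl⟩ := hvw
      have := ha2 v hvw
      refine le_trans (card_le_card fun x hx => ?_) ((card_insert_le w _).trans this)
      by_cases hxw : x = w
      · rw [hxw]; exact mem_insert_self _ _
      · exact mem_insert_of_mem (hsub x hx hxw)
    · refine le_trans (card_le_card fun x hx => hsub x hx ?_) (hc.frugal v b)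
      rintro rfl
      simp only [mem_filter, mem_inter, mem_nbr, Function.update_self] at hx
      exact hvw ⟨hx.1.1.symm, hx.2⟩

/-- All smaller graphs of the given maximum degree are colourable. -/
def ColourableBelow (n Δ N k : ℕ) : Prop :=
  ∀ (W : Type u) [Fintype W] (H : SimpleGraph W), Fintype.card W < n → GridMinor H →
    (∀ v, #(nbr H v) ≤ Δ) → ∃ c : W → Fin N, IsPartial H k univ c

/-- Contraction of the vertex `w` into `x`. -/
def contract (H : SimpleGraph W) (w x : W) : SimpleGraph {y // y ≠ w} :=
  SimpleGraph.fromRel fun y z => H.Adj y.1 z.1 ∨ (y.1 = x ∧ H.Adj w z.1)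

theorem GridMinor.contract (hH : GridMinor H) {w x : W} (hwx : H.Adj w x) :
    GridMinor (contract H w x) := by
  have hx : x ≠ w := hwx.ne'
  refine hH.of_model (f := fun y => if h : y ≠ w then some ⟨y, h⟩ else some ⟨x, hx⟩)
    (isModel_of_star (fun i => i.1) (fun i => by simp [i.2]) ?_ ?_)
  · intro i y hy
    split_ifs at hy with h
    · left; rw [← Option.some.inj hy]
    · right
      rw [← Option.some.inj hy, not_not.1 h]
      exact hwx.symm
  · have key : ∀ i j : {y // y ≠ w}, (H.Adj i.1 j.1 ∨ (i.1 = x ∧ H.Adj w j.1)) →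
        ∃ a b, H.Adj a b ∧ (if h : a ≠ w then some (⟨a, h⟩ : {y // y ≠ w}) else some ⟨x, hx⟩) =
          some i ∧ (if h : b ≠ w then some (⟨b, h⟩ : {y // y ≠ w}) else some ⟨x, hx⟩) =
          some j := by
      rintro i j (h | ⟨h1, h2⟩)
      · exact ⟨i.1, j.1, h, by simp [i.2], by simp [j.2]⟩
      · exact ⟨w, j.1, h2, by simp [← h1], by simp [j.2]⟩
    intro i j hij
    rcases ((SimpleGraph.fromRel_adj _ _ _).1 hij).2 with h | h
    · exact key i j h
    · obtain ⟨a, b, h1, h2, h3⟩ := key j i h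
      exact ⟨b, a, h1.symm, h3, h2⟩

theorem exists_isPartial_of_contract (hH : GridMinor H) (hdeg : ∀ v, #(nbr H v) ≤ Δ) (hk : 1 ≤ k)
    (ih : ColourableBelow.{u} (Fintype.card W) Δ N k) {w x : W} (hwx : H.Adj w x)
    (hd : #(nbr H w) + #(nbr H x) ≤ Δ + 2) :
    ∃ c : W → Fin N, IsPartial H k (univ.erase w) c := by
  have hx : x ≠ w := hwx.ne'
  obtain ⟨c, hc⟩ := ih {y // y ≠ w} (contract H w x)
    (Fintype.card_subtype_lt (x := w) (by simp)) (hH.contract hwx) (by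
      intro v
      let g : {y // y ≠ w} → W := Subtype.val
      have hg : Function.Injective g := Subtype.val_injective
      rw [← card_image_of_injective _ hg]
      by_cases hv : v.1 = x
      · have : (nbr (contract H w x) v).image g ⊆ (nbr H w).erase x ∪ (nbr H x).erase w := by
          intro z hz
          obtain ⟨y, hy, rfl⟩ := mem_image.1 hz
          obtain ⟨h1, h2⟩ := (SimpleGraph.fromRel_adj _ _ _).1 (mem_nbr.1 hy)
          have h3 : y.1 ≠ x := fun h => h1 (Subtype.ext (hv.trans h.symm))
          simp only [mem_union, mem_erase, mem_nbr]
          rcases h2 with (h | h) | (h | h)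
          · exact Or.inr ⟨y.2, hv ▸ h⟩
          · exact Or.inl ⟨h3, h.2⟩
          · exact Or.inr ⟨y.2, hv ▸ h.symm⟩
          · exact (h3 h.1).elim
        refine (card_le_card this).trans ((card_union_le _ _).trans ?_)
        rw [card_erase_of_mem (mem_nbr.2 hwx), card_erase_of_mem (mem_nbr.2 hwx.symm)]
        have h1 : 0 < #(nbr H w) := card_pos.2 ⟨x, mem_nbr.2 hwx⟩
        have h2 : 0 < #(nbr H x) := card_pos.2 ⟨w, mem_nbr.2 hwx.symm⟩
        omega
      · by_cases hvw : H.Adj w v.1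
        · have : (nbr (contract H w x) v).image g ⊆ insert x ((nbr H v.1).erase w) := by
            intro z hz
            obtain ⟨y, hy, rfl⟩ := mem_image.1 hz
            obtain ⟨h1, h2⟩ := (SimpleGraph.fromRel_adj _ _ _).1 (mem_nbr.1 hy)
            simp only [mem_insert, mem_erase, mem_nbr]
            rcases h2 with (h | h) | (h | h)
            · exact Or.inr ⟨y.2, h⟩
            · exact (hv h.1).elim
            · exact Or.inr ⟨y.2, h.symm⟩
            · exact Or.inl h.1
          refine (card_le_card this).trans ((card_insert_le _ _).trans ?_)
          rw [card_erase_of_mem (mem_nbr.2 hvw.symm)]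
          have h1 : 0 < #(nbr H v.1) := card_pos.2 ⟨w, mem_nbr.2 hvw.symm⟩
          have := hdeg v.1
          omega
        · have : (nbr (contract H w x) v).image g ⊆ nbr H v.1 := by
            intro z hz
            obtain ⟨y, hy, rfl⟩ := mem_image.1 hz
            obtain ⟨h1, h2⟩ := (SimpleGraph.fromRel_adj _ _ _).1 (mem_nbr.1 hy)
            simp only [mem_nbr]
            rcases h2 with (h | h) | (h | h)
            · exact h
            · exact (hv h.1).elim
            · exact h.symm
            · exact (hvw h.2).elim
          exact (card_le_card this).trans (hdeg _))
  let c' : W → Fin N := fun y => if h : y ≠ w then c ⟨y, h⟩ else c ⟨x, hx⟩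
  have hc' : ∀ y (h : y ≠ w), c' y = c ⟨y, h⟩ := fun y h => by simp [c', h]
  have proper : ∀ u (hu : u ≠ w) v (hv : v ≠ w), (contract H w x).Adj ⟨u, hu⟩ ⟨v, hv⟩ →
      c' u ≠ c' v := by
    intro u hu v hv h
    rw [hc' u hu, hc' v hv]
    exact hc.proper _ (mem_univ _) _ (mem_univ _) h
  have adj : ∀ u (hu : u ≠ w) v (hv : v ≠ w), H.Adj u v →
      (contract H w x).Adj ⟨u, hu⟩ ⟨v, hv⟩ := fun u hu v hv h =>
    (SimpleGraph.fromRel_adj _ _ _).2 ⟨fun h' => h.ne (congrArg Subtype.val h'), Or.inl (Or.inl h)⟩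
  have adjx : ∀ v (hv : v ≠ w), H.Adj w v → v ≠ x → (contract H w x).Adj ⟨x, hx⟩ ⟨v, hv⟩ :=
    fun v hv h hvx => (SimpleGraph.fromRel_adj _ _ _).2
      ⟨fun h' => hvx (congrArg Subtype.val h').symm, Or.inl (Or.inr ⟨rfl, h⟩)⟩
  have frugal : ∀ (v : {y // y ≠ w}) a (S : Finset W),
      (∀ u ∈ S, ∃ hu : u ≠ w, (contract H w x).Adj v ⟨u, hu⟩ ∧ c' u = a) → #S ≤ k := by
    intro v a S hS
    refine le_trans ?_ (hc.frugal v a)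
    refine card_le_card_of_surjOn Subtype.val ?_
    intro u hu
    obtain ⟨h1, h2, h3⟩ := hS u hu
    refine ⟨⟨u, h1⟩, ?_, rfl⟩
    rw [hc' u h1] at h3
    simpa using ⟨h2, h3⟩
  refine ⟨c', ⟨fun u hu v hv huv => ?_, fun v a => ?_⟩⟩
  · exact proper u (ne_of_mem_erase hu) v (ne_of_mem_erase hv) (adj _ _ _ _ huv)
  · by_cases hvw : v = w
    · subst hvw
      by_cases hax : c' x = a
      · refine le_trans (card_le_one.2 ?_) hk
        have : ∀ z ∈ ({z ∈ nbr H v ∩ univ.erase v | c' z = a} : Finset W), z = x := by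
          intro z hz
          simp only [mem_filter, mem_inter, mem_nbr, mem_erase, mem_univ, and_true] at hz
          by_contra hzx
          exact proper _ _ _ _ (adjx z hz.1.2 hz.1.1 hzx) (hax.trans hz.2.symm)
        intro z hz z' hz'
        rw [this z hz, this z' hz']
      · refine frugal ⟨x, hx⟩ a _ fun z hz => ?_
        simp only [mem_filter, mem_inter, mem_nbr, mem_erase, mem_univ, and_true] at hz
        exact ⟨hz.1.2, adjx _ _ hz.1.1 (fun h => hax (h ▸ hz.2)), hz.2⟩
    · refine frugal ⟨v, hvw⟩ a _ fun z hz => ?_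
      simp only [mem_filter, mem_inter, mem_nbr, mem_erase, mem_univ, and_true] at hz
      exact ⟨hz.1.2, adj _ _ _ _ hz.1.1, hz.2⟩

theorem exists_isPartial_of_isolated (hH : GridMinor H) (hdeg : ∀ v, #(nbr H v) ≤ Δ) (hN : 0 < N)
    (ih : ColourableBelow.{u} (Fintype.card W) Δ N k) {w : W} (hw : nbr H w = ∅) :
    ∃ c : W → Fin N, IsPartial H k (univ.erase w) c := by
  obtain ⟨c, hc⟩ := ih {y // y ≠ w} (H.comap Subtype.val)
    (Fintype.card_subtype_lt (x := w) (by simp))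
    (hH.of_model (f := fun y => if h : y ≠ w then some ⟨y, h⟩ else none)
      (isModel_of_star (fun i => i.1) (fun i => by simp [i.2]) (fun i y hy => by
        split_ifs at hy with h
        left; rw [← Option.some.inj hy]) (fun i j h =>
        ⟨i.1, j.1, h, by simp [i.2], by simp [j.2]⟩)))
    (fun v => le_trans (card_le_card_of_injOn Subtype.val (fun y hy => by simpa using hy)
      Subtype.val_injective.injOn) (hdeg v.1))
  have hadj : ∀ y, ¬ H.Adj w y := fun y hy => by simpa [hw] using (mem_nbr.2 hy)
  let c' : W → Fin N := fun y => if h : y ≠ w then c ⟨y, h⟩ else ⟨0, hN⟩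
  have hc' : ∀ y (h : y ≠ w), c' y = c ⟨y, h⟩ := fun y h => by simp [c', h]
  refine ⟨c', ⟨fun u hu v hv huv => ?_, fun v a => ?_⟩⟩
  · rw [hc' u (ne_of_mem_erase hu), hc' v (ne_of_mem_erase hv)]
    exact hc.proper _ (mem_univ _) _ (mem_univ _) huv
  · by_cases hvw : v = w
    · simp [hvw, hw]
    · refine le_trans ?_ (hc.frugal ⟨v, hvw⟩ a)
      refine card_le_card_of_surjOn Subtype.val ?_
      intro z hz
      simp only [coe_filter, Set.mem_ofPred_eq, mem_inter, mem_nbr, mem_erase, mem_univ, and_true] at hz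
      refine ⟨⟨z, hz.1.2⟩, ?_, rfl⟩
      have := hz.2
      rw [hc' z hz.1.2] at this
      simpa using ⟨hz.1.1, this⟩

end Colouring

end PlanarFrugal

namespace PlanarFrugal

open Finset

open scoped Classical

universe u

section Reducible

variable {W : Type u} [Fintype W] {H : SimpleGraph W} {N k Δ : ℕ}

theorem exists_colouring_of_erase {w : W} {c : W → Fin N} (hc : IsPartial H k (univ.erase w) c)
    (hN : 5 * Δ + 180 + 54 * k ≤ 3 * (N * k)) (hw : #(nbr H w) ≤ 18)
    (hs : 3 * ∑ u ∈ nbr H w, (#(nbr H u) - 1) < 5 * Δ + 180) :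
    ∃ c : W → Fin N, IsPartial H k univ c := by
  have := hc.exists_insert (notMem_erase w univ) (by
    have h1 : ∑ u ∈ nbr H w, #(nbr H u ∩ univ.erase w) = ∑ u ∈ nbr H w, (#(nbr H u) - 1) := by
      refine sum_congr rfl fun u hu => ?_
      rw [← card_erase_of_mem (mem_nbr.2 (mem_nbr.1 hu).symm), inter_erase, inter_univ]
    have h2 : k * #(nbr H w ∩ univ.erase w) ≤ k * 18 :=
      Nat.mul_le_mul_left _ ((card_le_card inter_subset_left).trans hw)
    omega)
  rwa [insert_erase (mem_univ w)] at this

theorem exists_colouring_of_reducible (hH : GridMinor H) (hdeg : ∀ v, #(nbr H v) ≤ Δ) (hk : 1 ≤ k)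
    (hN : 5 * Δ + 180 + 54 * k ≤ 3 * (N * k))
    (ih : ColourableBelow.{u} (Fintype.card W) Δ N k) {w : W}
    (hd : nbr H w = ∅ ∨ ∃ x, H.Adj w x ∧ #(nbr H w) + #(nbr H x) ≤ Δ + 2) (hw : #(nbr H w) ≤ 18)
    (hs : 3 * ∑ u ∈ nbr H w, (#(nbr H u) - 1) < 5 * Δ + 180) :
    ∃ c : W → Fin N, IsPartial H k univ c := by
  rcases hd with h | ⟨x, hx, hd⟩
  · have h0 : 0 < N := by
      rcases Nat.eq_zero_or_pos N with rfl | h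
      · omega
      · exact h
    obtain ⟨c, hc⟩ := exists_isPartial_of_isolated hH hdeg h0 ih h
    exact exists_colouring_of_erase hc hN hw hs
  · obtain ⟨c, hc⟩ := exists_isPartial_of_contract hH hdeg hk ih hx hd
    exact exists_colouring_of_erase hc hN hw hs

/-- Greedy colouring along a degeneracy order. -/
theorem exists_colouring_of_small (hH : GridMinor H) (hdeg : ∀ v, #(nbr H v) ≤ Δ) (hk : 1 ≤ k)
    (hΔ : Δ ≤ 13) (hN : 5 * Δ + 180 + 54 * k ≤ 3 * (N * k)) :
    ∃ c : W → Fin N, IsPartial H k univ c := by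
  have h0 : 0 < N := by
    rcases Nat.eq_zero_or_pos N with rfl | h
    · omega
    · exact h
  have key : ∀ n, ∀ S : Finset W, #S = n → (∀ x, x ∉ S → #(nbr H x ∩ S) ≤ 5) →
      ∃ c : W → Fin N, IsPartial H k S c := by
    intro n
    induction n with
    | zero =>
      intro S hS _
      rw [card_eq_zero] at hS
      subst hS
      exact ⟨fun _ => ⟨0, h0⟩, ⟨by simp, by simp⟩⟩
    | succ n ih =>
      intro S hS hx
      have hne : S.Nonempty := card_pos.1 (by omega)
      obtain ⟨v, hv, hv5⟩ : ∃ v ∈ S, #(nbr H v ∩ S) < 6 := by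
        refine exists_lt_of_sum_lt ?_
        rw [sum_const, smul_eq_mul, mul_comm]
        exact hH.sum_nbr_inter_lt hne
      have hsub : ∀ x, nbr H x ∩ S.erase v ⊆ nbr H x ∩ S := fun x =>
        inter_subset_inter_left (erase_subset _ _)
      have hv5' : #(nbr H v ∩ S.erase v) ≤ 5 := (card_le_card (hsub v)).trans (by omega)
      have hx' : ∀ x, x ∉ S.erase v → #(nbr H x ∩ S.erase v) ≤ 5 := by
        intro x hxS
        by_cases hxv : x = v
        · exact hxv ▸ hv5'
        · exact (card_le_card (hsub x)).trans (hx x fun h => hxS (mem_erase.2 ⟨hxv, h⟩))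
      obtain ⟨c, hc⟩ := ih (S.erase v) (by rw [card_erase_of_mem hv]; omega) hx'
      have hlt : ∀ u ∈ nbr H v, #(nbr H u ∩ S.erase v) + 1 ≤ #(nbr H u ∩ S) := by
        intro u hu
        rw [inter_erase, card_erase_of_mem (mem_inter.2 ⟨mem_nbr.2 (mem_nbr.1 hu).symm, hv⟩)]
        have : 0 < #(nbr H u ∩ S) :=
          card_pos.2 ⟨v, mem_inter.2 ⟨mem_nbr.2 (mem_nbr.1 hu).symm, hv⟩⟩
        omega
      have hsum : ∑ u ∈ nbr H v, #(nbr H u ∩ S.erase v) ≤ 4 * Δ + 5 * (Δ - 5) := by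
        calc ∑ u ∈ nbr H v, #(nbr H u ∩ S.erase v)
            ≤ ∑ u ∈ nbr H v, (4 + if u ∈ S then Δ - 5 else 0) := by
              refine sum_le_sum fun u hu => ?_
              have h1 := hlt u hu
              split_ifs with h
              · have := (card_le_card (inter_subset_left (s₁ := nbr H u) (s₂ := S))).trans (hdeg u)
                omega
              · have := hx u h
                omega
          _ = #(nbr H v) * 4 + #(nbr H v ∩ S) * (Δ - 5) := by
              rw [sum_add_distrib, sum_const, smul_eq_mul, ← sum_filter, sum_const, smul_eq_mul,
                filter_mem_eq_inter]
          _ ≤ Δ * 4 + 5 * (Δ - 5) := by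
              gcongr
              · exact hdeg v
              · omega
          _ = _ := by rw [mul_comm Δ 4]
      have hk5 : k * #(nbr H v ∩ S.erase v) ≤ k * 5 := Nat.mul_le_mul_left _ hv5'
      have := hc.exists_insert (notMem_erase v S) (by omega)
      rwa [insert_erase hv] at this
  exact key _ univ rfl (by simp)

/-- A low vertex with few neighbours of degree at least `12`. -/
theorem GridMinor.exists_low (hH : GridMinor H) [Nonempty W] :
    ∃ w, #(nbr H w) ≤ 5 ∧ #{u ∈ nbr H w | 12 ≤ #(nbr H u)} ≤ 2 := by
  by_contra! hcon
  let L : Finset W := {w | #(nbr H w) ≤ 5}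
  let B : Finset W := {w | 12 ≤ #(nbr H w)}
  have hLB : Disjoint L B := by
    rw [Finset.disjoint_left]
    intro w h1 h2
    simp only [L, B, mem_filter, mem_univ, true_and] at h1 h2
    omega
  have hle : ∀ w ∈ L, 3 ≤ #(nbr H w ∩ B) := by
    intro w hw
    simp only [L, mem_filter, mem_univ, true_and] at hw
    have := hcon w hw
    have h2 : nbr H w ∩ B = {u ∈ nbr H w | 12 ≤ #(nbr H u)} := by
      ext u; simp [B]
    rw [h2]; omega
  have h1 := hH.sum_nbr_inter_le_of_disjoint hLB
  have h2 : #L * 3 ≤ ∑ v ∈ L, #(nbr H v ∩ B) := by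
    rw [← smul_eq_mul, ← sum_const]; exact sum_le_sum hle
  have h3 := hH.sum_nbr_inter_lt (S := univ) univ_nonempty
  have h4 : ∀ v : W, 6 + (if v ∈ B then 6 else 0) ≤ #(nbr H v) + if v ∈ L then 3 else 0 := by
    intro v
    split_ifs with hB hL hL
    · exact (Finset.disjoint_left.1 hLB hL hB).elim
    · simp only [B, mem_filter] at hB; omega
    · have := (hle v hL).trans (card_le_card inter_subset_left); omega
    · simp only [L, mem_filter, mem_univ, true_and] at hL; omega
  have h5 := sum_le_sum fun v (_ : v ∈ univ) => h4 v
  simp only [sum_add_distrib, ← sum_filter, sum_const, smul_eq_mul, filter_mem_eq_inter,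
    univ_inter] at h5
  simp only [inter_univ] at h3
  omega

theorem exists_colouring_of_medium (hH : GridMinor H) (hdeg : ∀ v, #(nbr H v) ≤ Δ) (hk : 1 ≤ k)
    (hΔ : 14 ≤ Δ) (hΔ' : Δ ≤ 95) (hN : 5 * Δ + 180 + 54 * k ≤ 3 * (N * k))
    (ih : ColourableBelow.{u} (Fintype.card W) Δ N k) [Nonempty W] :
    ∃ c : W → Fin N, IsPartial H k univ c := by
  obtain ⟨w, hw, hw2⟩ := hH.exists_low
  refine exists_colouring_of_reducible hH hdeg hk hN ih (w := w) ?_ (by omega) ?_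
  · by_cases h : ∃ u, H.Adj w u ∧ #(nbr H u) ≤ 11
    · obtain ⟨u, h1, h2⟩ := h
      exact Or.inr ⟨u, h1, by omega⟩
    · push Not at h
      have heq : {u ∈ nbr H w | 12 ≤ #(nbr H u)} = nbr H w :=
        filter_true_of_mem fun u hu => h u (mem_nbr.1 hu)
      rw [heq] at hw2
      rcases (nbr H w).eq_empty_or_nonempty with h0 | ⟨x, hx⟩
      · exact Or.inl h0
      · exact Or.inr ⟨x, mem_nbr.1 hx, by have := hdeg x; omega⟩
  · have : ∑ u ∈ nbr H w, (#(nbr H u) - 1) ≤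
        ∑ u ∈ nbr H w, (10 + if 12 ≤ #(nbr H u) then Δ - 11 else 0) := by
      refine sum_le_sum fun u _ => ?_
      have := hdeg u
      split_ifs <;> omega
    rw [sum_add_distrib, ← sum_filter, sum_const, sum_const, smul_eq_mul, smul_eq_mul] at this
    have h2 : #{u ∈ nbr H w | 12 ≤ #(nbr H u)} * (Δ - 11) ≤ 2 * (Δ - 11) :=
      Nat.mul_le_mul_right _ hw2
    omega

end Reducible

end PlanarFrugal

namespace PlanarFrugal

open Finset

open scoped Classical

section Sets

variable {W : Type*} [Fintype W] {H : SimpleGraph W}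

theorem exists_classifier {K : Type*} (g : K → Finset W)
    (hg : ∀ i j w, w ∈ g i → w ∈ g j → i = j) :
    ∃ f : W → Option K, ∀ w i, f w = some i ↔ w ∈ g i := by
  refine ⟨fun w => if h : ∃ i, w ∈ g i then some h.choose else none, fun w i => ?_⟩
  dsimp only
  split_ifs with h
  · constructor
    · intro h'
      rw [← Option.some.inj h']
      exact h.choose_spec
    · intro h'
      rw [hg _ _ w h.choose_spec h']
  · simpa using fun h' => h ⟨i, h'⟩

theorem GridMinor.sum_card_lt_of_sets (hH : GridMinor H) {K : Type*} [Fintype K] [Nonempty K]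
    (g : K → Finset W) (hg : ∀ i j w, w ∈ g i → w ∈ g j → i = j)
    (hstar : ∀ i, ∃ x ∈ g i, ∀ y ∈ g i, y = x ∨ H.Adj x y) (T : K → Finset K)
    (hT : ∀ i, ∀ j ∈ T i, j ≠ i ∧ ∃ a ∈ g i, ∃ b ∈ g j, H.Adj a b) :
    ∑ i, #(T i) < 6 * Fintype.card K := by
  obtain ⟨f, hf⟩ := exists_classifier g hg
  choose x hx hstar using hstar
  refine hH.sum_card_lt_of_stars x (fun i => (hf _ _).2 (hx i))
    (fun i y hy => hstar i y ((hf _ _).1 hy)) T fun i j hj => ?_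
  obtain ⟨h1, a, ha, b, hb, hab⟩ := hT i j hj
  exact ⟨h1, a, b, hab, (hf _ _).2 ha, (hf _ _).2 hb⟩

theorem GridMinor.sum_card_le_of_bipartite_sets (hH : GridMinor H) {A B : Type*} [Fintype A]
    [Fintype B] (g : A ⊕ B → Finset W) (hg : ∀ i j w, w ∈ g i → w ∈ g j → i = j)
    (hstar : ∀ i, ∃ x ∈ g i, ∀ y ∈ g i, y = x ∨ H.Adj x y) (T : A → Finset B)
    (hT : ∀ i, ∀ j ∈ T i, ∃ a ∈ g (Sum.inl i), ∃ b ∈ g (Sum.inr j), H.Adj a b) :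
    ∑ i, #(T i) ≤ 2 * (Fintype.card A + Fintype.card B) := by
  obtain ⟨f, hf⟩ := exists_classifier g hg
  choose x hx hstar using hstar
  refine hH.sum_card_le_of_bipartite_stars x (fun i => (hf _ _).2 (hx i))
    (fun i y hy => hstar i y ((hf _ _).1 hy)) T fun i j hj => ?_
  obtain ⟨a, ha, b, hb, hab⟩ := hT i j hj
  exact ⟨a, b, hab, (hf _ _).2 ha, (hf _ _).2 hb⟩

/-- At most two vertices adjacent to `u`, `v` are adjacent to a third vertex `y`. -/
theorem GridMinor.card_le_two (hH : GridMinor H) {u v y : W} (huv : u ≠ v) (hu : u ≠ y)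
    (hv : v ≠ y) (S : Finset W)
    (hS : ∀ w ∈ S, H.Adj w u ∧ H.Adj w v ∧ H.Adj w y) : #S ≤ 2 := by
  by_contra! h
  obtain ⟨T, hTS, hT⟩ := exists_subset_card_eq (show 3 ≤ #S by omega)
  let e := T.equivFinOfCardEq hT
  have hw : ∀ i, ((e.symm i : W)) ∈ S := fun i => hTS (e.symm i).2
  refine hH.no_K33_star huv {y} (Set.mem_singleton y) (by simp) (by simpa using hu)
    (by simpa using hv) (w := fun i => (e.symm i).1) (fun i j hij => ?_) (fun i => ?_)
    (fun i => (hS _ (hw i)).1) (fun i => (hS _ (hw i)).2.1)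
    (fun i => ⟨y, rfl, (hS _ (hw i)).2.2⟩)
  · exact e.symm.injective (Subtype.ext hij)
  · exact fun h => (hS _ (hw i)).2.2.ne h

end Sets

section Clusters

variable {W : Type*} [Fintype W] (H : SimpleGraph W) (B : Finset W)

/-- The neighbours in `B`. -/
noncomputable def bnbr (v : W) : Finset W := nbr H v ∩ B

/-- The neighbours outside `B`. -/
noncomputable def qnbr (v : W) : Finset W := nbr H v \ B

/-- A star outside `B` having at least three neighbours in `B`, without waste. -/
structure IsCluster (S : Finset W) : Prop where
  star : ∃ x ∈ S, ∀ y ∈ S, y = x ∨ H.Adj x y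
  disj : ∀ x ∈ S, x ∉ B
  three_le : 3 ≤ #(S.biUnion (bnbr H B))
  sum_le : ∑ w ∈ S, #(bnbr H B w) ≤ 6 * (#(S.biUnion (bnbr H B)) - 2)
  eq_of_three_le : ∀ y ∈ S, 3 ≤ #(bnbr H B y) → ∀ z ∈ S, z = y

/-- A maximal family of disjoint clusters. -/
structure IsPacking (Θ : Finset (Finset W)) : Prop where
  cluster : ∀ S ∈ Θ, IsCluster H B S
  disj : ∀ S ∈ Θ, ∀ S' ∈ Θ, ∀ w, w ∈ S → w ∈ S' → S = S'
  maximal : ∀ S, IsCluster H B S → ∃ w ∈ S, w ∈ Θ.biUnion id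

theorem exists_isPacking : ∃ Θ, IsPacking H B Θ := by
  let P : Finset (Finset (Finset W)) := {Θ | (∀ S ∈ Θ, IsCluster H B S) ∧
    ∀ S ∈ Θ, ∀ S' ∈ Θ, ∀ w, w ∈ S → w ∈ S' → S = S'}
  obtain ⟨Θ, hΘ, hmax⟩ := P.exists_max_image card ⟨∅, by simp [P]⟩
  obtain ⟨h1, h2⟩ := (mem_filter.1 hΘ).2
  refine ⟨Θ, h1, h2, fun S hS => ?_⟩
  by_contra! hcon
  have hn : ∀ S' ∈ Θ, ∀ w, w ∈ S → w ∉ S' := fun S' hS' w hw hw' =>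
    hcon w hw (mem_biUnion.2 ⟨S', hS', hw'⟩)
  have hSΘ : S ∉ Θ := fun h => by
    obtain ⟨x, hx, -⟩ := hS.star
    exact hn S h x hx hx
  have := hmax (insert S Θ) (mem_filter.2 ⟨mem_univ _, by
    intro S' hS'
    rcases mem_insert.1 hS' with rfl | h
    · exact hS
    · exact h1 _ h, by
    intro S1 hS1 S2 hS2 w hw1 hw2
    rcases mem_insert.1 hS1 with h | h <;> rcases mem_insert.1 hS2 with h' | h'
    · exact h.trans h'.symm
    · exact (hn S2 h' w (h ▸ hw1) hw2).elim
    · exact (hn S1 h w (h' ▸ hw2) hw1).elim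
    · exact h2 _ h _ h' w hw1 hw2⟩)
  rw [card_insert_of_notMem hSΘ] at this
  omega

variable {H B}

theorem mem_bnbr {v u : W} : u ∈ bnbr H B v ↔ H.Adj v u ∧ u ∈ B := by simp [bnbr]

theorem mem_qnbr {v u : W} : u ∈ qnbr H B v ↔ H.Adj v u ∧ u ∉ B := by simp [qnbr]

theorem card_nbr_eq (v : W) : #(nbr H v) = #(bnbr H B v) + #(qnbr H B v) :=
  (card_inter_add_card_sdiff _ _).symm

theorem isCluster_singleton {x : W} (hx : x ∉ B) (h : 3 ≤ #(bnbr H B x)) :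
    IsCluster H B {x} := by
  refine ⟨⟨x, by simp⟩, by simpa using hx, by simpa using h, ?_, by simp⟩
  simp only [sum_singleton, singleton_biUnion]
  omega

theorem isCluster_pair {x y : W} (hx : x ∉ B) (hy : y ∉ B) (hxy : H.Adj x y)
    (hbx : #(bnbr H B x) ≤ 2) (hby : #(bnbr H B y) ≤ 2)
    (h : 3 ≤ #(bnbr H B x ∪ bnbr H B y)) : IsCluster H B {x, y} := by
  have hU : ({x, y} : Finset W).biUnion (bnbr H B) = bnbr H B x ∪ bnbr H B y := by
    rw [biUnion_insert, singleton_biUnion]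
  refine ⟨⟨x, by simp, ?_⟩, ?_, by rwa [hU], ?_, ?_⟩
  · simp [hxy]
  · simp [hx, hy]
  · rw [hU, sum_pair hxy.ne]; omega
  · intro z hz hz3
    simp only [mem_insert, mem_singleton] at hz
    rcases hz with rfl | rfl <;> omega

theorem isCluster_triple {w x w' : W} (hw : w ∉ B) (hx : x ∉ B) (hw' : w' ∉ B)
    (hxw : H.Adj x w) (hxw' : H.Adj x w')
    (hbw : #(bnbr H B w) ≤ 2) (hbx : #(bnbr H B x) ≤ 2) (hbw' : #(bnbr H B w') ≤ 2)
    (h : 3 ≤ #(bnbr H B w ∪ bnbr H B w')) : IsCluster H B {x, w, w'} := by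
  have hne : w ≠ w' := by rintro rfl; rw [union_self] at h; omega
  have hU : bnbr H B w ∪ bnbr H B w' ⊆ ({x, w, w'} : Finset W).biUnion (bnbr H B) := by
    rw [biUnion_insert, biUnion_insert, singleton_biUnion]
    exact subset_union_right
  have h3 := h.trans (card_le_card hU)
  refine ⟨⟨x, by simp, ?_⟩, ?_, h3, ?_, ?_⟩
  · simp [hxw, hxw']
  · simp [hx, hw, hw']
  · rw [sum_insert (by simp [hxw.ne, hxw'.ne]), sum_pair hne]; omega
  · intro z hz hz3
    simp only [mem_insert, mem_singleton] at hz
    rcases hz with rfl | rfl | rfl <;> omega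

variable {Θ : Finset (Finset W)}

theorem IsPacking.sum_le (hΘ : IsPacking H B Θ) (hH : GridMinor H) :
    ∑ S ∈ Θ, (#(S.biUnion (bnbr H B)) - 2) ≤ 2 * #B := by
  have h := hH.sum_card_le_of_bipartite_sets (A := Θ) (B := B)
    (Sum.elim (fun S => S.1) (fun v => {v.1})) (by
      rintro (S | v) (S' | v') w hw hw' <;> simp only [Sum.elim_inl, Sum.elim_inr,
        mem_singleton] at hw hw'
      · rw [Subtype.ext (hΘ.disj _ S.2 _ S'.2 w hw hw')]
      · exact ((hΘ.cluster _ S.2).disj w hw (hw' ▸ v'.2)).elim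
      · exact ((hΘ.cluster _ S'.2).disj w hw' (hw ▸ v.2)).elim
      · rw [Subtype.ext (hw.symm.trans hw')])
    (by
      rintro (S | v)
      · exact (hΘ.cluster _ S.2).star
      · exact ⟨v.1, by simp⟩)
    (fun S => {v : B | v.1 ∈ S.1.biUnion (bnbr H B)}) (fun S v hv => by
      simp only [mem_filter, mem_univ, true_and, mem_biUnion, mem_bnbr] at hv
      obtain ⟨a, ha, hav, -⟩ := hv
      exact ⟨a, ha, v.1, by simp, hav⟩)
  rw [Fintype.card_coe, Fintype.card_coe] at h
  have h2 : ∀ S : Θ, #{v : B | v.1 ∈ S.1.biUnion (bnbr H B)} = #(S.1.biUnion (bnbr H B)) := by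
    intro S
    refine card_bij (fun v _ => v.1) (fun v hv => by simpa using hv)
      (fun v _ v' _ h => Subtype.ext h) (fun v hv => ?_)
    obtain ⟨a, -, ha⟩ := mem_biUnion.1 hv
    exact ⟨⟨v, (mem_bnbr.1 ha).2⟩, by simpa using hv, rfl⟩
  rw [sum_congr rfl fun S _ => h2 S, sum_coe_sort Θ fun S => #(S.biUnion (bnbr H B))] at h
  have h3 : ∑ S ∈ Θ, (#(S.biUnion (bnbr H B)) - 2) + ∑ S ∈ Θ, 2 =
      ∑ S ∈ Θ, #(S.biUnion (bnbr H B)) := by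
    rw [← sum_add_distrib]
    exact sum_congr rfl fun S hS => Nat.sub_add_cancel
      (by have := (hΘ.cluster S hS).three_le; omega)
  rw [sum_const, smul_eq_mul] at h3
  omega

theorem IsPacking.card_le (hΘ : IsPacking H B Θ) (hH : GridMinor H) : #Θ ≤ 2 * #B := by
  refine le_trans ?_ (hΘ.sum_le hH)
  rw [card_eq_sum_ones]
  exact sum_le_sum fun S hS => by have := (hΘ.cluster S hS).three_le; omega

theorem IsPacking.sum_bnbr_le (hΘ : IsPacking H B Θ) (hH : GridMinor H) :
    ∑ w ∈ Θ.biUnion id, #(bnbr H B w) ≤ 12 * #B := by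
  rw [sum_biUnion (t := id) fun S hS S' hS' hne => Finset.disjoint_left.2
    fun w hw hw' => hne (hΘ.disj S hS S' hS' w hw hw')]
  refine (sum_le_sum fun S hS => (hΘ.cluster S hS).sum_le).trans ?_
  rw [← mul_sum]
  have := hΘ.sum_le hH
  omega

/-- Few vertices with two neighbours in `B` are attached to clusters. -/
theorem IsPacking.card_attached_le (hΘ : IsPacking H B Θ) (hH : GridMinor H) (S : Finset W)
    (hS : ∀ w ∈ S, w ∉ B ∧ #(bnbr H B w) = 2 ∧ w ∉ Θ.biUnion id ∧
      ∃ x ∈ Θ.biUnion id, H.Adj w x) : #S ≤ 6 * #B := by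
  have h := hH.sum_card_le_of_bipartite_sets (A := S) (B := B ⊕ Θ)
    (Sum.elim (fun w => {w.1}) (Sum.elim (fun v => {v.1}) (fun S => S.1))) (by
      have h1 : ∀ (w : S) (R : Θ) x, x = w.1 → x ∉ R.1 := fun w R x hx h =>
        (hS w.1 w.2).2.2.1 (mem_biUnion.2 ⟨R.1, R.2, hx ▸ h⟩)
      have h2 : ∀ (v : B) (R : Θ) x, x = v.1 → x ∉ R.1 := fun v R x hx h =>
        (hΘ.cluster _ R.2).disj x h (hx ▸ v.2)
      rintro (w | v | R) (w' | v' | R') x hx hx' <;> simp only [Sum.elim_inl, Sum.elim_inr,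
        mem_singleton] at hx hx'
      · rw [Subtype.ext (hx.symm.trans hx')]
      · exact ((hS w.1 w.2).1 (hx ▸ hx' ▸ v'.2)).elim
      · exact (h1 _ _ _ hx hx').elim
      · exact ((hS w'.1 w'.2).1 (hx' ▸ hx ▸ v.2)).elim
      · rw [Subtype.ext (hx.symm.trans hx')]
      · exact (h2 _ _ _ hx hx').elim
      · exact (h1 _ _ _ hx' hx).elim
      · exact (h2 _ _ _ hx' hx).elim
      · rw [Subtype.ext (hΘ.disj _ R.2 _ R'.2 x hx hx')])
    (by
      rintro (w | v | R)
      · exact ⟨w.1, by simp⟩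
      · exact ⟨v.1, by simp⟩
      · exact (hΘ.cluster _ R.2).star)
    (fun w => ({v : B | H.Adj w.1 v.1} : Finset B).disjSum {R : Θ | ∃ x ∈ R.1, H.Adj w.1 x}) (by
      rintro w (v | R) hv
      · simp only [inl_mem_disjSum, mem_filter, mem_univ, true_and] at hv
        exact ⟨w.1, by simp, v.1, by simp, hv⟩
      · simp only [inr_mem_disjSum, mem_filter, mem_univ, true_and] at hv
        obtain ⟨x, hx, hwx⟩ := hv
        exact ⟨w.1, by simp, x, by simpa using hx, hwx⟩)
  have h3 : ∀ w : S, 3 ≤ #(({v : B | H.Adj w.1 v.1} : Finset B).disjSum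
      {R : Θ | ∃ x ∈ R.1, H.Adj w.1 x}) := by
    intro w
    obtain ⟨-, h2, -, x, hx, hwx⟩ := hS w.1 w.2
    rw [card_disjSum]
    have h4 : #(bnbr H B w.1) ≤ #({v : B | H.Adj w.1 v.1} : Finset B) := by
      refine card_le_card_of_surjOn Subtype.val fun v hv => ?_
      obtain ⟨h5, h6⟩ := mem_bnbr.1 hv
      exact ⟨⟨v, h6⟩, by simpa using h5, rfl⟩
    have h5 : 0 < #({R : Θ | ∃ x ∈ R.1, H.Adj w.1 x} : Finset Θ) := by
      obtain ⟨R, hR, hxR⟩ := mem_biUnion.1 hx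
      exact card_pos.2 ⟨⟨R, hR⟩, by simpa using ⟨x, hxR, hwx⟩⟩
    omega
  have h6 := (sum_le_sum fun w (_ : w ∈ univ) => h3 w).trans h
  simp only [sum_const, card_univ, Fintype.card_coe, Fintype.card_sum, smul_eq_mul] at h6
  have := hΘ.card_le hH
  omega

end Clusters

end PlanarFrugal

namespace PlanarFrugal

open Finset

open scoped Classical

section Discharging

variable {W : Type*} [Fintype W] {H : SimpleGraph W} {B : Finset W}

theorem GridMinor.sum_card_lt_of_finset (hH : GridMinor H) {K : Finset W} (hK : K.Nonempty)
    (g : W → Finset W) (hg : ∀ i ∈ K, ∀ j ∈ K, ∀ w, w ∈ g i → w ∈ g j → i = j)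
    (hstar : ∀ i ∈ K, i ∈ g i ∧ ∀ y ∈ g i, y = i ∨ H.Adj i y) (T : W → Finset W)
    (hT : ∀ i ∈ K, ∀ j ∈ T i, j ∈ K ∧ j ≠ i ∧ ∃ a ∈ g i, ∃ b ∈ g j, H.Adj a b) :
    ∑ i ∈ K, #(T i) < 6 * #K := by
  have : Nonempty K := hK.coe_sort
  have h := hH.sum_card_lt_of_sets (K := K) (fun i => g i.1)
    (fun i j w hi hj => Subtype.ext (hg _ i.2 _ j.2 w hi hj))
    (fun i => ⟨i.1, hstar i.1 i.2⟩) (fun i => {j | j.1 ∈ T i.1}) (fun i j hj => by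
      obtain ⟨-, h1, h2⟩ := hT i.1 i.2 j.1 (mem_filter.1 hj).2
      exact ⟨fun h => h1 (congrArg Subtype.val h), h2⟩)
  rw [Fintype.card_coe] at h
  refine lt_of_le_of_lt (le_of_eq ?_) h
  rw [← sum_coe_sort K]
  refine sum_congr rfl fun i _ => (card_bij (fun (j : K) _ => j.1) ?_ ?_ ?_).symm
  · intro j hj; simpa using hj
  · intro j _ j' _ h; exact Subtype.ext h
  · intro j hj; exact ⟨⟨j, (hT i.1 i.2 j hj).1⟩, by simpa using hj, rfl⟩

theorem GridMinor.card_le_two_of_bnbr (hH : GridMinor H) {y : W} (hy : y ∉ B) {P : Finset W}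
    (hP : 2 ≤ #P) (S : Finset W) (hS : ∀ w ∈ S, H.Adj y w ∧ P ⊆ bnbr H B w) : #S ≤ 2 := by
  obtain ⟨u, hu, v, hv, huv⟩ := one_lt_card.1 (show 1 < #P by omega)
  by_cases h0 : S = ∅
  · simp [h0]
  obtain ⟨s, hs⟩ := nonempty_iff_ne_empty.2 h0
  have hB : ∀ x ∈ P, x ≠ y := fun x hx h =>
    hy (h ▸ (mem_bnbr.1 ((hS s hs).2 hx)).2)
  exact hH.card_le_two huv (hB u hu) (hB v hv) S fun w hw =>
    ⟨(mem_bnbr.1 ((hS w hw).2 hu)).1, (mem_bnbr.1 ((hS w hw).2 hv)).1, (hS w hw).1.symm⟩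

variable (H B) in
/-- A vertex with two neighbours in `B`, which are also neighbours of its other neighbours. -/
def IsReg (v : W) : Prop :=
  v ∉ B ∧ #(bnbr H B v) = 2 ∧ ∀ x ∈ qnbr H B v, bnbr H B v ⊆ bnbr H B x

theorem qnbr_symm {u v : W} (hu : u ∉ B) (h : v ∈ qnbr H B u) : u ∈ qnbr H B v :=
  mem_qnbr.2 ⟨(mem_qnbr.1 h).1.symm, hu⟩

theorem IsReg.bnbr_eq {x v : W} (hx : IsReg H B x) (hv : v ∈ qnbr H B x)
    (h : #(bnbr H B v) ≤ 2) : bnbr H B x = bnbr H B v :=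
  eq_of_subset_of_card_le (hx.2.2 v hv) (by rw [hx.2.1]; exact h)

theorem exists_of_not_isReg {v : W} (hv : v ∉ B) (h2 : #(bnbr H B v) = 2) (hr : ¬ IsReg H B v) :
    ∃ x ∈ qnbr H B v, ¬ IsReg H B x ∧ ¬ bnbr H B v ⊆ bnbr H B x := by
  by_contra! hcon
  refine hr ⟨hv, h2, fun x hx => ?_⟩
  by_cases hxr : IsReg H B x
  · exact (hxr.bnbr_eq (qnbr_symm hv hx) h2.le).symm.subset
  · exact hcon x hx hxr

variable (H B) in
/-- The vertices in `A` are to be contracted into their unique relevant neighbour `z w`. -/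
structure IsAttachment (A : Finset W) (z : W → W) : Prop where
  notMem : ∀ w ∈ A, w ∉ B
  card_bnbr : ∀ w ∈ A, #(bnbr H B w) = 2
  notReg : ∀ w ∈ A, ¬ IsReg H B w
  target_mem : ∀ w ∈ A, z w ∈ qnbr H B w
  eq_target : ∀ w ∈ A, ∀ x ∈ qnbr H B w, ¬ IsReg H B x → x = z w
  two_le : ∀ v, v ∉ B → #(bnbr H B v) = 2 → ¬ IsReg H B v → v ∉ A → (∀ w ∈ A, z w ≠ v) →
    2 ≤ #{x ∈ qnbr H B v | ¬ IsReg H B x}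

variable (H B) in
theorem exists_isAttachment : ∃ A z, IsAttachment H B A z := by
  have h1 : ∀ v, ∃ z, v ∉ B → #(bnbr H B v) = 2 → ¬ IsReg H B v →
      z ∈ qnbr H B v ∧ ¬ IsReg H B z := by
    intro v
    by_cases h : v ∉ B ∧ #(bnbr H B v) = 2 ∧ ¬ IsReg H B v
    · obtain ⟨x, hx, hxr, -⟩ := exists_of_not_isReg h.1 h.2.1 h.2.2
      exact ⟨x, fun _ _ _ => ⟨hx, hxr⟩⟩
    · exact ⟨v, fun a b c => (h ⟨a, b, c⟩).elim⟩
  choose z hz using h1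
  let A₀ : Finset W := {w | (w ∉ B ∧ #(bnbr H B w) = 2 ∧ ¬ IsReg H B w) ∧
    ∀ x ∈ qnbr H B w, ¬ IsReg H B x → x = z w}
  let P : Finset (Finset W) := {A | A ⊆ A₀ ∧ ∀ w ∈ A, z w ∉ A}
  obtain ⟨A, hA, hmax⟩ := P.exists_max_image card ⟨∅, by simp [P]⟩
  obtain ⟨hA0, hAz⟩ := (mem_filter.1 hA).2
  have h0 : ∀ w ∈ A, (w ∉ B ∧ #(bnbr H B w) = 2 ∧ ¬ IsReg H B w) ∧
    ∀ x ∈ qnbr H B w, ¬ IsReg H B x → x = z w := fun w hw => (mem_filter.1 (hA0 hw)).2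
  refine ⟨A, z, fun w hw => (h0 w hw).1.1, fun w hw => (h0 w hw).1.2.1,
    fun w hw => (h0 w hw).1.2.2, fun w hw => (hz w (h0 w hw).1.1 (h0 w hw).1.2.1
    (h0 w hw).1.2.2).1, fun w hw => (h0 w hw).2, fun v hv hv2 hvr hvA hvz => ?_⟩
  obtain ⟨hz1, hz2⟩ := hz v hv hv2 hvr
  by_contra! hlt
  have hv0 : ∀ x ∈ qnbr H B v, ¬ IsReg H B x → x = z v := fun x hx hxr =>
    card_le_one.1 (Nat.lt_succ_iff.1 hlt) x (mem_filter.2 ⟨hx, hxr⟩) (z v)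
      (mem_filter.2 ⟨hz1, hz2⟩)
  have := hmax (insert v A) (mem_filter.2 ⟨mem_univ _, insert_subset
    (mem_filter.2 ⟨mem_univ _, ⟨hv, hv2, hvr⟩, hv0⟩) hA0, fun w hw hwz => by
      rcases mem_insert.1 hw with rfl | hw
      · rcases mem_insert.1 hwz with h | h
        · exact ((mem_qnbr.1 hz1).1.ne h.symm)
        · exact hvz _ h ((h0 _ h).2 w (qnbr_symm hv hz1) hvr).symm
      · rcases mem_insert.1 hwz with h | h
        · exact hvz w hw h
        · exact hAz w hw h⟩)
  rw [card_insert_of_notMem hvA] at this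
  omega

variable (H B) in
/-- The neighbours in `B` after contraction. -/
noncomputable def bnbr' (A : Finset W) (z : W → W) (v : W) : Finset W :=
  bnbr H B v ∪ ({w ∈ A | z w = v} : Finset W).biUnion (bnbr H B)

variable (H B) in
/-- The neighbours outside `B` after contraction. -/
noncomputable def qnbr' (A : Finset W) (v : W) : Finset W :=
  {x ∈ qnbr H B v | ¬ IsReg H B x ∧ x ∉ A}

variable {A : Finset W} {z : W → W}

theorem IsAttachment.sum_lt (hA : IsAttachment H B A z) (hH : GridMinor H) (hB : B.Nonempty) :
    ∑ v with v ∉ B ∧ ¬ IsReg H B v ∧ v ∉ A, (#(qnbr' H B A v) + 2 * #(bnbr' H B A z v)) +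
      ∑ v ∈ B, #(bnbr H B v) <
    6 * #{v | v ∉ B ∧ ¬ IsReg H B v ∧ v ∉ A} + 6 * #B := by
  set L : Finset W := {v | v ∉ B ∧ ¬ IsReg H B v ∧ v ∉ A} with hL
  have memL : ∀ v, v ∈ L ↔ v ∉ B ∧ ¬ IsReg H B v ∧ v ∉ A := fun v => by simp [L]
  have hLB : Disjoint L B := Finset.disjoint_left.2 fun v hv => ((memL v).1 hv).1
  have hKA : ∀ v ∈ L ∪ B, v ∉ A := fun v hv hvA => by
    rcases mem_union.1 hv with h | h
    · exact ((memL v).1 h).2.2 hvA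
    · exact hA.notMem v hvA h
  have hsub : ∀ v, bnbr' H B A z v ⊆ B := fun v x hx => by
    rcases mem_union.1 hx with h | h
    · exact (mem_bnbr.1 h).2
    · obtain ⟨w, -, hw⟩ := mem_biUnion.1 h
      exact (mem_bnbr.1 hw).2
  let g : W → Finset W := fun v => insert v ({w ∈ A | z w = v} : Finset W)
  have hg : ∀ v, ∀ x ∈ bnbr' H B A z v, ∃ a ∈ g v, H.Adj a x := fun v x hx => by
    rcases mem_union.1 hx with h | h
    · exact ⟨v, mem_insert_self _ _, (mem_bnbr.1 h).1⟩
    · obtain ⟨w, hw, hwx⟩ := mem_biUnion.1 h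
      exact ⟨w, mem_insert_of_mem hw, (mem_bnbr.1 hwx).1⟩
  let T : W → Finset W := fun v => if v ∈ B then
    bnbr H B v ∪ ({x ∈ L | v ∈ bnbr' H B A z x} : Finset W)
    else qnbr' H B A v ∪ bnbr' H B A z v
  have key := hH.sum_card_lt_of_finset (K := L ∪ B) (hB.mono subset_union_right) g (by
      intro i hi j hj w hwi hwj
      rcases mem_insert.1 hwi with h | h <;> rcases mem_insert.1 hwj with h' | h'
      · exact h.symm.trans h'
      · exact (hKA i hi (h ▸ (mem_filter.1 h').1)).elim
      · exact (hKA j hj (h' ▸ (mem_filter.1 h).1)).elim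
      · exact (mem_filter.1 h).2.symm.trans (mem_filter.1 h').2) (by
      intro i hi
      refine ⟨mem_insert_self _ _, fun y hy => ?_⟩
      rcases mem_insert.1 hy with h | h
      · exact Or.inl h
      · obtain ⟨h1, rfl⟩ := mem_filter.1 h
        exact Or.inr (mem_qnbr.1 (hA.target_mem y h1)).1.symm) T (by
      intro i hi j hj
      by_cases hiB : i ∈ B
      · simp only [T, if_pos hiB] at hj
        rcases mem_union.1 hj with h | h
        · obtain ⟨h1, h2⟩ := mem_bnbr.1 h
          exact ⟨mem_union_right _ h2, h1.ne', i, mem_insert_self _ _, j, mem_insert_self _ _, h1⟩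
        · obtain ⟨h1, h2⟩ := mem_filter.1 h
          obtain ⟨a, ha, hai⟩ := hg j i h2
          exact ⟨mem_union_left _ h1, fun h3 => ((memL j).1 h1).1 (h3 ▸ hiB),
            i, mem_insert_self _ _, a, ha, hai.symm⟩
      · simp only [T, if_neg hiB] at hj
        rcases mem_union.1 hj with h | h
        · obtain ⟨h1, h2⟩ := mem_filter.1 h
          obtain ⟨h3, h4⟩ := mem_qnbr.1 h1
          exact ⟨mem_union_left _ ((memL j).2 ⟨h4, h2⟩), h3.ne', i, mem_insert_self _ _, j,
            mem_insert_self _ _, h3⟩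
        · obtain ⟨a, ha, hai⟩ := hg i j h
          exact ⟨mem_union_right _ (hsub i h), fun h3 => hiB (h3 ▸ hsub i h), a, ha, j,
            mem_insert_self _ _, hai⟩)
  rw [sum_union hLB, card_union_of_disjoint hLB, mul_add] at key
  have h1 : ∑ v ∈ L, #(T v) = ∑ v ∈ L, (#(qnbr' H B A v) + #(bnbr' H B A z v)) := by
    refine sum_congr rfl fun v hv => ?_
    simp only [T, if_neg ((memL v).1 hv).1]
    refine card_union_of_disjoint (Finset.disjoint_left.2 fun x hx hx' => ?_)
    exact (mem_qnbr.1 (mem_filter.1 hx).1).2 (hsub v hx')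
  have h2 : ∑ v ∈ B, #(T v) = ∑ v ∈ B, #(bnbr H B v) + ∑ v ∈ L, #(bnbr' H B A z v) := by
    have h3 : ∑ v ∈ L, #(bnbr' H B A z v) = ∑ v ∈ B, #{x ∈ L | v ∈ bnbr' H B A z x} := by
      refine Eq.trans ?_ (sum_card_bipartiteAbove_eq_sum_card_bipartiteBelow (s := L) (t := B)
        (fun x v => v ∈ bnbr' H B A z x))
      refine sum_congr rfl fun x _ => ?_
      rw [bipartiteAbove, filter_mem_eq_inter, inter_eq_right.2 (hsub x)]
    rw [h3, ← sum_add_distrib]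
    refine sum_congr rfl fun v hv => ?_
    simp only [T, if_pos hv]
    refine card_union_of_disjoint (Finset.disjoint_left.2 fun x hx hx' => ?_)
    exact ((memL x).1 (mem_filter.1 hx').1).1 (mem_bnbr.1 hx).2
  have h4 : ∑ v ∈ L, (#(qnbr' H B A v) + 2 * #(bnbr' H B A z v)) =
      ∑ v ∈ L, (#(qnbr' H B A v) + #(bnbr' H B A z v)) + ∑ v ∈ L, #(bnbr' H B A z v) := by
    rw [← sum_add_distrib]
    exact sum_congr rfl fun v _ => by ring
  omega

end Discharging

end PlanarFrugal

namespace PlanarFrugal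

open Finset

open scoped Classical

section Charge

variable {W : Type*} [Fintype W] {H : SimpleGraph W} {B A : Finset W} {z : W → W}
  {Θ : Finset (Finset W)}

theorem card_filter_isReg_le (hH : GridMinor H) {v : W} (hv : v ∉ B) (h2 : #(bnbr H B v) = 2) :
    #{x ∈ qnbr H B v | IsReg H B x} ≤ 2 := by
  refine hH.card_le_two_of_bnbr hv h2.ge _ fun x hx => ?_
  obtain ⟨h1, h3⟩ := mem_filter.1 hx
  exact ⟨(mem_qnbr.1 h1).1, (h3.bnbr_eq (qnbr_symm hv h1) h2.le).symm.subset⟩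

theorem filter_isReg_eq_empty {v : W} (hv : v ∉ B) (h2 : #(bnbr H B v) ≤ 1) :
    ({x ∈ qnbr H B v | IsReg H B x} : Finset W) = ∅ := by
  refine filter_eq_empty_iff.2 fun x hx hr => ?_
  have := card_le_card (hr.2.2 v (qnbr_symm hv hx))
  rw [hr.2.1] at this
  omega

theorem IsReg.card_qnbr_le (hH : GridMinor H) {v : W} (hv : IsReg H B v) :
    #(qnbr H B v) ≤ 2 :=
  hH.card_le_two_of_bnbr hv.1 hv.2.1.ge _ fun x hx => ⟨(mem_qnbr.1 hx).1, hv.2.2 x hx⟩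

theorem IsAttachment.not_subset (hA : IsAttachment H B A z) {w : W} (hw : w ∈ A) :
    ¬ bnbr H B w ⊆ bnbr H B (z w) := by
  obtain ⟨x, h1, h2, h3⟩ := exists_of_not_isReg (hA.notMem w hw) (hA.card_bnbr w hw)
    (hA.notReg w hw)
  rwa [hA.eq_target w hw x h1 h2] at h3

theorem IsAttachment.card_qnbr_le (hA : IsAttachment H B A z) (hH : GridMinor H) {w : W}
    (hw : w ∈ A) : #(qnbr H B w) ≤ 3 := by
  rw [← card_filter_add_card_filter_not (fun x => IsReg H B x)]
  have h1 := card_filter_isReg_le hH (hA.notMem w hw) (hA.card_bnbr w hw)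
  have h2 : #{x ∈ qnbr H B w | ¬ IsReg H B x} ≤ 1 := by
    refine card_le_one.2 fun x hx y hy => ?_
    obtain ⟨hx1, hx2⟩ := mem_filter.1 hx
    obtain ⟨hy1, hy2⟩ := mem_filter.1 hy
    rw [hA.eq_target w hw x hx1 hx2, hA.eq_target w hw y hy1 hy2]
  omega

theorem IsPacking.card_bnbr_le (hΘ : IsPacking H B Θ) {v : W} (hv : v ∉ B)
    (hvU : v ∉ Θ.biUnion id) : #(bnbr H B v) ≤ 2 := by
  by_contra! h
  obtain ⟨x, hx, hxU⟩ := hΘ.maximal _ (isCluster_singleton hv h)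
  rw [mem_singleton] at hx
  exact hvU (hx ▸ hxU)

theorem IsPacking.card_union_le (hΘ : IsPacking H B Θ) {v w : W} (hv : v ∉ B) (hw : w ∉ B)
    (hvU : v ∉ Θ.biUnion id) (hwU : w ∉ Θ.biUnion id) (hvw : H.Adj v w) :
    #(bnbr H B v ∪ bnbr H B w) ≤ 2 := by
  by_contra! h
  obtain ⟨x, hx, hxU⟩ := hΘ.maximal _ (isCluster_pair hv hw hvw (hΘ.card_bnbr_le hv hvU)
    (hΘ.card_bnbr_le hw hwU) h)
  simp only [mem_insert, mem_singleton] at hx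
  rcases hx with rfl | rfl
  · exact hvU hxU
  · exact hwU hxU

theorem IsPacking.bnbr_eq_of_common (hΘ : IsPacking H B Θ) {v w w' : W} (hv : v ∉ B) (hw : w ∉ B)
    (hw' : w' ∉ B) (hvU : v ∉ Θ.biUnion id) (hwU : w ∉ Θ.biUnion id)
    (hwU' : w' ∉ Θ.biUnion id) (hvw : H.Adj v w) (hvw' : H.Adj v w') (h2 : #(bnbr H B w) = 2)
    (h2' : #(bnbr H B w') = 2) : bnbr H B w = bnbr H B w' := by
  have h3 : #(bnbr H B w ∪ bnbr H B w') ≤ 2 := by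
    by_contra! h
    obtain ⟨x, hx, hxU⟩ := hΘ.maximal _ (isCluster_triple hw hv hw' hvw hvw' h2.le
      (hΘ.card_bnbr_le hv hvU) h2'.le h)
    simp only [mem_insert, mem_singleton] at hx
    rcases hx with rfl | rfl | rfl
    · exact hvU hxU
    · exact hwU hxU
    · exact hwU' hxU
  exact (eq_of_subset_of_card_le (subset_union_left (s₂ := bnbr H B w')) (by omega)).trans
    (eq_of_subset_of_card_le (subset_union_right (s₁ := bnbr H B w)) (by omega)).symm

theorem IsAttachment.notMem_packing (hA : IsAttachment H B A z) (hΘ : IsPacking H B Θ) {w : W}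
    (hw : w ∈ A) (hz : z w ∉ Θ.biUnion id) : w ∉ Θ.biUnion id := by
  intro hwU
  obtain ⟨R, hR, hwR⟩ := mem_biUnion.1 hwU
  have hRU : ∀ y ∈ R, y ≠ z w := fun y hy h => hz (h ▸ mem_biUnion.2 ⟨R, hR, hy⟩)
  have hc := hΘ.cluster R hR
  obtain ⟨x, hx, hstar⟩ := hc.star
  have h2 := hA.card_bnbr w hw
  have hreg : ∀ y ∈ R, H.Adj w y → IsReg H B y ∧ bnbr H B y = bnbr H B w := by
    intro y hy hwy
    have hq : y ∈ qnbr H B w := mem_qnbr.2 ⟨hwy, hc.disj y hy⟩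
    have hr : IsReg H B y := by
      by_contra hr
      exact hRU y hy (hA.eq_target w hw y hq hr)
    exact ⟨hr, hr.bnbr_eq (qnbr_symm (hA.notMem w hw) hq) h2.le⟩
  have hle : ∀ y ∈ R, #(bnbr H B y) ≤ 2 := by
    intro y hy
    by_contra! h
    rw [← hc.eq_of_three_le y hy h w hwR] at h
    omega
  have hall : ∀ y ∈ R, bnbr H B y = bnbr H B w := by
    rcases hstar w hwR with rfl | hxw
    · intro y hy
      rcases hstar y hy with rfl | h
      · rfl
      · exact (hreg y hy h).2
    · obtain ⟨hr, hxe⟩ := hreg x hx hxw.symm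
      intro y hy
      rcases hstar y hy with rfl | h
      · exact hxe
      · rw [← hxe]
        exact (hr.bnbr_eq (mem_qnbr.2 ⟨h, hc.disj y hy⟩) (hle y hy)).symm
  have h3 : R.biUnion (bnbr H B) ⊆ bnbr H B w := biUnion_subset.2 fun y hy => (hall y hy).subset
  have := (hc.three_le.trans (card_le_card h3))
  omega

variable (H B Θ) in
/-- The charge of a vertex. -/
noncomputable def charge (v : W) : ℕ :=
  if v ∈ B ∨ v ∈ Θ.biUnion id ∨ IsReg H B v then 0 else
    if #(bnbr H B v) = 0 then #(qnbr H B v) - 6 else #(qnbr H B v) - 4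

theorem IsAttachment.charge_le (hA : IsAttachment H B A z) (hΘ : IsPacking H B Θ)
    (hH : GridMinor H) (h0 : ∀ v, v ∉ B → #(bnbr H B v) = 0 → 6 ≤ #(qnbr H B v))
    (h1 : ∀ v, v ∉ B → #(bnbr H B v) = 1 → 5 ≤ #(qnbr H B v)) {v : W} (hv : v ∉ B)
    (hvr : ¬ IsReg H B v) (hvA : v ∉ A) :
    6 + charge H B Θ v ≤ #(qnbr' H B A v) + 2 * #(bnbr' H B A z v) := by
  set s : Finset W := {w ∈ A | z w = v} with hs
  have hsA : ∀ w ∈ s, w ∈ A := fun w hw => (mem_filter.1 hw).1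
  have hsz : ∀ w ∈ s, z w = v := fun w hw => (mem_filter.1 hw).2
  have hsq : ∀ w ∈ s, w ∈ qnbr H B v := fun w hw => by
    have := hA.target_mem w (hsA w hw)
    rw [hsz w hw] at this
    exact qnbr_symm (hA.notMem w (hsA w hw)) this
  have hcard : #(qnbr' H B A v) + #s = #{x ∈ qnbr H B v | ¬ IsReg H B x} := by
    have : qnbr' H B A v = ({x ∈ qnbr H B v | ¬ IsReg H B x} : Finset W) \ s := by
      ext x
      simp only [qnbr', mem_sdiff, mem_filter, s, not_and]
      constructor
      · rintro ⟨a, b, c⟩; exact ⟨⟨a, b⟩, fun h => (c h).elim⟩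
      · rintro ⟨⟨a, b⟩, c⟩
        exact ⟨a, b, fun h => c h (hA.eq_target x h v (qnbr_symm hv a) hvr).symm⟩
    rw [this, card_sdiff_add_card_eq_card]
    exact fun w hw => mem_filter.2 ⟨hsq w hw, hA.notReg w (hsA w hw)⟩
  have hsplit := card_filter_add_card_filter_not (s := qnbr H B v) (fun x => IsReg H B x)
  have hb2 : ∀ w ∈ s, bnbr H B w ⊆ bnbr' H B A z v := fun w hw x hx =>
    mem_union_right _ (mem_biUnion.2 ⟨w, hw, hx⟩)
  have hbv : bnbr H B v ⊆ bnbr' H B A z v := subset_union_left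
  have hbv' := card_le_card hbv
  have hs1 : s.Nonempty → 2 ≤ #(bnbr' H B A z v) ∧ #(bnbr H B v) < #(bnbr' H B A z v) := by
    rintro ⟨w, hw⟩
    refine ⟨(hA.card_bnbr w (hsA w hw)).ge.trans (card_le_card (hb2 w hw)),
      card_lt_card (hbv.ssubset_of_ne fun h => ?_)⟩
    have := hA.not_subset (hsA w hw)
    rw [hsz w hw, h] at this
    exact this (hb2 w hw)
  have hs2 : #(bnbr' H B A z v) ≤ 2 → #s ≤ 2 := by
    intro hle
    by_cases hne : s.Nonempty
    · refine hH.card_le_two_of_bnbr hv (hs1 hne).1 s fun w hw => ⟨(mem_qnbr.1 (hsq w hw)).1, ?_⟩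
      rw [eq_of_subset_of_card_le (hb2 w hw) (by rw [hA.card_bnbr w (hsA w hw)]; exact hle)]
    · simp [not_nonempty_iff_eq_empty.1 hne]
  have hs0 : ¬ s.Nonempty → #s = 0 := fun h => by simp [not_nonempty_iff_eq_empty.1 h]
  have hbig : v ∉ Θ.biUnion id → s.Nonempty →
      #(bnbr H B v) ≤ 1 ∧ #(bnbr' H B A z v) ≤ 2 := by
    rintro hvU ⟨w, hw⟩
    have hwU : ∀ w ∈ s, w ∉ Θ.biUnion id := fun w hw =>
      hA.notMem_packing hΘ (hsA w hw) (by rwa [hsz w hw])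
    have hvw : ∀ w ∈ s, bnbr H B v ⊆ bnbr H B w := fun w hw => by
      have h := hΘ.card_union_le hv (hA.notMem w (hsA w hw)) hvU (hwU w hw)
        (mem_qnbr.1 (hsq w hw)).1
      rw [eq_of_subset_of_card_le (subset_union_right (s₁ := bnbr H B v) (s₂ := bnbr H B w))
        (by rw [hA.card_bnbr w (hsA w hw)]; exact h)]
      exact subset_union_left
    have h2 := hA.card_bnbr w (hsA w hw)
    constructor
    · by_contra! h
      have := hA.not_subset (hsA w hw)
      rw [hsz w hw, eq_of_subset_of_card_le (hvw w hw) (by omega)] at this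
      exact this Subset.rfl
    · rw [← h2]
      refine card_le_card (union_subset (hvw w hw) (biUnion_subset.2 fun w' hw' => ?_))
      exact (hΘ.bnbr_eq_of_common hv (hA.notMem w' (hsA w' hw')) (hA.notMem w (hsA w hw)) hvU
        (hwU w' hw') (hwU w hw) (mem_qnbr.1 (hsq w' hw')).1 (mem_qnbr.1 (hsq w hw)).1
        (hA.card_bnbr w' (hsA w' hw')) h2).subset
  have hvB := h0 v hv
  have hvB1 := h1 v hv
  have hreg : #(bnbr H B v) ≤ 1 → #{x ∈ qnbr H B v | IsReg H B x} = 0 := fun h => by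
    rw [filter_isReg_eq_empty hv h, card_empty]
  have hreg2 := card_filter_isReg_le hH hv
  have htwo : #(bnbr H B v) = 2 → ¬ s.Nonempty → 2 ≤ #{x ∈ qnbr H B v | ¬ IsReg H B x} :=
    fun h hne => hA.two_le v hv h hvr hvA fun w hw hwz => hne ⟨w, mem_filter.2 ⟨hw, hwz⟩⟩
  by_cases hvU : v ∈ Θ.biUnion id
  · have : charge H B Θ v = 0 := if_pos (Or.inr (Or.inl hvU))
    rw [this]
    by_cases hne : s.Nonempty
    · have := hs1 hne
      omega
    · have := hs0 hne
      have := htwo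
      simp only [hne, not_false_eq_true, forall_const] at this
      omega
  · have hle := hΘ.card_bnbr_le hv hvU
    have hch : charge H B Θ v =
        if #(bnbr H B v) = 0 then #(qnbr H B v) - 6 else #(qnbr H B v) - 4 :=
      if_neg (not_or.2 ⟨hv, not_or.2 ⟨hvU, hvr⟩⟩)
    rw [hch]
    clear hch
    have hcases : #(bnbr H B v) = 0 ∨ #(bnbr H B v) = 1 ∨ #(bnbr H B v) = 2 := by omega
    by_cases hne : s.Nonempty
    · obtain ⟨h3, h4⟩ := hs1 hne
      obtain ⟨h5, h6⟩ := hbig hvU hne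
      have h7 := hs2 h6
      have h8 := hreg h5
      clear hs1 hs2 hs0 hbig hreg hreg2 htwo h0 h1
      rcases hcases with h | h | h
      · rw [if_pos h]; have := hvB h; omega
      · rw [if_neg (by omega)]; have := hvB1 h; omega
      · omega
    · have h3 := hs0 hne
      have h4 := fun h => htwo h hne
      clear hs1 hs2 hs0 hbig htwo h0 h1
      rcases hcases with h | h | h
      · rw [if_pos h]; have := hvB h; have := hreg (by omega); omega
      · rw [if_neg (by omega)]; have := hvB1 h; have := hreg (by omega); omega
      · rw [if_neg (by omega)]; have := hreg2 h; have := h4 h; omega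

theorem IsPacking.sum_charge_le (hΘ : IsPacking H B Θ) (hH : GridMinor H) (hB : B.Nonempty)
    (h0 : ∀ v, v ∉ B → #(bnbr H B v) = 0 → 6 ≤ #(qnbr H B v))
    (h1 : ∀ v, v ∉ B → #(bnbr H B v) = 1 → 5 ≤ #(qnbr H B v)) :
    ∑ v, charge H B Θ v + ∑ v ∈ B, #(bnbr H B v) ≤ 6 * #B := by
  obtain ⟨A, z, hA⟩ := exists_isAttachment H B
  have hlt := hA.sum_lt hH hB
  have h2 : ∑ v with v ∉ B ∧ ¬ IsReg H B v ∧ v ∉ A, (6 + charge H B Θ v) ≤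
      ∑ v with v ∉ B ∧ ¬ IsReg H B v ∧ v ∉ A, (#(qnbr' H B A v) + 2 * #(bnbr' H B A z v)) :=
    sum_le_sum fun v hv => by
      obtain ⟨h3, h4, h5⟩ := (mem_filter.1 hv).2
      exact hA.charge_le hΘ hH h0 h1 h3 h4 h5
  rw [sum_add_distrib, sum_const, smul_eq_mul] at h2
  have h3 : ∑ v with v ∉ B ∧ ¬ IsReg H B v ∧ v ∉ A, charge H B Θ v = ∑ v, charge H B Θ v := by
    refine sum_subset (subset_univ _) fun v _ hv => ?_
    rw [charge]
    by_cases h4 : v ∈ B ∨ v ∈ Θ.biUnion id ∨ IsReg H B v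
    · rw [if_pos h4]
    · have hvA : v ∈ A := by
        by_contra h
        exact hv (mem_filter.2 ⟨mem_univ _, by tauto⟩)
      have := hA.card_bnbr v hvA
      have := hA.card_qnbr_le hH hvA
      rw [if_neg h4, if_neg (by omega)]
      omega
  omega

end Charge

end PlanarFrugal

namespace PlanarFrugal

open Finset

open scoped Classical

section Good

variable {W : Type*} [Fintype W] {H : SimpleGraph W} {B : Finset W}

variable (H B) in
/-- A set of vertices with two neighbours in `B` and restricted further neighbourhood. -/
structure IsGood (G : Finset W) : Prop where
  notMem : ∀ w ∈ G, w ∉ B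
  card_bnbr : ∀ w ∈ G, #(bnbr H B w) = 2
  card_qnbr : ∀ w ∈ G, #(qnbr H B w) ≤ 5
  card_nbr : ∀ w ∈ G, ∀ x ∈ qnbr H B w, #(nbr H x) ≤ 11
  eq_of_adj : ∀ w ∈ G, ∀ w' ∈ G, H.Adj w w' → bnbr H B w = bnbr H B w'
  eq_of_common : ∀ w ∈ G, ∀ w' ∈ G, ∀ y, y ∉ B → H.Adj y w → H.Adj y w' →
    bnbr H B w = bnbr H B w'
  card_inter : ∀ y, y ∉ B → #(nbr H y ∩ G) ≤ 2

theorem sum_card_sdiff_eq {G : Finset W} (hG : ∀ w ∈ G, w ∉ B) :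
    ∑ v ∈ B, #(nbr H v \ G) =
      ∑ v ∈ B, #(bnbr H B v) + ∑ w with w ∉ B ∧ w ∉ G, #(bnbr H B w) := by
  have h : ∑ w with w ∉ B ∧ w ∉ G, #(bnbr H B w) =
      ∑ v ∈ B, #{w ∈ ({w | w ∉ B ∧ w ∉ G} : Finset W) | H.Adj w v} := by
    refine Eq.trans ?_ (sum_card_bipartiteAbove_eq_sum_card_bipartiteBelow
      (s := ({w | w ∉ B ∧ w ∉ G} : Finset W)) (t := B) (fun w v => H.Adj w v))
    refine sum_congr rfl fun w _ => congrArg card ?_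
    ext v
    simp only [mem_bnbr, bipartiteAbove, mem_filter]
    tauto
  rw [h, ← sum_add_distrib]
  refine sum_congr rfl fun v _ => ?_
  rw [← card_union_of_disjoint]
  · congr 1
    ext w
    simp only [mem_sdiff, mem_union, mem_bnbr, mem_filter, mem_nbr, mem_univ, true_and,
      H.adj_comm w v]
    have := hG w
    tauto
  · refine Finset.disjoint_left.2 fun w h1 h2 => ?_
    exact (mem_filter.1 (mem_filter.1 h2).1).2.1 (mem_bnbr.1 h1).2

theorem exists_isGood (hH : GridMinor H) (hB : B.Nonempty)
    (h0 : ∀ v, v ∉ B → #(bnbr H B v) = 0 → 6 ≤ #(qnbr H B v))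
    (h1 : ∀ v, v ∉ B → #(bnbr H B v) = 1 → 5 ≤ #(qnbr H B v)) :
    ∃ G, IsGood H B G ∧ ∑ v ∈ B, #(nbr H v \ G) ≤ 30 * #B := by
  obtain ⟨Θ, hΘ⟩ := exists_isPacking H B
  set U := Θ.biUnion id with hU
  let Q : Finset W := {w | w ∉ B ∧ #(bnbr H B w) = 2 ∧ w ∉ U ∧ ∀ x ∈ U, ¬ H.Adj w x}
  have memQ : ∀ {w}, w ∈ Q ↔ w ∉ B ∧ #(bnbr H B w) = 2 ∧ w ∉ U ∧ ∀ x ∈ U, ¬ H.Adj w x :=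
    fun {w} => by simp [Q]
  let G : Finset W := {w ∈ Q | #(qnbr H B w) ≤ 5 ∧ ∀ x ∈ qnbr H B w, #(nbr H x) ≤ 11}
  have hGQ : G ⊆ Q := filter_subset _ _
  have hcommon : ∀ w ∈ Q, ∀ w' ∈ Q, ∀ y, y ∉ B → H.Adj y w → H.Adj y w' →
      bnbr H B w = bnbr H B w' := by
    intro w hw w' hw' y hy hyw hyw'
    obtain ⟨a1, a2, a3, a4⟩ := memQ.1 hw
    obtain ⟨b1, b2, b3, b4⟩ := memQ.1 hw'
    exact hΘ.bnbr_eq_of_common hy a1 b1 (fun h => a4 y h hyw.symm) a3 b3 hyw hyw' a2 b2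
  have hinter : ∀ y, y ∉ B → #(nbr H y ∩ Q) ≤ 2 := by
    intro y hy
    rcases (nbr H y ∩ Q).eq_empty_or_nonempty with h | ⟨w, hw⟩
    · simp [h]
    · obtain ⟨hw1, hw2⟩ := mem_inter.1 hw
      refine hH.card_le_two_of_bnbr hy (memQ.1 hw2).2.1.ge _ fun w' hw' => ?_
      obtain ⟨h3, h4⟩ := mem_inter.1 hw'
      exact ⟨mem_nbr.1 h3, (hcommon w hw2 w' h4 y hy (mem_nbr.1 hw1) (mem_nbr.1 h3)).subset⟩
  have hgood : IsGood H B G := by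
    refine ⟨fun w hw => (memQ.1 (hGQ hw)).1, fun w hw => (memQ.1 (hGQ hw)).2.1,
      fun w hw => (mem_filter.1 hw).2.1, fun w hw => (mem_filter.1 hw).2.2, ?_,
      fun w hw w' hw' => hcommon w (hGQ hw) w' (hGQ hw'),
      fun y hy => (card_le_card (inter_subset_inter_left hGQ)).trans (hinter y hy)⟩
    intro w hw w' hw' hww
    obtain ⟨a1, a2, a3, a4⟩ := memQ.1 (hGQ hw)
    obtain ⟨b1, b2, b3, b4⟩ := memQ.1 (hGQ hw')
    have := hΘ.card_union_le a1 b1 a3 b3 hww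
    exact (eq_of_subset_of_card_le (subset_union_left (s₂ := bnbr H B w')) (by omega)).trans
      (eq_of_subset_of_card_le (subset_union_right (s₁ := bnbr H B w)) (by omega)).symm
  refine ⟨G, hgood, ?_⟩
  rw [sum_card_sdiff_eq hgood.notMem]
  have hch := hΘ.sum_charge_le hH hB h0 h1
  have hcl := hΘ.sum_bnbr_le hH
  rw [← hU] at hcl
  let F : Finset W := {w | w ∉ B ∧ #(bnbr H B w) = 2 ∧ w ∉ U ∧ ∃ x ∈ U, H.Adj w x}
  have hF : #F ≤ 6 * #B := hΘ.card_attached_le hH F fun w hw => by simpa [F, ← hU] using hw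
  let X : Finset W := {x | x ∉ B ∧ x ∉ U ∧ 12 ≤ #(nbr H x)}
  let Z : Finset W := {w ∈ Q | ∃ x ∈ qnbr H B w, 12 ≤ #(nbr H x)}
  have hZ : #Z ≤ #X * 2 := by
    have hsub : Z ⊆ X.biUnion fun x => nbr H x ∩ Q := by
      intro w hw
      obtain ⟨hwQ, x, hx, hx12⟩ := mem_filter.1 hw
      obtain ⟨hwx, hxB⟩ := mem_qnbr.1 hx
      refine mem_biUnion.2 ⟨x, mem_filter.2 ⟨mem_univ _, hxB, fun h =>
        (memQ.1 hwQ).2.2.2 x h hwx, hx12⟩, mem_inter.2 ⟨mem_nbr.2 hwx.symm, hwQ⟩⟩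
    exact (card_le_card hsub).trans (card_biUnion_le_card_mul _ _ _ fun x hx =>
      hinter x (mem_filter.1 hx).2.1)
  have hpt : ∀ w, (if w ∉ B ∧ w ∉ G then #(bnbr H B w) else 0) + (if w ∈ X then 4 else 0) ≤
      (if w ∈ U then #(bnbr H B w) else 0) + (if w ∈ F then 2 else 0) +
        (if w ∈ Z then 2 else 0) + charge H B Θ w := by
    intro w
    by_cases hwB : w ∈ B
    · have hX : w ∉ X := fun h => (mem_filter.1 h).2.1 hwB
      simp [hwB, hX]
    by_cases hwU : w ∈ U
    · have hX : w ∉ X := fun h => (mem_filter.1 h).2.2.1 hwU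
      simp only [hX, hwU, if_true, if_false]
      split_ifs <;> omega
    have hle := hΘ.card_bnbr_le hwB hwU
    have hd := card_nbr_eq (H := H) (B := B) w
    have hXd : (if w ∈ X then 4 else 0) = if 12 ≤ #(nbr H w) then 4 else 0 :=
      if_congr (by simp [X, hwB, hwU]) rfl rfl
    rw [hXd, if_neg hwU]
    have hch : charge H B Θ w = if IsReg H B w then 0 else
        if #(bnbr H B w) = 0 then #(qnbr H B w) - 6 else #(qnbr H B w) - 4 := by
      rw [charge]
      exact if_congr ⟨fun h => (h.resolve_left hwB).resolve_left hwU, fun h => Or.inr (Or.inr h)⟩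
        rfl rfl
    have hcases : #(bnbr H B w) = 0 ∨ #(bnbr H B w) = 1 ∨ #(bnbr H B w) = 2 := by omega
    rcases hcases with h | h | h
    · have hr : ¬ IsReg H B w := fun hr => by have := hr.2.1; omega
      rw [hch, if_neg hr, if_pos h]
      have := h0 w hwB h
      split_ifs <;> omega
    · have hr : ¬ IsReg H B w := fun hr => by have := hr.2.1; omega
      rw [hch, if_neg hr, if_neg (show ¬ #(bnbr H B w) = 0 by omega)]
      have := h1 w hwB h
      split_ifs <;> omega
    · by_cases hwF : w ∈ F
      · rw [if_pos hwF, hch, if_neg (show ¬ #(bnbr H B w) = 0 by omega)]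
        by_cases hr : IsReg H B w
        · have := hr.card_qnbr_le hH
          rw [if_neg (show ¬ 12 ≤ #(nbr H w) by omega)]
          split_ifs <;> omega
        · rw [if_neg hr]
          split_ifs <;> omega
      · have hwQ : w ∈ Q := memQ.2 ⟨hwB, h, hwU, fun x hx hwx =>
          hwF (mem_filter.2 ⟨mem_univ _, hwB, h, hwU, x, hx, hwx⟩)⟩
        rw [if_neg hwF, hch, if_neg (show ¬ #(bnbr H B w) = 0 by omega)]
        by_cases hwZ : w ∈ Z
        · rw [if_pos hwZ]
          by_cases hr : IsReg H B w
          · have := hr.card_qnbr_le hH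
            rw [if_neg (show ¬ 12 ≤ #(nbr H w) by omega)]
            split_ifs <;> omega
          · rw [if_neg hr]
            split_ifs <;> omega
        · have hZ11 : ∀ x ∈ qnbr H B w, #(nbr H x) ≤ 11 := by
            intro x hx
            by_contra! h12
            exact hwZ (mem_filter.2 ⟨hwQ, x, hx, h12⟩)
          by_cases hwG : w ∈ G
          · have h5 := hgood.card_qnbr w hwG
            rw [if_neg (fun h => h.2 hwG), if_neg (show ¬ 12 ≤ #(nbr H w) by omega)]
            omega
          · have h6 : 6 ≤ #(qnbr H B w) := by
              by_contra! h6
              exact hwG (mem_filter.2 ⟨hwQ, by omega, hZ11⟩)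
            have hr : ¬ IsReg H B w := fun hr => by have := hr.card_qnbr_le hH; omega
            rw [if_neg hr]
            split_ifs <;> omega
  have hsum := sum_le_sum fun w (_ : w ∈ univ) => hpt w
  simp only [sum_add_distrib, ← sum_filter, sum_const, smul_eq_mul, filter_mem_eq_inter,
    univ_inter] at hsum
  omega

end Good

end PlanarFrugal

namespace PlanarFrugal

open Finset

open scoped Classical

section Blocks

variable {X : Type*}

theorem mem_of_reachable {M : SimpleGraph X} {K : Set X} (hK : ∀ a ∈ K, ∀ b, M.Adj a b → b ∈ K)
    {e x : X} (he : e ∈ K) (h : M.Reachable e x) : x ∈ K := by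
  obtain ⟨p⟩ := h
  induction p with
  | nil => exact he
  | cons h _ ih => exact ih (hK _ he _ h)

theorem exists_maximal_matching [Finite X] (Γ : SimpleGraph X) :
    ∃ M ≤ Γ, (∀ a b c, M.Adj a b → M.Adj a c → b = c) ∧
      ∀ a b, Γ.Adj a b → (∃ c, M.Adj a c) ∨ ∃ c, M.Adj b c := by
  obtain ⟨M, hM⟩ := (Set.toFinite {M : SimpleGraph X | M ≤ Γ ∧
    ∀ a b c, M.Adj a b → M.Adj a c → b = c}).exists_maximal ⟨⊥, bot_le, by simp⟩
  refine ⟨M, hM.prop.1, hM.prop.2, fun a b hab => ?_⟩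
  by_contra! hc
  have hle : M ⊔ SimpleGraph.edge a b ≤ M := by
    refine hM.le_of_ge ⟨sup_le hM.prop.1 ?_, ?_⟩ le_sup_left
    · intro x y h
      rw [SimpleGraph.edge_adj] at h
      rcases h.1 with ⟨rfl, rfl⟩ | ⟨rfl, rfl⟩
      · exact hab
      · exact hab.symm
    · intro x y z hy hz
      simp only [SimpleGraph.sup_adj, SimpleGraph.edge_adj] at hy hz
      rcases hy with hy | ⟨⟨rfl, rfl⟩ | ⟨rfl, rfl⟩, hne⟩ <;>
      rcases hz with hz | ⟨⟨h1, h2⟩ | ⟨h1, h2⟩, hne'⟩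
      · exact hM.prop.2 _ _ _ hy hz
      · subst h1; exact (hc.1 _ hy).elim
      · subst h1; exact (hc.2 _ hy).elim
      · exact (hc.1 _ hz).elim
      · exact h2.symm
      · exact (hne h1).elim
      · exact (hc.2 _ hz).elim
      · exact (hne h1).elim
      · exact h2.symm
  exact hc.1 b (hle (Or.inr (by simp [SimpleGraph.edge_adj, hab.ne])))

/-- A representative of the component of a vertex. -/
noncomputable def compRep (M : SimpleGraph X) (e : X) : X := (M.connectedComponentMk e).out

theorem compRep_eq_iff {M : SimpleGraph X} {e e' : X} :
    compRep M e = compRep M e' ↔ M.Reachable e e' := by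
  refine ⟨fun h => ?_, fun h => ?_⟩
  · rw [← SimpleGraph.ConnectedComponent.eq]
    have := congrArg M.connectedComponentMk h
    simpa [compRep, SimpleGraph.connectedComponentMk, Quot.out_eq] using this
  · rw [compRep, compRep, SimpleGraph.ConnectedComponent.eq.2 h]

/-- A graph of maximum degree two is covered by two partitions into connected pieces, of sizes
at most two and three respectively. -/
theorem exists_blocks [Fintype X] (Γ : SimpleGraph X) (hΓ : ∀ e, #(nbr Γ e) ≤ 2) :
    ∃ f g : X → X, (∀ e e', Γ.Adj e e' → f e = f e' ∨ g e = g e') ∧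
      (∀ e e', f e = f e' → Γ.Reachable e e') ∧ (∀ e e', g e = g e' → Γ.Reachable e e') ∧
      (∀ e, #{e' | e' ≠ e ∧ f e' = f e} ≤ 1) ∧ ∀ e, #{e' | e' ≠ e ∧ g e' = g e} ≤ 2 := by
  obtain ⟨M, hle, huniq, hmax⟩ := exists_maximal_matching Γ
  have hbound : ∀ (L : SimpleGraph X) (e : X) (K : Finset X), e ∈ K →
      (∀ a ∈ K, ∀ b, L.Adj a b → b ∈ K) →
      #{e' | e' ≠ e ∧ compRep L e' = compRep L e} + 1 ≤ #K := by
    intro L e K he hK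
    rw [← card_erase_add_one he]
    refine Nat.add_le_add_right (card_le_card fun x hx => ?_) 1
    simp only [mem_filter, mem_univ, true_and] at hx
    refine mem_erase.2 ⟨hx.1, ?_⟩
    exact mem_coe.1 (mem_of_reachable (M := L) (K := ↑K) hK he (compRep_eq_iff.1 hx.2.symm))
  have hcov : ∀ e, (∃ c, M.Adj e c) → #(nbr (Γ \ M) e) ≤ 1 := by
    rintro e ⟨c, hc⟩
    have : nbr (Γ \ M) e ⊆ (nbr Γ e).erase c := by
      intro x hx
      simp only [mem_nbr, SimpleGraph.sdiff_adj, mem_erase] at hx ⊢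
      exact ⟨fun h : x = c => hx.2 (h ▸ hc), hx.1⟩
    have h1 := card_le_card this
    have h2 := card_erase_add_one (s := nbr Γ e) (a := c) (by simpa using hle hc)
    have := hΓ e
    omega
  have huncov : ∀ e, (¬ ∃ c, M.Adj e c) →
      ∀ a ∈ insert e (nbr (Γ \ M) e), ∀ b, (Γ \ M).Adj a b → b ∈ insert e (nbr (Γ \ M) e) := by
    intro e he a ha b hab
    rcases mem_insert.1 ha with rfl | ha
    · exact mem_insert_of_mem (by simpa using hab)
    · rw [mem_nbr] at ha
      have hc := (hmax e a ha.1).resolve_left he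
      have := card_le_one.1 (hcov a hc) e (by simpa using ha.symm) b (by simpa using hab)
      exact this ▸ mem_insert_self _ _
  have hcard : ∀ e, #(insert e (nbr (Γ \ M) e)) ≤ 3 := by
    intro e
    have h1 := card_insert_le e (nbr (Γ \ M) e)
    have h2 : nbr (Γ \ M) e ⊆ nbr Γ e := fun x hx => by
      simp only [mem_nbr, SimpleGraph.sdiff_adj] at hx ⊢
      exact hx.1
    have := card_le_card h2
    have := hΓ e
    omega
  refine ⟨compRep M, compRep (Γ \ M), fun e e' h => ?_, fun e e' h => ?_, fun e e' h => ?_,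
    fun e => ?_, fun e => ?_⟩
  · by_cases hM : M.Adj e e'
    · exact Or.inl (compRep_eq_iff.2 hM.reachable)
    · exact Or.inr (compRep_eq_iff.2 (SimpleGraph.Adj.reachable ⟨h, hM⟩))
  · exact (compRep_eq_iff.1 h).mono hle
  · exact (compRep_eq_iff.1 h).mono sdiff_le
  · have h1 : #(nbr M e) ≤ 1 := card_le_one.2 fun a ha b hb =>
      huniq e a b (by simpa using ha) (by simpa using hb)
    have := hbound M e (insert e (nbr M e)) (mem_insert_self _ _) ?_
    · have := card_insert_le e (nbr M e)
      omega
    intro a ha b hab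
    rcases mem_insert.1 ha with rfl | ha
    · exact mem_insert_of_mem (by simpa using hab)
    · rw [mem_nbr] at ha
      exact huniq a e b ha.symm hab ▸ mem_insert_self _ _
  · by_cases he : ∃ c, M.Adj e c
    · by_cases hf : ∃ f, (Γ \ M).Adj e f ∧ ¬ ∃ c, M.Adj f c
      · obtain ⟨f, hef, hf⟩ := hf
        have := hbound (Γ \ M) e (insert f (nbr (Γ \ M) f))
          (mem_insert_of_mem (by simpa using hef.symm)) (huncov f hf)
        have := hcard f
        omega
      · push Not at hf
        have := hbound (Γ \ M) e (insert e (nbr (Γ \ M) e)) (mem_insert_self _ _) ?_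
        · have := hcard e
          omega
        intro a ha b hab
        rcases mem_insert.1 ha with rfl | ha
        · exact mem_insert_of_mem (by simpa using hab)
        · rw [mem_nbr] at ha
          have := card_le_one.1 (hcov a (hf a ha)) e (by simpa using ha.symm) b (by simpa using hab)
          exact this ▸ mem_insert_self _ _
    · have := hbound (Γ \ M) e (insert e (nbr (Γ \ M) e)) (mem_insert_self _ _) (huncov e he)
      have := hcard e
      omega

end Blocks

end PlanarFrugal

namespace PlanarFrugal

open Finset

open scoped Classical

section Dense

variable {W : Type*} [Fintype W] {H : SimpleGraph W} {B G : Finset W}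

/-- A bipartite orientation of at least two thirds of a good set. -/
theorem IsGood.exists_cut (hG : IsGood H B G) (hH : GridMinor H) :
    ∃ (C : Finset W) (S : Set W) (σ τ : W → W), C ⊆ G ∧ 2 * #G ≤ 3 * #C ∧
      ∀ w ∈ C, bnbr H B w = {σ w, τ w} ∧ σ w ∈ S ∧ τ w ∉ S := by
  have h2 : ∀ w : W, ∃ x y, w ∈ G → x ≠ y ∧ bnbr H B w = {x, y} := fun w => by
    by_cases hw : w ∈ G
    · obtain ⟨x, y, h⟩ := card_eq_two.1 (hG.card_bnbr w hw)
      exact ⟨x, y, fun _ => h⟩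
    · exact ⟨w, w, fun h => (hw h).elim⟩
  choose α β hαβ using h2
  have hα : ∀ w ∈ G, H.Adj w (α w) ∧ α w ∈ B := fun w hw => by
    rw [← mem_bnbr, (hαβ w hw).2]
    simp
  have hβ : ∀ w ∈ G, H.Adj w (β w) ∧ β w ∈ B := fun w hw => by
    rw [← mem_bnbr, (hαβ w hw).2]
    simp
  let K : SimpleGraph {v // v ∈ B} :=
    { Adj := fun u v => u ≠ v ∧ ∃ w ∈ G, bnbr H B w = {u.1, v.1}
      symm := ⟨fun u v h => ⟨h.1.symm, by
        obtain ⟨w, hw, h⟩ := h.2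
        exact ⟨w, hw, by rw [h, pair_comm]⟩⟩⟩
      loopless := ⟨fun u h => h.1 rfl⟩ }
  let f : W → Option {v // v ∈ B} := fun y =>
    if h : y ∈ B then some ⟨y, h⟩ else if h : y ∈ G then some ⟨α y, (hα y h).2⟩ else none
  have hfB : ∀ i : {v // v ∈ B}, f i.1 = some i := fun i => by simp [f, i.2]
  have hfG : ∀ w (hw : w ∈ G), f w = some ⟨α w, (hα w hw).2⟩ := fun w hw => by
    simp [f, hG.notMem w hw, hw]
  have hK : GridMinor K := by
    refine GridMinor.of_model hH (f := f) (isModel_of_star (fun i => i.1) hfB ?_ ?_)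
    · intro i y hy
      by_cases hyB : y ∈ B
      · left
        simp only [f, hyB, dif_pos, Option.some.injEq] at hy
        rw [← hy]
      · by_cases hyG : y ∈ G
        · right
          rw [hfG y hyG, Option.some.injEq] at hy
          rw [← hy]
          exact (hα y hyG).1.symm
        · simp [f, hyB, hyG] at hy
    · rintro i j ⟨hij, w, hw, hwij⟩
      have hi : H.Adj w i.1 := (mem_bnbr.1 (hwij ▸ mem_insert_self _ _)).1
      have hj : H.Adj w j.1 :=
        (mem_bnbr.1 (hwij ▸ mem_insert_of_mem (mem_singleton_self _))).1
      have : α w ∈ ({i.1, j.1} : Finset W) := hwij ▸ mem_bnbr.2 (hα w hw)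
      rcases mem_insert.1 this with h | h
      · exact ⟨w, j, hj, by rw [hfG w hw]; exact congrArg some (Subtype.ext h), hfB j⟩
      · exact ⟨i, w, hi.symm, hfB i,
          by rw [hfG w hw]; exact congrArg some (Subtype.ext (mem_singleton.1 h))⟩
  obtain ⟨S, hS⟩ := GridMinor.exists_cut hK (I := {w // w ∈ G})
    (fun w => ⟨α w, (hα w w.2).2⟩) (fun w => ⟨β w, (hβ w w.2).2⟩)
    (fun w => ⟨fun h => (hαβ w w.2).1 (congrArg Subtype.val h), w.1, w.2, (hαβ w w.2).2⟩)
  let S' : Set W := Subtype.val '' S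
  have hS' : ∀ i : {v // v ∈ B}, i.1 ∈ S' ↔ i ∈ S := fun i =>
    ⟨fun ⟨j, hj, h⟩ => Subtype.ext h ▸ hj, fun h => ⟨i, h, rfl⟩⟩
  refine ⟨{w ∈ G | ¬ (α w ∈ S' ↔ β w ∈ S')}, S', fun w => if α w ∈ S' then α w else β w,
    fun w => if α w ∈ S' then β w else α w, filter_subset _ _, ?_, ?_⟩
  · rw [Fintype.card_coe] at hS
    refine hS.trans (Nat.mul_le_mul_left 3 ?_)
    rw [← card_map (Function.Embedding.subtype _)]
    refine card_le_card fun x hx => ?_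
    obtain ⟨w, hw, rfl⟩ := mem_map.1 hx
    simp only [mem_filter, mem_univ, true_and] at hw
    refine mem_filter.2 ⟨w.2, fun h => hw ?_⟩
    rw [← hS', ← hS']
    exact h
  · intro w hw
    obtain ⟨hw, hn⟩ := mem_filter.1 hw
    by_cases h : α w ∈ S'
    · simp only [h, if_true]
      exact ⟨(hαβ w hw).2, trivial, fun h' => hn ⟨fun _ => h', fun _ => h⟩⟩
    · simp only [h, if_false]
      refine ⟨by rw [(hαβ w hw).2, pair_comm], ?_, not_false⟩
      by_contra h'
      exact hn ⟨fun h1 => (h h1).elim, fun h1 => (h' h1).elim⟩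

/-- A nonempty subset of a good set, with a bipartite orientation, which contains all but at most
`g` of the neighbours of each vertex of `B` that it meets. -/
theorem IsGood.exists_dense (hG : IsGood H B G) (hH : GridMinor H) (hB : B.Nonempty) {Δ g : ℕ}
    (hdeg : ∀ v, #(nbr H v) ≤ Δ) (hg : 2 * Δ + 28 ≤ 3 * g) (hB33 : ∀ v ∈ B, 33 ≤ #(nbr H v))
    (hsum : ∑ v ∈ B, #(nbr H v \ G) ≤ 30 * #B) :
    ∃ (X : Finset W) (σ τ : W → W), X ⊆ G ∧ X.Nonempty ∧
      (∀ w ∈ X, bnbr H B w = {σ w, τ w}) ∧ (∀ w ∈ X, ∀ w' ∈ X, σ w ≠ τ w') ∧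
      (∀ w ∈ X, #(nbr H (σ w)) ≤ g + #{w' ∈ X | σ w' = σ w}) ∧
      ∀ w ∈ X, #(nbr H (τ w)) ≤ g + #{w' ∈ X | τ w' = τ w} := by
  obtain ⟨C, S, σ, τ, hCG, hcard, hC⟩ := hG.exists_cut hH
  let P : Finset W → Prop := fun Y =>
    ∑ u ∈ Y, (#(nbr H u) - g - 1) < #{w ∈ C | bnbr H B w ⊆ Y}
  have hPB : P B := by
    have h1 : ∑ v ∈ B, #(nbr H v ∩ G) = 2 * #G := by
      have h2 := sum_card_bipartiteAbove_eq_sum_card_bipartiteBelow (s := B) (t := G) H.Adj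
      have h3 : ∀ v ∈ B, #(nbr H v ∩ G) = #(bipartiteAbove H.Adj G v) := fun v _ => by
        congr 1
        ext x
        simp [bipartiteAbove, and_comm]
      have h4 : ∀ w ∈ G, #(bipartiteBelow H.Adj B w) = 2 := fun w hw => by
        rw [← hG.card_bnbr w hw]
        congr 1
        ext x
        simp [bipartiteBelow, mem_bnbr, and_comm, H.adj_comm]
      rw [sum_congr rfl h3, h2, sum_congr rfl h4]
      simp [mul_comm]
    have h5 : ∑ v ∈ B, #(nbr H v) = ∑ v ∈ B, #(nbr H v ∩ G) + ∑ v ∈ B, #(nbr H v \ G) := by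
      rw [← sum_add_distrib]
      exact sum_congr rfl fun v _ => (card_inter_add_card_sdiff _ _).symm
    have h6 : ∑ u ∈ B, (3 * (#(nbr H u) - g - 1) + 31) ≤ ∑ u ∈ B, #(nbr H u) := by
      refine sum_le_sum fun u hu => ?_
      have := hB33 u hu
      have := hdeg u
      omega
    rw [sum_add_distrib, ← mul_sum, sum_const, smul_eq_mul] at h6
    have h7 : {w ∈ C | bnbr H B w ⊆ B} = C := filter_true_of_mem fun w _ => inter_subset_right
    have := hB.card_pos
    change _ < _
    rw [h7]
    omega
  obtain ⟨Y, hY⟩ := (Set.toFinite {Y : Finset W | P Y}).exists_minimal ⟨B, hPB⟩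
  have hPY : P Y := hY.prop
  have hmin : ∀ u ∈ Y, #(nbr H u) ≤ g + #{w ∈ {w ∈ C | bnbr H B w ⊆ Y} | u ∈ bnbr H B w} := by
    intro u hu
    have hn : ¬ P (Y.erase u) := fun h =>
      notMem_erase u Y (hY.le_of_le h (erase_subset u Y) hu)
    have h1 := add_sum_erase Y (fun u => #(nbr H u) - g - 1) hu
    have h2 := card_filter_add_card_filter_not (s := {w ∈ C | bnbr H B w ⊆ Y})
      (fun w => u ∈ bnbr H B w)
    have h3 : #{w ∈ {w ∈ C | bnbr H B w ⊆ Y} | ¬ u ∈ bnbr H B w} ≤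
        #{w ∈ C | bnbr H B w ⊆ Y.erase u} := by
      refine card_le_card fun w hw => ?_
      simp only [mem_filter] at hw ⊢
      exact ⟨hw.1.1, subset_erase.2 ⟨hw.1.2, hw.2⟩⟩
    simp only [P] at hn hPY
    omega
  have hne : ∀ w ∈ C, ∀ w' ∈ C, σ w ≠ τ w' := fun w hw w' hw' h =>
    (hC w' hw').2.2 (h ▸ (hC w hw).2.1)
  refine ⟨{w ∈ C | bnbr H B w ⊆ Y}, σ, τ, (filter_subset _ _).trans hCG,
    card_pos.1 (Nat.zero_lt_of_lt hPY), fun w hw => (hC w (mem_filter.1 hw).1).1,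
    fun w hw w' hw' => hne w (mem_filter.1 hw).1 w' (mem_filter.1 hw').1, fun w hw => ?_,
    fun w hw => ?_⟩
  · obtain ⟨hwC, hwY⟩ := mem_filter.1 hw
    refine (hmin (σ w) (hwY (by rw [(hC w hwC).1]; simp))).trans
      (Nat.add_le_add_left (card_le_card fun w' hw' => ?_) _)
    obtain ⟨hw', h⟩ := mem_filter.1 hw'
    have hw'C := (mem_filter.1 hw').1
    rw [(hC w' hw'C).1, mem_insert, mem_singleton] at h
    exact mem_filter.2 ⟨hw', (h.resolve_right (hne w hwC w' hw'C)).symm⟩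
  · obtain ⟨hwC, hwY⟩ := mem_filter.1 hw
    refine (hmin (τ w) (hwY (by rw [(hC w hwC).1]; simp))).trans
      (Nat.add_le_add_left (card_le_card fun w' hw' => ?_) _)
    obtain ⟨hw', h⟩ := mem_filter.1 hw'
    have hw'C := (mem_filter.1 hw').1
    rw [(hC w' hw'C).1, mem_insert, mem_singleton] at h
    exact mem_filter.2 ⟨hw', (h.resolve_left (hne w' hw'C w hwC).symm).symm⟩

end Dense

end PlanarFrugal

namespace PlanarFrugal

open Finset

open scoped Classical

section Extension

variable {W : Type*} [Fintype W] {H : SimpleGraph W} {B G X : Finset W} {N k : ℕ}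

variable (H B) in
/-- Two vertices with the same neighbours in `B` that are to receive distinct colours. -/
def Conflict (w w' : W) : Prop :=
  w ≠ w' ∧ bnbr H B w = bnbr H B w' ∧
    (H.Adj w w' ∨ ∃ y, y ∉ B ∧ H.Adj y w ∧ H.Adj y w' ∧ bnbr H B y ≠ bnbr H B w)

theorem Conflict.symm {w w' : W} (h : Conflict H B w w') : Conflict H B w' w :=
  ⟨h.1.symm, h.2.1.symm, h.2.2.imp (fun h => SimpleGraph.Adj.symm h) fun ⟨y, hy, h1, h2, h3⟩ =>
    ⟨y, hy, h2, h1, h.2.1 ▸ h3⟩⟩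

theorem GridMinor.card_conflict_le (hH : GridMinor H) {w : W} (hw : w ∉ B)
    (h2 : #(bnbr H B w) = 2) {S : Finset W} (hS : ∀ w' ∈ S, Conflict H B w w') : #S ≤ 2 := by
  by_contra! h3
  obtain ⟨a, ha, b, hb, c, hc, hab, hac, hbc⟩ := two_lt_card.1 h3
  obtain ⟨u, v, huv, hwuv⟩ := card_eq_two.1 h2
  have hu : u ∈ bnbr H B w := by simp [hwuv]
  have hv : v ∈ bnbr H B w := by simp [hwuv]
  have hS' : ∀ i, ![a, b, c] i ∈ S := by
    intro i
    fin_cases i <;> assumption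
  refine hH.no_K33_star huv (y := w)
    (insert w {y | y ∉ B ∧ H.Adj w y ∧ bnbr H B y ≠ bnbr H B w}) (Set.mem_insert _ _) ?_ ?_ ?_
    (w := ![a, b, c]) ?_ ?_ ?_ ?_ ?_
  · rintro z (rfl | hz)
    · exact Or.inl rfl
    · exact Or.inr hz.2.1
  · rintro (h | h)
    · exact hw (h ▸ (mem_bnbr.1 hu).2)
    · exact h.1 (mem_bnbr.1 hu).2
  · rintro (h | h)
    · exact hw (h ▸ (mem_bnbr.1 hv).2)
    · exact h.1 (mem_bnbr.1 hv).2
  · intro i j hij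
    fin_cases i <;> fin_cases j <;> simp_all
  · rintro i (h | h)
    · exact (hS _ (hS' i)).1 h.symm
    · exact h.2.2 (hS _ (hS' i)).2.1.symm
  · intro i
    exact (mem_bnbr.1 ((hS _ (hS' i)).2.1 ▸ hu)).1
  · intro i
    exact (mem_bnbr.1 ((hS _ (hS' i)).2.1 ▸ hv)).1
  · intro i
    rcases (hS _ (hS' i)).2.2 with h | ⟨y, hy, h1, h4, h5⟩
    · exact ⟨w, Set.mem_insert _ _, h.symm⟩
    · exact ⟨y, Set.mem_insert_of_mem _ ⟨hy, h1.symm, h5⟩, h4.symm⟩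

variable (H B X k) in
/-- The number of coloured neighbours of `y` making a colour unavailable for its neighbour `w`. -/
noncomputable def threshold (y w : W) : ℕ :=
  if 2 ≤ k ∧ 2 ≤ #(nbr H y ∩ X) ∧ bnbr H B y = bnbr H B w then k - 1 else k

variable (H B X k) in
/-- The colours unavailable for `w` because of the colouring `c` outside `X`. -/
noncomputable def forbidden (c : W → Fin N) (w : W) : Finset (Fin N) :=
  (nbr H w \ X).image c ∪ (qnbr H B w).biUnion fun y =>
    {a | threshold H B X k y w ≤ #{u ∈ nbr H y \ X | c u = a}}

theorem mul_card_forbidden_le (hG : IsGood H B G) (hH : GridMinor H) (hX : X ⊆ G)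
    (c : W → Fin N) {w : W} (hw : w ∈ X) :
    k * #(forbidden H B X k c w) ≤ 7 * k + if 2 ≤ k then 66 else 50 := by
  have hwB := hG.notMem w (hX hw)
  have hb := hG.card_bnbr w (hX hw)
  have hq := hG.card_qnbr w (hX hw)
  have h1 : #((nbr H w \ X).image c) ≤ 7 := by
    have := card_image_le (s := nbr H w \ X) (f := c)
    have := card_le_card (sdiff_subset (s := nbr H w) (t := X))
    have := card_nbr_eq (H := H) (B := B) w
    omega
  have h2 : ∀ y ∈ qnbr H B w,
      k * #{a | threshold H B X k y w ≤ #{u ∈ nbr H y \ X | c u = a}} ≤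
        10 + if 2 ≤ k ∧ bnbr H B y = bnbr H B w then 8 else 0 := by
    intro y hy
    have h3 := mul_card_frequent_le (nbr H y \ X) c (threshold H B X k y w)
    have h4 := card_inter_add_card_sdiff (nbr H y) X
    have h5 := hG.card_nbr w (hX hw) y hy
    have h6 : 0 < #(nbr H y ∩ X) :=
      card_pos.2 ⟨w, mem_inter.2 ⟨mem_nbr.2 (mem_qnbr.1 hy).1.symm, hw⟩⟩
    generalize #{a | threshold H B X k y w ≤ #{u ∈ nbr H y \ X | c u = a}} = n at h3 ⊢
    unfold threshold at h3
    split_ifs at h3 with h7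
    · rw [if_pos ⟨h7.1, h7.2.2⟩]
      have : k * n ≤ 2 * (k - 1) * n := Nat.mul_le_mul_right n (by omega)
      rw [mul_assoc] at this
      omega
    · omega
  have h3 : #((qnbr H B w).biUnion fun y =>
      {a | threshold H B X k y w ≤ #{u ∈ nbr H y \ X | c u = a}}) * k ≤
        if 2 ≤ k then 66 else 50 := by
    refine (Nat.mul_le_mul_right k card_biUnion_le).trans ?_
    rw [mul_comm, mul_sum]
    refine (sum_le_sum h2).trans ?_
    rw [sum_add_distrib, ← sum_filter, sum_const, sum_const]
    simp only [smul_eq_mul]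
    split_ifs with hk2
    · have : #{y ∈ qnbr H B w | 2 ≤ k ∧ bnbr H B y = bnbr H B w} ≤ 2 := by
        refine hH.card_le_two_of_bnbr hwB hb.ge _ fun y hy => ?_
        obtain ⟨hy, h⟩ := mem_filter.1 hy
        exact ⟨(mem_qnbr.1 hy).1, h.2.ge⟩
      omega
    · have : #{y ∈ qnbr H B w | 2 ≤ k ∧ bnbr H B y = bnbr H B w} = 0 := by
        rw [card_eq_zero, filter_eq_empty_iff]
        exact fun y _ h => hk2 h.1
      omega
  have h4 : #(forbidden H B X k c w) ≤ _ := card_union_le _ _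
  have := Nat.mul_le_mul_left k h4
  rw [mul_add, mul_comm k #(Finset.biUnion _ _)] at this
  have := Nat.mul_le_mul_left k h1
  omega

theorem IsPartial.of_extension (hG : IsGood H B G) (hX : X ⊆ G) (hk : 1 ≤ k)
    {c₀ c : W → Fin N} (hc₀ : IsPartial H k (univ \ X) c₀) (hoff : ∀ w, w ∉ X → c w = c₀ w)
    {σ τ : W → W} (hστ : ∀ w ∈ X, bnbr H B w = {σ w, τ w})
    (hne : ∀ w ∈ X, ∀ w' ∈ X, σ w ≠ τ w')
    (hforb : ∀ w ∈ X, c w ∉ forbidden H B X k c₀ w)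
    (hconf : ∀ w ∈ X, ∀ w' ∈ X, Conflict H B w w' → c w ≠ c w')
    (hσ : ∀ a u, #{w ∈ X | c w = a ∧ σ w = u} ≤ k - #{x ∈ nbr H u \ X | c₀ x = a})
    (hτ : ∀ a u, #{w ∈ X | c w = a ∧ τ w = u} ≤ k - #{x ∈ nbr H u \ X | c₀ x = a}) :
    IsPartial H k univ c := by
  have hnbr : ∀ w ∈ X, ∀ v, v ∉ X → H.Adj w v → c w ≠ c v := by
    intro w hw v hv h he
    refine hforb w hw (mem_union_left _ (mem_image.2 ⟨v, ?_, ?_⟩))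
    · exact mem_sdiff.2 ⟨mem_nbr.2 h, hv⟩
    · rw [← hoff v hv, he]
  refine ⟨fun u _ v _ h => ?_, fun v a => ?_⟩
  · by_cases hu : u ∈ X <;> by_cases hv : v ∈ X
    · exact hconf u hu v hv ⟨h.ne, hG.eq_of_adj u (hX hu) v (hX hv) h, Or.inl h⟩
    · exact hnbr u hu v hv h
    · exact (hnbr v hv u hu h.symm).symm
    · rw [hoff u hu, hoff v hv]
      exact hc₀.proper u (by simp [hu]) v (by simp [hv]) h
  · have hsplit : #{u ∈ nbr H v ∩ univ | c u = a} =
        #{u ∈ nbr H v ∩ X | c u = a} + #{u ∈ nbr H v \ X | c₀ u = a} := by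
      rw [← card_union_of_disjoint]
      · congr 1
        ext u
        simp only [mem_filter, mem_union, mem_inter, mem_sdiff, mem_univ, and_true]
        by_cases hu : u ∈ X
        · simp [hu]
        · simp [hu, hoff u hu]
      · refine disjoint_left.2 fun u h1 h2 => ?_
        simp only [mem_filter, mem_inter, mem_sdiff] at h1 h2
        exact h2.1.2 h1.1.2
    have hold : #{u ∈ nbr H v \ X | c₀ u = a} ≤ k := by
      refine le_trans (card_le_card fun u hu => ?_) (hc₀.frugal v a)
      simp only [mem_filter, mem_inter, mem_sdiff, mem_univ, true_and] at hu ⊢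
      exact hu
    rw [hsplit]
    by_cases hv : v ∈ B
    · have hmem : ∀ u ∈ X, H.Adj v u → v = σ u ∨ v = τ u := by
        intro u hu h
        have : v ∈ bnbr H B u := mem_bnbr.2 ⟨h.symm, hv⟩
        simpa [hστ u hu] using this
      by_cases hs : ∃ u₀ ∈ X, σ u₀ = v
      · obtain ⟨u₀, hu₀, hv₀⟩ := hs
        have h1 := hσ a v
        have h2 : #{u ∈ nbr H v ∩ X | c u = a} ≤ #{w ∈ X | c w = a ∧ σ w = v} := by
          refine card_le_card fun u hu => ?_
          simp only [mem_filter, mem_inter, mem_nbr] at hu ⊢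
          refine ⟨hu.1.2, hu.2, ((hmem u hu.1.2 hu.1.1).resolve_right fun h => ?_).symm⟩
          exact hne u₀ hu₀ u hu.1.2 (hv₀.trans h)
        omega
      · have h1 := hτ a v
        have h2 : #{u ∈ nbr H v ∩ X | c u = a} ≤ #{w ∈ X | c w = a ∧ τ w = v} := by
          refine card_le_card fun u hu => ?_
          simp only [mem_filter, mem_inter, mem_nbr] at hu ⊢
          refine ⟨hu.1.2, hu.2, ((hmem u hu.1.2 hu.1.1).resolve_left fun h => ?_).symm⟩
          exact hs ⟨u, hu.1.2, h.symm⟩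
        omega
    · have hthr : ∀ w ∈ X, H.Adj v w → c w = a →
          #{u ∈ nbr H v \ X | c₀ u = a} < threshold H B X k v w := by
        intro w hw h hca
        by_contra! hle
        refine hforb w hw (mem_union_right _ (mem_biUnion.2 ⟨v, mem_qnbr.2 ⟨h.symm, hv⟩, ?_⟩))
        simp only [mem_filter, mem_univ, true_and, hca]
        exact hle
      have hle2 : #{u ∈ nbr H v ∩ X | c u = a} ≤ 2 :=
        (card_le_card ((filter_subset _ _).trans (inter_subset_inter_left hX))).trans
          (hG.card_inter v hv)
      rcases Nat.lt_or_ge 1 #{u ∈ nbr H v ∩ X | c u = a} with h2 | h2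
      · obtain ⟨w, hw, w', hw', hww⟩ := one_lt_card.1 h2
        simp only [mem_filter, mem_inter, mem_nbr] at hw hw'
        have heq := hG.eq_of_common w (hX hw.1.2) w' (hX hw'.1.2) v hv hw.1.1 hw'.1.1
        have hvw : bnbr H B v = bnbr H B w := by
          by_contra hvw
          exact hconf w hw.1.2 w' hw'.1.2
            ⟨hww, heq, Or.inr ⟨v, hv, hw.1.1, hw'.1.1, hvw⟩⟩ (hw.2.trans hw'.2.symm)
        have h3 := hthr w hw.1.2 hw.1.1 hw.2
        have h4 : 2 ≤ #(nbr H v ∩ X) := le_trans h2 (card_le_card (filter_subset _ _))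
        rcases Nat.lt_or_ge 1 k with hk2 | hk1
        · rw [threshold, if_pos ⟨hk2, h4, hvw⟩] at h3
          omega
        · have hs : σ w' = σ w := by
            rw [hστ w hw.1.2, hστ w' hw'.1.2] at heq
            have : σ w' ∈ ({σ w, τ w} : Finset W) := heq ▸ mem_insert_self _ _
            exact (mem_insert.1 this).resolve_right fun h =>
              hne w' hw'.1.2 w hw.1.2 (mem_singleton.1 h)
          have h5 : 1 < #{x ∈ X | c x = a ∧ σ x = σ w} := one_lt_card.2
            ⟨w, by simp [hw.1.2, hw.2], w', by simp [hw'.1.2, hw'.2, hs], hww⟩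
          have := hσ a (σ w)
          omega
      · rcases Nat.eq_zero_or_pos #{u ∈ nbr H v ∩ X | c u = a} with h0 | h0
        · omega
        · obtain ⟨w, hw⟩ := card_pos.1 h0
          simp only [mem_filter, mem_inter, mem_nbr] at hw
          have h3 := hthr w hw.1.2 hw.1.1 hw.2
          have : threshold H B X k v w ≤ k := by
            unfold threshold
            split_ifs <;> omega
          omega

end Extension

end PlanarFrugal

namespace PlanarFrugal

open Finset

open scoped Classical

universe u

section Large

variable {W : Type u} [Fintype W] {H : SimpleGraph W} {B G X : Finset W} {N k Δ g : ℕ}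

theorem card_filter_subtype (p : W → Prop) :
    #{e : {w // w ∈ X} | p e.1} = #{w ∈ X | p w} := by
  rw [← card_map (Function.Embedding.subtype _)]
  congr 1
  ext w
  simp only [mem_map, mem_filter, mem_univ, true_and, Function.Embedding.subtype_apply,
    Subtype.exists, exists_and_left, exists_prop, exists_eq_right_right]
  exact and_comm

theorem card_sdiff_add_le {ρ : W → W} (hρ : ∀ w ∈ X, H.Adj w (ρ w)) (hgΔ : g ≤ Δ)
    (hdeg : ∀ v, #(nbr H v) ≤ Δ) {u : W} (hu : #(nbr H u) ≤ g + #{w ∈ X | ρ w = u}) :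
    #(nbr H u \ X) + (#{w ∈ X | ρ w = u} - (Δ - g)) ≤ g := by
  have h1 := card_inter_add_card_sdiff (nbr H u) X
  have h2 : #{w ∈ X | ρ w = u} ≤ #(nbr H u ∩ X) := by
    refine card_le_card fun w hw => ?_
    obtain ⟨hwX, rfl⟩ := mem_filter.1 hw
    exact mem_inter.2 ⟨mem_nbr.2 (hρ w hwX).symm, hwX⟩
  have := hdeg u
  omega

theorem IsPartial.exists_extension (hG : IsGood H B G) (hH : GridMinor H) (hX : X ⊆ G)
    (hdeg : ∀ v, #(nbr H v) ≤ Δ) (hk : 1 ≤ k) (hg : 3 * g ≤ 2 * Δ + 30) (hgΔ : g < Δ)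
    (hN : 5 * Δ + 180 + 54 * k ≤ 3 * (N * k))
    {c₀ : W → Fin N} (hc₀ : IsPartial H k (univ \ X) c₀)
    {σ τ : W → W} (hστ : ∀ w ∈ X, bnbr H B w = {σ w, τ w})
    (hne : ∀ w ∈ X, ∀ w' ∈ X, σ w ≠ τ w')
    (hσ : ∀ w ∈ X, #(nbr H (σ w)) ≤ g + #{w' ∈ X | σ w' = σ w})
    (hτ : ∀ w ∈ X, #(nbr H (τ w)) ≤ g + #{w' ∈ X | τ w' = τ w}) :
    ∃ c : W → Fin N, IsPartial H k univ c := by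
  let Γ : SimpleGraph {w // w ∈ X} :=
    { Adj := fun e e' => Conflict H B e.1 e'.1
      symm := ⟨fun _ _ h => h.symm⟩
      loopless := ⟨fun _ h => h.1 rfl⟩ }
  obtain ⟨f, f', hff, hfr, hfr', hf1, hf2⟩ := exists_blocks Γ fun e => by
    rw [← card_map (Function.Embedding.subtype _)]
    refine hH.card_conflict_le (hG.notMem e.1 (hX e.2)) (hG.card_bnbr e.1 (hX e.2)) ?_
    intro w hw
    obtain ⟨e', he', rfl⟩ := mem_map.1 hw
    exact mem_nbr.1 he'
  obtain ⟨κ, κ', hκ, hκ', hκκ⟩ := exists_keys (fun e : {w // w ∈ X} => σ e.1)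
    (fun e => τ e.1) (R := Δ - g) (by omega)
  have hreach : ∀ e e', Γ.Reachable e e' → bnbr H B e.1 = bnbr H B e'.1 := by
    intro e e' h
    exact (mem_of_reachable (M := Γ) (K := {x | bnbr H B x.1 = bnbr H B e.1})
      (fun a ha b hab => hab.2.1.symm.trans ha) rfl h).symm
  have hσeq : ∀ e e' : {w // w ∈ X}, bnbr H B e.1 = bnbr H B e'.1 → σ e.1 = σ e'.1 := by
    intro e e' h
    rw [hστ _ e.2, hστ _ e'.2] at h
    have : σ e.1 ∈ ({σ e'.1, τ e'.1} : Finset W) := h ▸ mem_insert_self _ _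
    exact (mem_insert.1 this).resolve_right fun h => hne _ e.2 _ e'.2 (mem_singleton.1 h)
  have hτeq : ∀ e e' : {w // w ∈ X}, bnbr H B e.1 = bnbr H B e'.1 → τ e.1 = τ e'.1 := by
    intro e e' h
    rw [hστ _ e.2, hστ _ e'.2] at h
    have : τ e.1 ∈ ({σ e'.1, τ e'.1} : Finset W) :=
      h ▸ mem_insert_of_mem (mem_singleton_self _)
    exact mem_singleton.1 ((mem_insert.1 this).resolve_left fun h => hne _ e'.2 _ e.2 h.symm)
  let s : Side {w // w ∈ X} W := ⟨fun e => σ e.1, κ, f, hκ, fun e e' h =>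
    hσeq e e' (hreach e e' (hfr e e' h))⟩
  let t : Side {w // w ∈ X} W := ⟨fun e => τ e.1, κ', f', hκ', fun e e' h =>
    hτeq e e' (hreach e e' (hfr' e e' h))⟩
  let m : Fin N → W → ℕ := fun a u => #{x ∈ nbr H u \ X | c₀ x = a}
  have hm : ∀ u, ∑ a, m a u = #(nbr H u \ X) := fun u =>
    (card_eq_sum_card_fiberwise fun x _ => mem_coe.2 (mem_univ (c₀ x))).symm
  have hσadj : ∀ w ∈ X, H.Adj w (σ w) := fun w hw =>
    (mem_bnbr.1 (hστ w hw ▸ mem_insert_self _ _)).1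
  have hτadj : ∀ w ∈ X, H.Adj w (τ w) := fun w hw =>
    (mem_bnbr.1 (hστ w hw ▸ mem_insert_of_mem (mem_singleton_self _))).1
  obtain ⟨c, hc1, hc2, hc3, hc4⟩ := exists_assignment s t (N := N) (k := k)
    (fun a u => k - m a u) (fun a u => k - m a u) m m (fun a u => by omega) (fun a u => by omega)
    (fun e => forbidden H B X k c₀ e.1) fun e => by
      have h1 := mul_card_forbidden_le (k := k) hG hH hX c₀ e.2
      have h2 : s.mates e ≤ 1 := by
        refine le_trans (le_of_eq ?_) (hf1 e)
        simp only [Side.mates, s]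
        congr
      have h3 : t.mates e ≤ 2 := by
        refine le_trans (le_of_eq ?_) (hf2 e)
        simp only [Side.mates, t]
        congr
      have h4 := card_sdiff_add_le hσadj hgΔ.le hdeg (hσ e.1 e.2)
      have h5 := card_sdiff_add_le hτadj hgΔ.le hdeg (hτ e.1 e.2)
      have h6 := hκκ e
      rw [card_filter_subtype (fun w => σ w = σ e.1),
        card_filter_subtype (fun w => τ w = τ e.1)] at h6
      have h7 := Nat.mul_le_mul_left k (add_le_add h2 h3)
      rw [hm, hm]
      change _ + _ + (#(nbr H (σ e.1) \ X) + κ e) + (#(nbr H (τ e.1) \ X) + κ' e) < _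
      split_ifs at h1 <;> omega
  have key : ∀ (a : Fin N) (u : W) (ρ : W → W),
      #{w ∈ X | (if h : w ∈ X then c ⟨w, h⟩ else c₀ w) = a ∧ ρ w = u} =
        {e : {w // w ∈ X} | c e = a ∧ ρ e.1 = u}.ncard := by
    intro a u ρ
    have h := card_filter_subtype (X := X)
      (fun w => (if h : w ∈ X then c ⟨w, h⟩ else c₀ w) = a ∧ ρ w = u)
    rw [Set.ncard_eq_toFinset_card']
    refine Eq.trans ?_ (h.symm.trans (congrArg card ?_))
    · congr
    · ext e
      simp
  refine ⟨fun w => if h : w ∈ X then c ⟨w, h⟩ else c₀ w,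
    IsPartial.of_extension hG hX hk hc₀ (fun w hw => by simp [hw]) hστ hne ?_ ?_ ?_ ?_⟩
  · intro w hw
    simpa [hw] using hc1 ⟨w, hw⟩
  · intro w hw w' hw' h
    have := hc2 ⟨w, hw⟩ ⟨w', hw'⟩ (fun h' => h.1 (congrArg Subtype.val h')) (hff _ _ h)
    simpa [hw, hw'] using this
  · intro a u
    exact (key a u σ).trans_le (hc3 a u)
  · intro a u
    exact (key a u τ).trans_le (hc4 a u)

theorem exists_colouring_of_large (hH : GridMinor H) (hdeg : ∀ v, #(nbr H v) ≤ Δ) (hk : 1 ≤ k)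
    (hΔ : 96 ≤ Δ) (hN : 5 * Δ + 180 + 54 * k ≤ 3 * (N * k))
    (ih : ColourableBelow.{u} (Fintype.card W) Δ N k) [Nonempty W] :
    ∃ c : W → Fin N, IsPartial H k univ c := by
  obtain ⟨B, hB⟩ : ∃ B : Finset W, ∀ v, v ∈ B ↔ 33 ≤ #(nbr H v) :=
    ⟨({v | 33 ≤ #(nbr H v)} : Finset W), fun v => by simp⟩
  by_cases hred : ∃ v, v ∉ B ∧ #(bnbr H B v) ≤ 1 ∧ #(bnbr H B v) + #(qnbr H B v) ≤ 5
  · obtain ⟨w, hw, hb, hq⟩ := hred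
    have hn := card_nbr_eq (H := H) (B := B) w
    refine exists_colouring_of_reducible hH hdeg hk hN ih (w := w) ?_ (by omega) ?_
    · rcases (qnbr H B w).eq_empty_or_nonempty with hq0 | ⟨x, hx⟩
      · rcases (nbr H w).eq_empty_or_nonempty with h | ⟨x, hx⟩
        · exact Or.inl h
        · have := hdeg x
          rw [hq0, card_empty] at hn
          exact Or.inr ⟨x, mem_nbr.1 hx, by omega⟩
      · obtain ⟨hx, hxB⟩ := mem_qnbr.1 hx
        rw [hB] at hxB
        exact Or.inr ⟨x, hx, by omega⟩
    · have h1 : ∑ u ∈ nbr H w, (#(nbr H u) - 1) =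
          ∑ u ∈ bnbr H B w, (#(nbr H u) - 1) + ∑ u ∈ qnbr H B w, (#(nbr H u) - 1) :=
        (sum_inter_add_sum_sdiff (nbr H w) B _).symm
      have h2 : ∑ u ∈ bnbr H B w, (#(nbr H u) - 1) ≤ #(bnbr H B w) * (Δ - 1) :=
        sum_le_card_nsmul _ _ _ fun u _ => Nat.sub_le_sub_right (hdeg u) 1
      have h3 : ∑ u ∈ qnbr H B w, (#(nbr H u) - 1) ≤ #(qnbr H B w) * 31 :=
        sum_le_card_nsmul _ _ _ fun u hu => by
          have := (mem_qnbr.1 hu).2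
          rw [hB] at this
          omega
      rw [h1]
      interval_cases #(bnbr H B w) <;> omega
  · push Not at hred
    have hBne : B.Nonempty := by
      by_contra hB0
      rw [not_nonempty_iff_eq_empty] at hB0
      have h1 := hH.sum_nbr_inter_lt (S := univ) univ_nonempty
      have h2 : ∑ _v : W, 6 ≤ ∑ v, #(nbr H v ∩ univ) := by
        refine sum_le_sum fun v _ => ?_
        have h0 : #(bnbr H B v) = 0 := by simp [bnbr, hB0]
        have := hred v (by simp [hB0]) (by omega)
        rw [inter_univ, card_nbr_eq (B := B)]
        omega
      rw [sum_const, smul_eq_mul] at h2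
      omega
    obtain ⟨G, hG, hsum⟩ := exists_isGood hH hBne
      (fun v hv h => by have := hred v hv (by omega); omega)
      (fun v hv h => by have := hred v hv (by omega); omega)
    obtain ⟨X, σ, τ, hX, ⟨w, hw⟩, hστ, hne, hσ, hτ⟩ :=
      hG.exists_dense hH hBne (g := 2 * Δ / 3 + 10) hdeg (by omega) (fun v hv => (hB v).1 hv) hsum
    have hb := hG.card_bnbr w (hX hw)
    have hq := hG.card_qnbr w (hX hw)
    have hn := card_nbr_eq (H := H) (B := B) w
    obtain ⟨x, hwx, hd⟩ : ∃ x, H.Adj w x ∧ #(nbr H w) + #(nbr H x) ≤ Δ + 2 := by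
      rcases (qnbr H B w).eq_empty_or_nonempty with hq0 | ⟨x, hx⟩
      · rw [hq0, card_empty] at hn
        have h : σ w ∈ bnbr H B w := by simp [hστ w hw]
        have := hdeg (σ w)
        exact ⟨σ w, (mem_bnbr.1 h).1, by omega⟩
      · have := hG.card_nbr w (hX hw) x hx
        exact ⟨x, (mem_qnbr.1 hx).1, by omega⟩
    obtain ⟨c₀, hc₀⟩ := exists_isPartial_of_contract hH hdeg hk ih hwx hd
    exact IsPartial.exists_extension hG hH hX hdeg hk (g := 2 * Δ / 3 + 10) (by omega) (by omega)
      hN (hc₀.mono fun v hv => mem_erase.2 ⟨fun h : v = w => (mem_sdiff.1 hv).2 (h ▸ hw),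
        mem_univ v⟩) hστ hne hσ hτ

end Large

theorem exists_colouring {N k Δ : ℕ} (hk : 1 ≤ k) (hN : 5 * Δ + 180 + 54 * k ≤ 3 * (N * k))
    (n : ℕ) : ColourableBelow.{u} n Δ N k := by
  induction n with
  | zero => exact fun W _ H h => (Nat.not_lt_zero _ h).elim
  | succ n ih =>
    intro W _ H hn hH hdeg
    have ih' : ColourableBelow.{u} (Fintype.card W) Δ N k := fun W' _ H' h =>
      ih W' H' (by omega)
    rcases isEmpty_or_nonempty W with hW | hW
    · exact ⟨fun w => hW.elim w, fun u => hW.elim u, fun v => hW.elim v⟩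
    · by_cases h1 : Δ ≤ 13
      · exact exists_colouring_of_small hH hdeg hk h1 hN
      · by_cases h2 : Δ ≤ 95
        · exact exists_colouring_of_medium hH hdeg hk (by omega) h2 hN ih'
        · exact exists_colouring_of_large hH hdeg hk (by omega) hN ih'

end PlanarFrugal

/-- For any planar graph `G` and `k ≥ 1`, `χ_k(G) ≤ ⌈(5Δ(G) + 180)/(3k)⌉ + 18`
(the ceiling `⌈a/b⌉` is written `(a + b - 1)/b` in natural-number arithmetic). -/
theorem frugalChromaticNumber_planar_le {V : Type*} [Fintype V] (G : SimpleGraph V)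
    [DecidableRel G.Adj] (hG : G.IsPlanar) (k : ℕ) (hk : 1 ≤ k) :
    G.frugalChromaticNumber k ≤ (5 * G.maxDegree + 180 + (3 * k - 1)) / (3 * k) + 18 := by
  classical
  set N := (5 * G.maxDegree + 180 + (3 * k - 1)) / (3 * k) + 18 with hNdef
  have hN : 5 * G.maxDegree + 180 + 54 * k ≤ 3 * (N * k) := by
    have h1 := Nat.div_add_mod (5 * G.maxDegree + 180 + (3 * k - 1)) (3 * k)
    have h2 := Nat.mod_lt (5 * G.maxDegree + 180 + (3 * k - 1)) (y := 3 * k) (by omega)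
    have h3 : 3 * (N * k) =
        3 * k * ((5 * G.maxDegree + 180 + (3 * k - 1)) / (3 * k)) + 54 * k := by
      rw [hNdef]
      ring
    omega
  obtain ⟨c, hc⟩ := PlanarFrugal.exists_colouring hk hN (Fintype.card V + 1) V G
    (Nat.lt_succ_self _) (PlanarFrugal.GridMinor.of_isPlanar hG) fun v => by
      refine le_trans (le_of_eq ?_) (G.degree_le_maxDegree v)
      rw [← SimpleGraph.card_neighborFinset_eq_degree]
      congr 1
      ext u
      simp
  refine Nat.sInf_le ⟨fun v => (c v).val, fun v => (c v).isLt, fun u v h he => ?_, fun v a => ?_⟩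
  · exact hc.proper u (Finset.mem_univ u) v (Finset.mem_univ v) h (Fin.ext he)
  · by_cases ha : a < N
    · refine le_trans (le_of_eq ?_) (hc.frugal v ⟨a, ha⟩)
      rw [Set.ncard_eq_toFinset_card']
      congr 1
      ext u
      simp [Fin.ext_iff]
    · have : {u | u ∈ G.neighborSet v ∧ (c u).val = a} = ∅ := by
        refine Set.eq_empty_of_forall_notMem fun u hu => ha ?_
        rw [← hu.2]
        exact (c u).isLt
      rw [this]
      simp
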